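/- Let n ≥ 3 and let A, B ⊆ S^{n-1} be Lebesgue measurable sets with non-empty interiors (relative to the sphere) and of the same measure. Then there exist sets A′, B′ ⊆ S^{n-1} of measure zero such that A \ A′ and B \ B′ are equidecomposable using rotations with pieces that are Borel; that is, there exist m ∈ ℕ, rotations γ₁,…,γ_m ∈ SO(n), and partitions A \ A′ = A₁ ⊔ … ⊔ A_m and B \ B′ = B₁ ⊔ … ⊔ B_m into Borel pieces such that γᵢ(Aᵢ) = Bᵢ for each i ∈ {1,…,m}. -/

import Mathlib

open MeasureTheory Set Metric
open scoped ENNReal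

noncomputable section

/-- `n`-dimensional Euclidean space `ℝⁿ`. -/
abbrev EucSp (n : ℕ) : Type := EuclideanSpace ℝ (Fin n)

/-- The unit sphere `S^{n-1} ⊆ ℝⁿ`. -/
abbrev Sph (n : ℕ) : Type := Metric.sphere (0 : EucSp n) 1

/-- A linear isometry of `ℝⁿ` is a rotation (an element of `SO(n)`) if it has determinant `1`. -/
def IsRotation {n : ℕ} (γ : EucSp n ≃ₗᵢ[ℝ] EucSp n) : Prop :=
  LinearMap.det (γ.toLinearEquiv.toLinearMap) = 1

/-- The action of a linear isometry of `ℝⁿ` on the unit sphere `S^{n-1}`. -/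
def rotateSphere {n : ℕ} (γ : EucSp n ≃ₗᵢ[ℝ] EucSp n) (x : Sph n) : Sph n :=
  ⟨γ x, by
    have hx : ‖(x : EucSp n)‖ = 1 := by
      have h := x.2
      rwa [Metric.mem_sphere, dist_zero_right] at h
    rw [Metric.mem_sphere, dist_zero_right, γ.norm_map]
    exact hx⟩

/-- **Ekeland's variational principle**, in the form of a Caristi-type statement for a function `φ`
on a set with a distance `d` such that sequences with summable steps converge. -/
theorem exists_forall_le_of_dist_le_sub {α : Type*} [Nonempty α] (d : α → α → ℝ) (φ : α → ℝ)
    (hd0 : ∀ a, d a a = 0) (hdn : ∀ a b, 0 ≤ d a b)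
    (htri : ∀ a b c, d a c ≤ d a b + d b c) (hφ : ∀ a, 0 ≤ φ a)
    (hlim : ∀ s : ℕ → α, Summable (fun n => d (s n) (s (n + 1))) →
      ∃ a, Filter.Tendsto (fun n => d (s n) a) Filter.atTop (nhds 0) ∧
        Filter.Tendsto (fun n => φ (s n)) Filter.atTop (nhds (φ a))) :
    ∃ a, ∀ b, d a b ≤ φ a - φ b → φ a ≤ φ b := by
  have hbdd : ∀ a, BddBelow (φ '' {b | d a b ≤ φ a - φ b}) := fun a =>
    ⟨0, by rintro _ ⟨b, -, rfl⟩; exact hφ b⟩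
  have hne : ∀ a, (φ '' {b | d a b ≤ φ a - φ b}).Nonempty := fun a =>
    ⟨φ a, a, by simp [hd0], rfl⟩
  have hstep : ∀ (n : ℕ) (a : α), ∃ b, d a b ≤ φ a - φ b ∧
      φ b ≤ sInf (φ '' {b | d a b ≤ φ a - φ b}) + (1 / 2 : ℝ) ^ n := by
    intro n a
    obtain ⟨_, ⟨b, hb, rfl⟩, hlt⟩ := exists_lt_of_csInf_lt (hne a)
      (lt_add_of_pos_right (sInf (φ '' {b | d a b ≤ φ a - φ b})) (by positivity : (0:ℝ) < (1/2)^n))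
    exact ⟨b, hb, hlt.le⟩
  choose next hnext1 hnext2 using hstep
  let s : ℕ → α := fun n => Nat.rec (Classical.arbitrary α) (fun n a => next n a) n
  have hs : ∀ n, s (n + 1) = next n (s n) := fun n => rfl
  have hs1 : ∀ n, d (s n) (s (n + 1)) ≤ φ (s n) - φ (s (n + 1)) := fun n => by
    rw [hs]; exact hnext1 n (s n)
  have hsum : Summable (fun n => d (s n) (s (n + 1))) := by
    refine summable_of_sum_range_le (c := φ (s 0)) (fun n => hdn _ _) fun n => ?_
    calc ∑ i ∈ Finset.range n, d (s i) (s (i + 1))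
        ≤ ∑ i ∈ Finset.range n, (φ (s i) - φ (s (i + 1))) := Finset.sum_le_sum fun i _ => hs1 i
      _ = φ (s 0) - φ (s n) := Finset.sum_range_sub' (fun i => φ (s i)) n
      _ ≤ φ (s 0) := by linarith [hφ (s n)]
  obtain ⟨a, ha, hφa⟩ := hlim s hsum
  refine ⟨a, fun b hb => ?_⟩
  have hchain : ∀ n k, d (s n) (s (n + k)) ≤ φ (s n) - φ (s (n + k)) := by
    intro n k
    induction k with
    | zero => simp [hd0]
    | succ k ih =>
      have := htri (s n) (s (n + k)) (s (n + k + 1))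
      have h2 := hs1 (n + k)
      rw [← add_assoc]; linarith
  have hna : ∀ n, d (s n) a ≤ φ (s n) - φ a := by
    intro n
    have hle : ∀ k, d (s n) a ≤ φ (s n) - φ (s (k + n)) + d (s (k + n)) a := fun k => by
      have := htri (s n) (s (n + k)) a
      have h2 := hchain n k
      rw [add_comm k n]; linarith
    have h1 := (Filter.tendsto_add_atTop_iff_nat n).2 ha
    have h2 := (Filter.tendsto_add_atTop_iff_nat n).2 hφa
    have h3 := (h2.const_sub (φ (s n))).add h1
    rw [add_zero] at h3
    exact ge_of_tendsto' h3 hle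
  have hmem : ∀ n, φ (s (n + 1)) ≤ φ b + (1 / 2 : ℝ) ^ n := by
    intro n
    have hin : φ b ∈ φ '' {b | d (s n) b ≤ φ (s n) - φ b} :=
      ⟨b, by have := htri (s n) a b; have := hna n; simp only [mem_ofPred_eq]; linarith, rfl⟩
    have h1 := csInf_le (hbdd (s n)) hin
    have h2 := hnext2 n (s n)
    rw [hs]; linarith
  have h4 : Filter.Tendsto (fun n => φ b + (1 / 2 : ℝ) ^ n) Filter.atTop (nhds (φ b + 0)) :=
    tendsto_const_nhds.add (tendsto_pow_atTop_nhds_zero_of_lt_one (by norm_num) (by norm_num))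
  rw [add_zero] at h4
  exact le_of_tendsto_of_tendsto' ((Filter.tendsto_add_atTop_iff_nat 1).2 hφa) h4 hmem

/-- A measurable matching between `A` and `B` along the finitely many maps `τ i`: the point `x` of
`piece i ⊆ A` is matched to the point `τ i x` of `B`. -/
structure MeasMatching {X ι : Type*} [MeasurableSpace X] (τ : ι → X ≃ᵐ X) (A B : Set X) where
  /-- the points of `A` that are moved by `τ i` -/
  piece : ι → Set X
  measurableSet_piece : ∀ i, MeasurableSet (piece i)
  mem_left : ∀ i, ∀ x ∈ piece i, x ∈ A
  mem_right : ∀ i, ∀ x ∈ piece i, τ i x ∈ B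
  eq_of_mem : ∀ i j, ∀ x ∈ piece i, x ∈ piece j → i = j
  eq_of_apply_eq : ∀ i j, ∀ x ∈ piece i, ∀ y ∈ piece j, τ i x = τ j y → i = j

namespace MeasMatching

variable {X ι : Type*} [MeasurableSpace X] {τ : ι → X ≃ᵐ X} {A B : Set X}

instance : Nonempty (MeasMatching τ A B) :=
  ⟨⟨fun _ => ∅, by simp, by simp, by simp, by simp, by simp⟩⟩

/-- The points of `A` that are not matched. -/
def freeLeft (M : MeasMatching τ A B) : Set X := A \ ⋃ i, M.piece i

/-- The points of `B` that are not matched. -/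
def freeRight (M : MeasMatching τ A B) : Set X := B \ ⋃ i, τ i '' M.piece i

variable [Fintype ι]

/-- The distance of two matchings: the total measure of the changes of the pieces. -/
noncomputable def cost (μ : Measure X) (M N : MeasMatching τ A B) : ℝ :=
  ∑ i, μ.real (symmDiff (M.piece i) (N.piece i))

theorem cost_self (μ : Measure X) (M : MeasMatching τ A B) : cost μ M M = 0 := by
  simp [cost]

theorem cost_nonneg (μ : Measure X) (M N : MeasMatching τ A B) : 0 ≤ cost μ M N :=
  Finset.sum_nonneg fun _ _ => measureReal_nonneg

theorem cost_triangle (μ : Measure X) [IsFiniteMeasure μ] (M N K : MeasMatching τ A B) :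
    cost μ M K ≤ cost μ M N + cost μ N K := by
  simp only [cost, ← Finset.sum_add_distrib]
  refine Finset.sum_le_sum fun i _ => ?_
  exact (measureReal_mono (symmDiff_triangle _ (N.piece i) _)).trans (measureReal_union_le _ _)

theorem measurableSet_freeLeft (M : MeasMatching τ A B) (hA : MeasurableSet A) :
    MeasurableSet M.freeLeft :=
  hA.diff (MeasurableSet.iUnion M.measurableSet_piece)

theorem measurableSet_freeRight (M : MeasMatching τ A B) (hB : MeasurableSet B) :
    MeasurableSet M.freeRight :=
  hB.diff (MeasurableSet.iUnion fun i => (τ i).measurableSet_image.2 (M.measurableSet_piece i))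

theorem abs_freeLeft_sub_le (μ : Measure X) [IsFiniteMeasure μ] (M N : MeasMatching τ A B) :
    |μ.real M.freeLeft - μ.real N.freeLeft| ≤ cost μ M N := by
  have key : ∀ M N : MeasMatching τ A B,
      μ.real M.freeLeft ≤ μ.real N.freeLeft + cost μ M N := by
    intro M N
    have hsub : M.freeLeft ⊆ N.freeLeft ∪ ⋃ i, symmDiff (M.piece i) (N.piece i) := by
      rintro x ⟨hxA, hx⟩
      by_cases h : ∃ i, x ∈ N.piece i
      · obtain ⟨i, hi⟩ := h
        refine Or.inr (mem_iUnion.2 ⟨i, Or.inr ⟨hi, fun h => hx (mem_iUnion.2 ⟨i, h⟩)⟩⟩)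
      · exact Or.inl ⟨hxA, by simpa using h⟩
    calc _ ≤ μ.real (N.freeLeft ∪ ⋃ i, symmDiff (M.piece i) (N.piece i)) := measureReal_mono hsub
      _ ≤ μ.real N.freeLeft + μ.real (⋃ i, symmDiff (M.piece i) (N.piece i)) :=
        measureReal_union_le _ _
      _ ≤ _ := by
        gcongr
        exact measureReal_iUnion_fintype_le _
  rw [abs_le]
  have h1 := key M N
  have h2 := key N M
  have h3 : cost μ N M = cost μ M N := by simp only [cost, symmDiff_comm]
  constructor <;> linarith

/-- Sequences of matchings with summable changes converge. -/
theorem exists_tendsto_cost (μ : Measure X) [IsFiniteMeasure μ] (s : ℕ → MeasMatching τ A B)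
    (hs : Summable fun n => cost μ (s n) (s (n + 1))) :
    ∃ M, Filter.Tendsto (fun n => cost μ (s n) M) Filter.atTop (nhds 0) := by
  let P : ι → Set X := fun i => ⋃ n, ⋂ k, (s (n + k)).piece i
  have hP : ∀ i x, x ∈ P i ↔ ∃ n, ∀ m, n ≤ m → x ∈ (s m).piece i := by
    intro i x
    simp only [P, mem_iUnion, mem_iInter]
    constructor
    · rintro ⟨n, h⟩
      exact ⟨n, fun m hm => by simpa [Nat.add_sub_cancel' hm] using h (m - n)⟩
    · rintro ⟨n, h⟩
      exact ⟨n, fun k => h _ (by omega)⟩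
  let M : MeasMatching τ A B :=
    { piece := P
      measurableSet_piece := fun i => MeasurableSet.iUnion fun n => MeasurableSet.iInter fun k =>
        (s (n + k)).measurableSet_piece i
      mem_left := fun i x hx => by
        obtain ⟨n, h⟩ := (hP i x).1 hx
        exact (s n).mem_left i x (h n le_rfl)
      mem_right := fun i x hx => by
        obtain ⟨n, h⟩ := (hP i x).1 hx
        exact (s n).mem_right i x (h n le_rfl)
      eq_of_mem := fun i j x hi hj => by
        obtain ⟨n, h⟩ := (hP i x).1 hi
        obtain ⟨m, h'⟩ := (hP j x).1 hj
        exact (s (max n m)).eq_of_mem i j x (h _ (le_max_left _ _)) (h' _ (le_max_right _ _))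
      eq_of_apply_eq := fun i j x hi y hj hxy => by
        obtain ⟨n, h⟩ := (hP i x).1 hi
        obtain ⟨m, h'⟩ := (hP j y).1 hj
        exact (s (max n m)).eq_of_apply_eq i j x (h _ (le_max_left _ _)) y
          (h' _ (le_max_right _ _)) hxy }
  refine ⟨M, ?_⟩
  let D : ι → ℕ → Set X := fun i n => symmDiff ((s n).piece i) ((s (n + 1)).piece i)
  have hD : ∀ i, Summable fun n => μ.real (D i n) := fun i =>
    Summable.of_nonneg_of_le (fun _ => measureReal_nonneg)
      (fun n => Finset.single_le_sum (f := fun i => μ.real (D i n))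
        (fun _ _ => measureReal_nonneg) (Finset.mem_univ i)) hs
  have hsub : ∀ i n, symmDiff ((s n).piece i) (P i) ⊆ ⋃ k, D i (k + n) := by
    intro i n x hx
    by_contra hcon
    have hconst : ∀ k, x ∈ (s (n + k)).piece i ↔ x ∈ (s n).piece i := by
      intro k
      induction k with
      | zero => rfl
      | succ k ih =>
        rw [← ih]
        have : x ∉ D i (k + n) := fun h => hcon (mem_iUnion.2 ⟨k, h⟩)
        simp only [D, mem_symmDiff] at this
        rw [add_comm k n] at this
        have e : n + (k + 1) = n + k + 1 := by ring
        rw [e]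
        tauto
    rcases hx with ⟨h1, h2⟩ | ⟨h1, h2⟩
    · refine h2 ((hP i x).2 ⟨n, fun m hm => ?_⟩)
      have := (hconst (m - n)).2 h1
      rwa [Nat.add_sub_cancel' hm] at this
    · obtain ⟨m, hm⟩ := (hP i x).1 h1
      exact h2 ((hconst m).1 (hm _ (by omega)))
  have hle : ∀ i n, μ.real (symmDiff ((s n).piece i) (P i)) ≤ ∑' k, μ.real (D i (k + n)) := by
    intro i n
    have hsum := (summable_nat_add_iff n).2 (hD i)
    have h1 : μ (⋃ k, D i (k + n)) ≤ ENNReal.ofReal (∑' k, μ.real (D i (k + n))) := by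
      refine (measure_iUnion_le _).trans (le_of_eq ?_)
      rw [ENNReal.ofReal_tsum_of_nonneg (fun _ => measureReal_nonneg) hsum]
      exact tsum_congr fun k => (ofReal_measureReal).symm
    refine (measureReal_mono (hsub i n)).trans ?_
    exact ENNReal.toReal_le_of_le_ofReal (tsum_nonneg fun _ => measureReal_nonneg) h1
  have h0 : Filter.Tendsto (fun n => ∑ i, ∑' k, μ.real (D i (k + n))) Filter.atTop (nhds 0) := by
    have := tendsto_finsetSum (Finset.univ : Finset ι)
      (fun i _ => tendsto_sum_nat_add fun n => μ.real (D i n))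
    simpa using this
  exact squeeze_zero (fun n => cost_nonneg μ _ _) (fun n => Finset.sum_le_sum fun i _ => hle i n) h0

open Classical in
/-- Rematch the points of `U`, which are moved by `t` or are not matched at all, using `τ s`. -/
noncomputable def rematch (M : MeasMatching τ A B) (U : Set X) (s : ι) (hU : MeasurableSet U)
    (hUA : U ⊆ A) (hUB : τ s '' U ⊆ M.freeRight) : MeasMatching τ A B where
  piece i := (M.piece i \ U) ∪ (if i = s then U else ∅)
  measurableSet_piece i := by
    refine ((M.measurableSet_piece i).diff hU).union ?_
    split_ifs
    exacts [hU, MeasurableSet.empty]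
  mem_left i x hx := by
    rcases hx with hx | hx
    · exact M.mem_left i x hx.1
    · split_ifs at hx
      · exact hUA hx
      · exact hx.elim
  mem_right i x hx := by
    rcases hx with hx | hx
    · exact M.mem_right i x hx.1
    · split_ifs at hx with h
      · subst h; exact (hUB ⟨x, hx, rfl⟩).1
      · exact hx.elim
  eq_of_mem i j x hi hj := by
    rcases hi with hi | hi <;> rcases hj with hj | hj
    · exact M.eq_of_mem i j x hi.1 hj.1
    · split_ifs at hj
      · exact (hi.2 hj).elim
      · exact hj.elim
    · split_ifs at hi
      · exact (hj.2 hi).elim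
      · exact hi.elim
    · split_ifs at hi hj with h1 h2
      · exact h1.trans h2.symm
      all_goals first | exact hj.elim | exact hi.elim
  eq_of_apply_eq i j x hi y hj hxy := by
    rcases hi with hi | hi <;> rcases hj with hj | hj
    · exact M.eq_of_apply_eq i j x hi.1 y hj.1 hxy
    · split_ifs at hj with h
      · subst h
        exact ((hUB ⟨y, hj, rfl⟩).2 (mem_iUnion.2 ⟨i, x, hi.1, hxy⟩)).elim
      · exact hj.elim
    · split_ifs at hi with h
      · subst h
        exact ((hUB ⟨x, hi, rfl⟩).2 (mem_iUnion.2 ⟨j, y, hj.1, hxy.symm⟩)).elim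
      · exact hi.elim
    · split_ifs at hi hj with h1 h2
      · exact h1.trans h2.symm
      all_goals first | exact hj.elim | exact hi.elim

section rematch

variable (M : MeasMatching τ A B) {U : Set X} {s : ι} (hU : MeasurableSet U)
    (hUA : U ⊆ A) (hUB : τ s '' U ⊆ M.freeRight)

omit [Fintype ι] in
theorem mem_rematch_of_notMem {x : X} (hx : x ∉ U) (i : ι) :
    x ∈ (M.rematch U s hU hUA hUB).piece i ↔ x ∈ M.piece i := by
  classical
  simp only [rematch, mem_union, mem_sdiff]
  split_ifs <;> simp [hx]

omit [Fintype ι] in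
theorem mem_rematch_of_mem {x : X} (hx : x ∈ U) (i : ι) :
    x ∈ (M.rematch U s hU hUA hUB).piece i ↔ i = s := by
  classical
  simp only [rematch, mem_union, mem_sdiff]
  split_ifs with h <;> simp [hx, h]

theorem cost_rematch_le (μ : Measure X) [IsFiniteMeasure μ] (t : ι)
    (ht : ∀ i, ∀ x ∈ U, x ∈ M.piece i → i = t) :
    cost μ M (M.rematch U s hU hUA hUB) ≤ 2 * μ.real U := by
  classical
  have h1 : ∀ i, symmDiff (M.piece i) ((M.rematch U s hU hUA hUB).piece i) ⊆
      (if i = t then U else ∅) ∪ (if i = s then U else ∅) := by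
    intro i x hx
    by_cases hxU : x ∈ U
    · rw [mem_symmDiff, M.mem_rematch_of_mem hU hUA hUB hxU] at hx
      rcases hx with ⟨h, -⟩ | ⟨h, -⟩
      · left; simp [ht i x hxU h, hxU]
      · right; simp [h, hxU]
    · rw [mem_symmDiff, M.mem_rematch_of_notMem hU hUA hUB hxU] at hx
      tauto
  have h2 : ∀ t : ι, ∑ i, μ.real (if i = t then U else ∅) = μ.real U := by
    intro t
    rw [Finset.sum_eq_single t] <;> simp +contextual
  calc cost μ M (M.rematch U s hU hUA hUB)
      ≤ ∑ i, (μ.real (if i = t then U else ∅) + μ.real (if i = s then U else ∅)) :=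
        Finset.sum_le_sum fun i _ => (measureReal_mono (h1 i)).trans (measureReal_union_le _ _)
    _ = 2 * μ.real U := by rw [Finset.sum_add_distrib, h2, h2]; ring

end rematch

end MeasMatching

namespace MeasMatching

variable {X ι : Type*} [MeasurableSpace X] {τ : ι → X ≃ᵐ X} {A B : Set X}

/-- The points of `A` from which an unmatched point of `A` can be reached by at most `k`
alternating steps. -/
def reach (M : MeasMatching τ A B) : ℕ → Set X
  | 0 => M.freeLeft
  | k + 1 => M.freeLeft ∪ ⋃ t, M.piece t ∩ τ t ⁻¹' ⋃ s, τ s '' M.reach k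

theorem reach_subset_succ (M : MeasMatching τ A B) (k : ℕ) : M.reach k ⊆ M.reach (k + 1) := by
  induction k with
  | zero => exact subset_union_left
  | succ k ih =>
    refine union_subset_union_right _ (iUnion_mono fun t => inter_subset_inter_right _ ?_)
    exact preimage_mono (iUnion_mono fun s => image_mono ih)

theorem reach_subset (M : MeasMatching τ A B) (k : ℕ) : M.reach k ⊆ A := by
  cases k with
  | zero => exact sdiff_subset
  | succ k =>
    refine union_subset sdiff_subset (iUnion_subset fun t x hx => M.mem_left t x hx.1)

variable [Fintype ι]

theorem measurableSet_reach (M : MeasMatching τ A B) (hA : MeasurableSet A) (k : ℕ) :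
    MeasurableSet (M.reach k) := by
  induction k with
  | zero => exact M.measurableSet_freeLeft hA
  | succ k ih =>
    refine (M.measurableSet_freeLeft hA).union (MeasurableSet.iUnion fun t => ?_)
    refine (M.measurableSet_piece t).inter ((τ t).measurable ?_)
    exact MeasurableSet.iUnion fun s => (τ s).measurableSet_image.2 ih

theorem measure_reach_succ_ge (M : MeasMatching τ A B) (μ : Measure X) [IsFiniteMeasure μ]
    (hτ : ∀ i, MeasurePreserving (τ i) μ μ) (hA : MeasurableSet A) (k : ℕ)
    (h0 : μ ((⋃ s, τ s '' M.reach k) ∩ M.freeRight) = 0) :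
    μ.real M.freeLeft + μ.real ((⋃ s, τ s '' M.reach k) ∩ B) ≤ μ.real (M.reach (k + 1)) := by
  set N := ⋃ s, τ s '' M.reach k with hN
  have hNm : MeasurableSet N :=
    MeasurableSet.iUnion fun s => (τ s).measurableSet_image.2 (M.measurableSet_reach hA k)
  have hm : ∀ t, MeasurableSet (M.piece t ∩ τ t ⁻¹' N) := fun t =>
    (M.measurableSet_piece t).inter ((τ t).measurable hNm)
  have h1 : μ.real (N ∩ B) ≤ ∑ t, μ.real (M.piece t ∩ τ t ⁻¹' N) := by
    have hsub : N ∩ B ⊆ (⋃ t, τ t '' (M.piece t ∩ τ t ⁻¹' N)) ∪ (N ∩ M.freeRight) := by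
      rintro y ⟨hyN, hyB⟩
      by_cases h : y ∈ ⋃ i, τ i '' M.piece i
      · obtain ⟨i, x, hx, rfl⟩ := mem_iUnion.1 h
        exact Or.inl (mem_iUnion.2 ⟨i, x, ⟨hx, hyN⟩, rfl⟩)
      · exact Or.inr ⟨hyN, hyB, h⟩
    calc μ.real (N ∩ B) ≤ _ := measureReal_mono hsub
      _ ≤ μ.real (⋃ t, τ t '' (M.piece t ∩ τ t ⁻¹' N)) + μ.real (N ∩ M.freeRight) :=
        measureReal_union_le _ _
      _ = μ.real (⋃ t, τ t '' (M.piece t ∩ τ t ⁻¹' N)) := by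
        rw [measureReal_def μ (N ∩ _), h0]; simp
      _ ≤ ∑ t, μ.real (τ t '' (M.piece t ∩ τ t ⁻¹' N)) := measureReal_iUnion_fintype_le _
      _ = _ := by
        refine Finset.sum_congr rfl fun t _ => ?_
        rw [← (hτ t).measureReal_preimage
          ((τ t).measurableSet_image.2 (hm t)).nullMeasurableSet,
          preimage_image_eq _ (τ t).injective]
  have h2 : μ.real (M.reach (k + 1)) =
      μ.real M.freeLeft + ∑ t, μ.real (M.piece t ∩ τ t ⁻¹' N) := by
    have hd : Disjoint M.freeLeft (⋃ t, M.piece t ∩ τ t ⁻¹' N) := by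
      rw [disjoint_left]
      rintro x ⟨-, hx⟩ hx'
      obtain ⟨t, ht⟩ := mem_iUnion.1 hx'
      exact hx (mem_iUnion.2 ⟨t, ht.1⟩)
    rw [reach, measureReal_union hd (MeasurableSet.iUnion hm)]
    congr 1
    refine measureReal_iUnion_fintype ?_ hm
    intro i j hij
    refine disjoint_left.2 fun x hx hx' => hij (M.eq_of_mem i j x hx.1 hx'.1)
  linarith

theorem exists_lt_of_growth {u a : ℝ} {f : ℕ → ℝ} (hu : 0 < u) (hf0 : u ≤ f 0)
    (hfa : ∀ k, f k ≤ a) {K : ℕ} (hK : 1 ≤ K) (hKu : a ≤ 2 ^ K * u)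
    (h1 : ∀ k < 2 * K, f k ≤ a / 3 → u + 2 * f k ≤ f (k + 1))
    (h2 : ∀ k < 2 * K, a / 3 < f k → a - f (k + 1) ≤ (a - f k) / 2 - u) : False := by
  have ha : 0 < a := hu.trans_le (hf0.trans (hfa 0))
  obtain ⟨k, hk, hka⟩ : ∃ k ≤ K, a / 3 < f k := by
    by_contra! hcon
    have : ∀ k ≤ K, 2 ^ k * u ≤ f k := by
      intro k
      induction k with
      | zero => simpa using hf0
      | succ k ih =>
        intro hk
        have := h1 k (by omega) (hcon k (by omega))
        have := ih (by omega)
        rw [pow_succ]; nlinarith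
    have h3 := this K le_rfl
    have h4 := hcon K le_rfl
    linarith
  have key : ∀ j, j + 1 ≤ K → a - f (k + (j + 1)) ≤ (2 / 3 * a) / 2 ^ (j + 1) - u := by
    intro j
    induction j with
    | zero =>
      intro hj
      have := h2 k (by omega) hka
      simp only [zero_add, pow_one]
      linarith
    | succ j ih =>
      intro hj
      have h3 := ih (by omega)
      have h4 : (2 / 3 * a) / 2 ^ (j + 1) ≤ 2 / 3 * a :=
        div_le_self (by positivity) (one_le_pow₀ (by norm_num))
      have h5 := h2 (k + (j + 1)) (by omega) (by linarith)
      have h6 : (2 / 3 * a) / 2 ^ (j + 1 + 1) = (2 / 3 * a) / 2 ^ (j + 1) / 2 := by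
        rw [pow_succ _ (j + 1)]; field_simp
      rw [h6, ← add_assoc k]
      linarith
  obtain ⟨j, rfl⟩ : ∃ j, K = j + 1 := ⟨K - 1, by omega⟩
  have h3 := key j le_rfl
  have h4 := hfa (k + (j + 1))
  have h5 : (2 / 3 * a) / 2 ^ (j + 1) ≤ 2 / 3 * u := by
    rw [div_le_iff₀ (by positivity)]; linarith
  linarith

/-- If `A` and `B` expand along the maps `τ i`, then an unmatched point of `B` is reached after
few steps. -/
theorem exists_measure_reach_pos (M : MeasMatching τ A B) (μ : Measure X) [IsFiniteMeasure μ]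
    (hτ : ∀ i, MeasurePreserving (τ i) μ μ) (hA : MeasurableSet A) (hB : MeasurableSet B)
    (hAB : μ.real A = μ.real B)
    (h₁ : ∀ Y ⊆ A, MeasurableSet Y →
      min (2 * μ.real Y) (2 / 3 * μ.real A) ≤ μ.real ((⋃ i, τ i '' Y) ∩ B))
    (h₂ : ∀ Z ⊆ B, MeasurableSet Z →
      min (2 * μ.real Z) (2 / 3 * μ.real A) ≤ μ.real ((⋃ i, τ i ⁻¹' Z) ∩ A))
    (hu : 0 < μ.real M.freeLeft) {K : ℕ} (hK : 1 ≤ K)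
    (hKu : μ.real A ≤ 2 ^ K * μ.real M.freeLeft) :
    ∃ k < 2 * K, μ ((⋃ s, τ s '' M.reach k) ∩ M.freeRight) ≠ 0 := by
  by_contra! hcon
  refine exists_lt_of_growth (f := fun k => μ.real (M.reach k)) (a := μ.real A) hu le_rfl
    (fun k => measureReal_mono (M.reach_subset k)) hK hKu ?_ ?_
  · intro k hk hk3
    have := M.measure_reach_succ_ge μ hτ hA k (hcon k hk)
    have h := h₁ _ (M.reach_subset k) (M.measurableSet_reach hA k)
    rw [min_eq_left (by linarith)] at h
    linarith
  · intro k hk hk3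
    have h3 := M.measure_reach_succ_ge μ hτ hA k (hcon k hk)
    have h := h₁ _ (M.reach_subset k) (M.measurableSet_reach hA k)
    rw [min_eq_right (by linarith)] at h
    set N := ⋃ s, τ s '' M.reach k with hN
    have hNm : MeasurableSet N :=
      MeasurableSet.iUnion fun s => (τ s).measurableSet_image.2 (M.measurableSet_reach hA k)
    have hZ : μ.real (B \ N) = μ.real B - μ.real (N ∩ B) := by
      have := measureReal_sdiff_add_inter (μ := μ) (s := B) hNm
      rw [inter_comm] at this
      linarith
    have h4 := h₂ (B \ N) sdiff_subset (hB.diff hNm)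
    rw [min_eq_left (by linarith)] at h4
    have h5 : (⋃ i, τ i ⁻¹' (B \ N)) ∩ A ⊆ A \ M.reach k := by
      rintro x ⟨hx, hxA⟩
      obtain ⟨i, hi⟩ := mem_iUnion.1 hx
      exact ⟨hxA, fun hr => hi.2 (mem_iUnion.2 ⟨i, x, hr, rfl⟩)⟩
    have h6 := measureReal_mono (μ := μ) h5
    rw [measureReal_sdiff (M.reach_subset k) (M.measurableSet_reach hA k)] at h6
    linarith

theorem exists_augment (M : MeasMatching τ A B) (μ : Measure X) [IsFiniteMeasure μ]
    (hτ : ∀ i, MeasurePreserving (τ i) μ μ) (hA : MeasurableSet A) (k : ℕ) :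
    ∀ U ⊆ M.reach k, MeasurableSet U → μ U ≠ 0 →
    ∃ V ⊆ U, MeasurableSet V ∧ μ V ≠ 0 ∧ ∀ W ⊆ V, MeasurableSet W →
    ∀ M' : MeasMatching τ A B, (∀ x ∈ M.reach k, ∀ i, x ∈ M'.piece i ↔ x ∈ M.piece i) →
    ∀ s, τ s '' W ⊆ M'.freeRight →
    ∃ M'' : MeasMatching τ A B, μ.real M''.freeLeft = μ.real M'.freeLeft - μ.real W ∧
      cost μ M' M'' ≤ 2 * (k + 1) * μ.real W := by
  induction k with
  | zero =>
    intro U hU hUm hU0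
    refine ⟨U, Subset.rfl, hUm, hU0, fun W hW hWm M' hM' s hs => ?_⟩
    have hWA : W ⊆ A := (hW.trans hU).trans (M.reach_subset 0)
    have hfree : ∀ x ∈ W, ∀ i, x ∉ M'.piece i := fun x hx i hi =>
      (hU (hW hx)).2 (mem_iUnion.2 ⟨i, (hM' x (hU (hW hx)) i).1 hi⟩)
    refine ⟨M'.rematch W s hWm hWA hs, ?_, ?_⟩
    · have hsub : W ⊆ M'.freeLeft := fun x hx => ⟨hWA hx, by simpa using hfree x hx⟩
      rw [← measureReal_sdiff hsub hWm]
      congr 1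
      ext x
      by_cases hx : x ∈ W
      · simp only [freeLeft, mem_sdiff, mem_iUnion, M'.mem_rematch_of_mem hWm hWA hs hx]
        simp [hx]
      · simp only [freeLeft, mem_sdiff, mem_iUnion, M'.mem_rematch_of_notMem hWm hWA hs hx]
        simp [hx]
    · have := M'.cost_rematch_le hWm hWA hs μ s fun i x hx hi => (hfree x hx i hi).elim
      simpa using this
  | succ k ih =>
    intro U hU hUm hU0
    have hFm := M.measurableSet_reach hA k
    by_cases hUF : μ (U ∩ M.reach k) = 0
    swap
    · obtain ⟨V, hVU, hVm, hV0, hV⟩ := ih _ inter_subset_right (hUm.inter hFm) hUF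
      refine ⟨V, hVU.trans inter_subset_left, hVm, hV0, fun W hW hWm M' hM' s hs => ?_⟩
      obtain ⟨M'', h1, h2⟩ := hV W hW hWm M'
        (fun x hx => hM' x (M.reach_subset_succ k hx)) s hs
      refine ⟨M'', h1, h2.trans ?_⟩
      push_cast
      have := measureReal_nonneg (μ := μ) (s := W)
      nlinarith
    obtain ⟨t, s', hts⟩ : ∃ t s', μ (U \ M.reach k ∩ (M.piece t ∩ τ t ⁻¹' (τ s' '' M.reach k)))
        ≠ 0 := by
      by_contra! hcon
      refine hU0 (measure_mono_null (t := (U ∩ M.reach k) ∪ ⋃ t, ⋃ s',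
        (U \ M.reach k ∩ (M.piece t ∩ τ t ⁻¹' (τ s' '' M.reach k)))) ?_ ?_)
      · intro x hx
        by_cases hxF : x ∈ M.reach k
        · exact Or.inl ⟨hx, hxF⟩
        right
        rcases hU hx with h | h
        · refine (hxF ?_).elim
          clear hcon hU0 ih hUF hU hxF hFm
          cases k with
          | zero => exact h
          | succ k => exact Or.inl h
        · obtain ⟨t, h1, h2⟩ := mem_iUnion.1 h
          obtain ⟨s', h3⟩ := mem_iUnion.1 h2
          exact mem_iUnion.2 ⟨t, mem_iUnion.2 ⟨s', ⟨hx, hxF⟩, h1, h3⟩⟩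
      · exact measure_union_null hUF (measure_iUnion_null fun t => measure_iUnion_null (hcon t))
    set U₁ := U \ M.reach k ∩ (M.piece t ∩ τ t ⁻¹' (τ s' '' M.reach k)) with hU₁
    have hU₁m : MeasurableSet U₁ := (hUm.diff hFm).inter ((M.measurableSet_piece t).inter
      ((τ t).measurable ((τ s').measurableSet_image.2 hFm)))
    -- the map `e` sends `U₁` into `M.reach k`
    let e : X ≃ᵐ X := (τ t).trans (τ s').symm
    have he : MeasurePreserving e μ μ := (hτ t).trans ((hτ s').symm)
    have hes : ∀ x, τ s' (e x) = τ t x := fun x => by simp [e]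
    have heU : e '' U₁ ⊆ M.reach k := by
      rintro _ ⟨x, hx, rfl⟩
      obtain ⟨y, hy, hyx⟩ := hx.2.2
      have : e x = y := (τ s').injective ((hes x).trans hyx.symm)
      rwa [this]
    have himg : ∀ W, MeasurableSet W → μ (e '' W) = μ W := fun W hW => by
      rw [← he.measure_preimage (e.measurableSet_image.2 hW).nullMeasurableSet,
        preimage_image_eq _ e.injective]
    obtain ⟨V, hVU, hVm, hV0, hV⟩ := ih (e '' U₁) heU (e.measurableSet_image.2 hU₁m)
      (by rwa [himg _ hU₁m])
    have hVe : e '' (e ⁻¹' V) = V := image_preimage_eq _ e.surjective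
    have hVU' : e ⁻¹' V ⊆ U₁ := by
      intro x hx
      obtain ⟨y, hy, hyx⟩ := hVU hx
      rwa [← e.injective hyx]
    refine ⟨e ⁻¹' V, fun x hx => (hVU' hx).1.1, e.measurable hVm, ?_, ?_⟩
    · rwa [he.measure_preimage hVm.nullMeasurableSet]
    intro W hW hWm M' hM' s hs
    have hWU : W ⊆ U₁ := hW.trans hVU'
    have hWR : W ⊆ M.reach (k + 1) := fun x hx => hU (hWU hx).1.1
    have hWA : W ⊆ A := hWR.trans (M.reach_subset _)
    have hWt : ∀ x ∈ W, x ∈ M'.piece t := fun x hx => (hM' x (hWR hx) t).2 (hWU hx).2.1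
    obtain ⟨M'', h1, h2⟩ := hV (e '' W) (by rw [← hVe]; exact image_mono hW)
      (e.measurableSet_image.2 hWm) (M'.rematch W s hWm hWA hs) (fun x hx i => by
        rw [M'.mem_rematch_of_notMem hWm hWA hs fun h => (hWU h).1.2 hx]
        exact hM' x (M.reach_subset_succ k hx) i) s' (by
        rintro _ ⟨_, ⟨w, hw, rfl⟩, rfl⟩
        rw [hes]
        refine ⟨M'.mem_right t w (hWt w hw), fun hcon => ?_⟩
        obtain ⟨i, x, hx, hxw⟩ := mem_iUnion.1 hcon
        by_cases hxW : x ∈ W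
        · rw [M'.mem_rematch_of_mem hWm hWA hs hxW] at hx
          subst hx
          exact (hs ⟨x, hxW, rfl⟩).2 (mem_iUnion.2 ⟨t, w, hWt w hw, hxw.symm⟩)
        · rw [M'.mem_rematch_of_notMem hWm hWA hs hxW] at hx
          obtain rfl := M'.eq_of_apply_eq i t x hx w (hWt w hw) hxw
          rw [(τ i).injective hxw] at hxW
          exact hxW hw)
    have hWe : μ.real (e '' W) = μ.real W := by simp only [measureReal_def, himg W hWm]
    rw [hWe] at h1 h2
    refine ⟨M'', ?_, ?_⟩
    · rw [h1]
      congr 2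
      ext x
      by_cases hx : x ∈ W
      · simp only [freeLeft, mem_sdiff, mem_iUnion, M'.mem_rematch_of_mem hWm hWA hs hx]
        have : ∃ i, x ∈ M'.piece i := ⟨t, hWt x hx⟩
        simp [this]
      · simp only [freeLeft, mem_sdiff, mem_iUnion, M'.mem_rematch_of_notMem hWm hWA hs hx]
    · have h3 := M'.cost_rematch_le hWm hWA hs μ t
        fun i x hx hi => M'.eq_of_mem i t x hi (hWt x hx)
      have h4 := cost_triangle μ M' (M'.rematch W s hWm hWA hs) M''
      push_cast
      linarith

/-- **Measurable Hall theorem**: sets of equal measure that expand along finitely many measure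
preserving maps are matched up to null sets. -/
theorem exists_measure_freeLeft_eq_zero (μ : Measure X) [IsFiniteMeasure μ]
    (hτ : ∀ i, MeasurePreserving (τ i) μ μ) (hA : MeasurableSet A) (hB : MeasurableSet B)
    (hAB : μ.real A = μ.real B)
    (h₁ : ∀ Y ⊆ A, MeasurableSet Y →
      min (2 * μ.real Y) (2 / 3 * μ.real A) ≤ μ.real ((⋃ i, τ i '' Y) ∩ B))
    (h₂ : ∀ Z ⊆ B, MeasurableSet Z →
      min (2 * μ.real Z) (2 / 3 * μ.real A) ≤ μ.real ((⋃ i, τ i ⁻¹' Z) ∩ A)) :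
    ∃ M : MeasMatching τ A B, μ M.freeLeft = 0 := by
  set a := μ.real A with ha
  let φ : MeasMatching τ A B → ℝ := fun M => 24 * √a * √(μ.real M.freeLeft)
  have hφ0 : ∀ M, 0 ≤ φ M := fun M => by positivity
  obtain ⟨M, hM⟩ := exists_forall_le_of_dist_le_sub (d := cost μ) (φ := φ)
    (cost_self μ) (cost_nonneg μ) (cost_triangle μ) hφ0 fun s hs => by
      obtain ⟨M, hM⟩ := exists_tendsto_cost μ s hs
      refine ⟨M, hM, ((Real.continuous_sqrt.tendsto _).comp ?_).const_mul _⟩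
      rw [tendsto_iff_norm_sub_tendsto_zero]
      exact squeeze_zero (fun _ => norm_nonneg _) (fun n => abs_freeLeft_sub_le μ (s n) M) hM
  refine ⟨M, ?_⟩
  by_contra hne
  set u := μ.real M.freeLeft with hu
  have hu0 : 0 < u := ENNReal.toReal_pos hne (measure_ne_top _ _)
  have hua : u ≤ a := measureReal_mono sdiff_subset
  have hx1 : 1 ≤ a / u := (one_le_div hu0).2 hua
  have hx1' : 1 ≤ √(a / u) := Real.one_le_sqrt.2 hx1
  set K := ⌈2 * √(a / u)⌉₊ with hKdef
  have hK1 : 2 * √(a / u) ≤ K := Nat.le_ceil _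
  have hK2 : (K : ℝ) ≤ 3 * √(a / u) := by
    have := Nat.ceil_lt_add_one (a := 2 * √(a / u)) (by positivity)
    linarith
  have hpow : ∀ n : ℕ, (n : ℝ) ^ 2 / 4 ≤ 2 ^ n := by
    intro n
    have h : ∀ n : ℕ, n ≤ 2 ^ n := fun n => Nat.lt_two_pow_self.le
    have h2 : n ^ 2 ≤ 4 * 2 ^ n := by
      induction n using Nat.strong_induction_on with
      | _ n ih =>
        rcases n with _ | _ | _ | _ | n
        · norm_num
        · norm_num
        · norm_num
        · norm_num
        · have := ih (n + 3) (by omega)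
          have h3 : (n + 3 + 1) ^ 2 ≤ 2 * (n + 3) ^ 2 := by
            linarith [Nat.zero_le (n ^ 2), Nat.zero_le n]
          rw [pow_succ 2 (n + 3)]
          linarith
    have : (n : ℝ) ^ 2 ≤ 4 * 2 ^ n := by exact_mod_cast h2
    linarith
  have hKu : a ≤ 2 ^ K * u := by
    have h1 := hpow K
    have h2 : (2 * √(a / u)) ^ 2 ≤ (K : ℝ) ^ 2 := by gcongr
    rw [mul_pow, Real.sq_sqrt (by positivity)] at h2
    have h3 : a / u ≤ 2 ^ K := by linarith
    rwa [div_le_iff₀ hu0] at h3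
  obtain ⟨k, hk, hk0⟩ := M.exists_measure_reach_pos μ hτ hA hB hAB h₁ h₂ hu0
    (K := K) (by have : (1 : ℝ) ≤ K := by linarith
                 exact_mod_cast this) hKu
  obtain ⟨s, hs⟩ : ∃ s, μ (τ s '' M.reach k ∩ M.freeRight) ≠ 0 := by
    by_contra! hcon
    rw [iUnion_inter] at hk0
    exact hk0 (measure_iUnion_null hcon)
  have hRm := M.measurableSet_reach hA k
  have hBm := M.measurableSet_freeRight hB
  obtain ⟨V, hVU, hVm, hV0, hV⟩ := M.exists_augment μ hτ hA k (M.reach k ∩ τ s ⁻¹' M.freeRight)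
    inter_subset_left (hRm.inter ((τ s).measurable hBm)) (by
      rw [← (hτ s).measure_preimage (((τ s).measurableSet_image.2 hRm).inter hBm).nullMeasurableSet,
        preimage_inter, preimage_image_eq _ (τ s).injective] at hs
      exact hs)
  obtain ⟨N, hN1, hN2⟩ := hV V Subset.rfl hVm M (fun _ _ _ => Iff.rfl) s (by
    rintro _ ⟨x, hx, rfl⟩
    exact (hVU hx).2)
  set ε := μ.real V with hε
  have hε0 : 0 < ε := ENNReal.toReal_pos hV0 (measure_ne_top _ _)
  have hN0 : 0 ≤ u - ε := hN1 ▸ measureReal_nonneg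
  have ha0 : 0 < a := hu0.trans_le hua
  have hsqrt : √u - √(u - ε) ≥ ε / (2 * √u) := by
    rw [ge_iff_le, div_le_iff₀ (by positivity)]
    have e1 := Real.sq_sqrt hu0.le
    have e2 := Real.sq_sqrt hN0
    nlinarith [sq_nonneg (√u - √(u - ε))]
  have hdrop : cost μ M N ≤ φ M - φ N := by
    have hk' : ((k : ℝ) + 1) ≤ 2 * K := by exact_mod_cast hk
    calc cost μ M N ≤ 2 * (k + 1) * ε := hN2
      _ ≤ 12 * √(a / u) * ε := by
        refine mul_le_mul_of_nonneg_right ?_ hε0.le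
        linarith
      _ = 24 * √a * (ε / (2 * √u)) := by rw [Real.sqrt_div ha0.le]; field_simp; norm_num
      _ ≤ 24 * √a * (√u - √(u - ε)) := by gcongr
      _ = φ M - φ N := by simp only [φ, hN1]; ring
  have hle := hM N hdrop
  have hlt : φ N < φ M := by
    simp only [φ, hN1]
    have : √(u - ε) < √u := Real.sqrt_lt_sqrt hN0 (by linarith)
    have : 0 < √a := Real.sqrt_pos.2 ha0
    gcongr
  linarith

end MeasMatching

section Expansion

open scoped Pointwise

variable {G X : Type*} [Group G] [MulAction G X] [MeasurableSpace X] [MeasurableConstSMul G X]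
  {μ : Measure X} [IsProbabilityMeasure μ]

theorem measurableSet_biUnion_smul (S : Finset G) {Y : Set X} (hY : MeasurableSet Y) :
    MeasurableSet (⋃ g ∈ S, g • Y) :=
  S.measurableSet_biUnion fun g _ => hY.const_smul g

/-- If every set is moved by a definite amount by one of finitely many group elements, then
products of these elements expand sets by arbitrary factors. -/
theorem exists_finset_le_measureReal_biUnion_smul {Γ : Finset G} {c : ℝ} (hc : 0 < c)
    (hΓ : ∀ Y : Set X, MeasurableSet Y →
      ∃ γ ∈ Γ, c * (μ.real Y * (1 - μ.real Y)) ≤ μ.real ((γ • Y) \ Y))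
    {ε : ℝ} (hε : 0 < ε) (K : ℝ) :
    ∃ S : Finset G, ∀ Y : Set X, MeasurableSet Y →
      min (1 - ε) (K * μ.real Y) ≤ μ.real (⋃ g ∈ S, g • Y) := by
  classical
  have key : ∀ j : ℕ, ∃ S : Finset G, ∀ Y : Set X, MeasurableSet Y →
      min (1 - ε) ((1 + c * ε) ^ j * μ.real Y) ≤ μ.real (⋃ g ∈ S, g • Y) := by
    intro j
    induction j with
    | zero =>
      refine ⟨{1}, fun Y _ => ?_⟩
      simp
    | succ j ih =>
      obtain ⟨S, hS⟩ := ih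
      refine ⟨S ∪ Γ * S, fun Y hY => ?_⟩
      set V := ⋃ g ∈ S, g • Y with hV
      have hVm : MeasurableSet V := measurableSet_biUnion_smul S hY
      obtain ⟨γ, hγ, hγV⟩ := hΓ V hVm
      have hsub : V ∪ (γ • V) \ V ⊆ ⋃ g ∈ S ∪ Γ * S, g • Y := by
        rintro x (hx | ⟨hx, -⟩)
        · obtain ⟨g, hg, hx⟩ := mem_iUnion₂.1 hx
          exact mem_iUnion₂.2 ⟨g, Finset.mem_union_left _ hg, hx⟩
        · obtain ⟨y, hy, rfl⟩ := hx
          obtain ⟨g, hg, z, hz, rfl⟩ := mem_iUnion₂.1 hy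
          refine mem_iUnion₂.2 ⟨γ * g, Finset.mem_union_right _ (Finset.mul_mem_mul hγ hg), ?_⟩
          exact ⟨z, hz, mul_smul _ _ _⟩
      have h1 : μ.real V + μ.real ((γ • V) \ V) ≤ μ.real (⋃ g ∈ S ∪ Γ * S, g • Y) := by
        rw [← measureReal_union disjoint_sdiff_right ((hVm.const_smul γ).diff hVm)
          (measure_ne_top _ _) (measure_ne_top _ _)]
        exact measureReal_mono hsub (measure_ne_top _ _)
      have h2 := hS Y hY
      have h3 : μ.real V ≤ 1 := measureReal_le_one
      have h4 : 0 ≤ μ.real V := measureReal_nonneg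
      rcases le_or_gt (1 - ε) (μ.real V) with h | h
      · refine (min_le_left _ _).trans ?_
        have : 0 ≤ μ.real ((γ • V) \ V) := measureReal_nonneg
        linarith
      · refine (min_le_right _ _).trans ?_
        have h5 : (1 + c * ε) ^ j * μ.real Y ≤ μ.real V := by
          rcases min_le_iff.1 h2 with h' | h'
          · linarith
          · exact h'
        have h6 : μ.real V * ε ≤ μ.real V * (1 - μ.real V) := by gcongr; linarith
        have h7 : c * (μ.real V * ε) ≤ c * (μ.real V * (1 - μ.real V)) := by gcongr
        have h8 : (1 + c * ε) * ((1 + c * ε) ^ j * μ.real Y) ≤ (1 + c * ε) * μ.real V := by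
          gcongr
        rw [pow_succ]
        linarith
  obtain ⟨j, hj⟩ := pow_unbounded_of_one_lt K (show 1 < 1 + c * ε by linarith [mul_pos hc hε])
  obtain ⟨S, hS⟩ := key j
  refine ⟨S, fun Y hY => le_trans (min_le_min_left _ ?_) (hS Y hY)⟩
  gcongr

variable [SMulInvariantMeasure G X μ]

/-- Expansion into a set `B` of which finitely many translates cover the space. -/
theorem exists_finset_le_measureReal_inter
    (hexp : ∀ ε > 0, ∀ K : ℝ, ∃ S : Finset G, ∀ Y : Set X, MeasurableSet Y →
      min (1 - ε) (K * μ.real Y) ≤ μ.real (⋃ g ∈ S, g • Y))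
    {B : Set X} (hB0 : 0 < μ.real B) {F : Finset G}
    (hF : ⋃ g ∈ F, g • B = univ) :
    ∃ S : Finset G, ∀ Y : Set X, MeasurableSet Y →
      min (2 * μ.real Y) (2 / 3 * μ.real B) ≤ μ.real ((⋃ g ∈ S, g • Y) ∩ B) := by
  classical
  obtain ⟨S, hS⟩ := hexp (μ.real B / 3) (by positivity) (2 * F.card)
  refine ⟨S ∪ F⁻¹ * S, fun Y hY => ?_⟩
  set V := ⋃ g ∈ S, g • Y with hV
  have hVm : MeasurableSet V := measurableSet_biUnion_smul S hY
  have hV' : V ⊆ ⋃ g ∈ S ∪ F⁻¹ * S, g • Y := by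
    intro x hx
    obtain ⟨g, hg, hx⟩ := mem_iUnion₂.1 hx
    exact mem_iUnion₂.2 ⟨g, Finset.mem_union_left _ hg, hx⟩
  rcases min_le_iff.1 (hS Y hY) with h | h
  · refine (min_le_right _ _).trans ?_
    have h1 : μ.real B ≤ μ.real (V ∩ B) + μ.real Vᶜ := by
      refine (measureReal_mono ?_).trans (measureReal_union_le _ _)
      intro x hx
      by_cases hxV : x ∈ V
      exacts [Or.inl ⟨hxV, hx⟩, Or.inr hxV]
    rw [probReal_compl_eq_one_sub hVm] at h1
    have h2 : μ.real (V ∩ B) ≤ μ.real ((⋃ g ∈ S ∪ F⁻¹ * S, g • Y) ∩ B) :=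
      measureReal_mono (inter_subset_inter_left _ hV')
    linarith
  · refine (min_le_left _ _).trans ?_
    by_contra! hcon
    have h1 : ∀ g ∈ F, μ.real (V ∩ g • B) ≤ μ.real ((⋃ g ∈ S ∪ F⁻¹ * S, g • Y) ∩ B) := by
      intro g hg
      have h2 : μ.real (V ∩ g • B) = μ.real (g⁻¹ • (V ∩ g • B)) := by
        simp only [measureReal_def, measure_smul]
      rw [h2]
      refine measureReal_mono ?_
      rw [smul_set_inter, inv_smul_smul]
      refine inter_subset_inter_left _ ?_
      rintro _ ⟨x, hx, rfl⟩
      obtain ⟨s, hs, y, hy, rfl⟩ := mem_iUnion₂.1 hx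
      refine mem_iUnion₂.2 ⟨g⁻¹ * s, Finset.mem_union_right _
        (Finset.mul_mem_mul (Finset.inv_mem_inv hg) hs), y, hy, mul_smul _ _ _⟩
    have h2 : μ.real V ≤ ∑ g ∈ F, μ.real (V ∩ g • B) := by
      have : V = ⋃ g ∈ F, V ∩ g • B := by
        rw [← inter_iUnion₂, hF, inter_univ]
      conv_lhs => rw [this]
      exact measureReal_biUnion_finset_le _ _
    have hFne : F.Nonempty := by
      rw [Finset.nonempty_iff_ne_empty]
      rintro rfl
      have : (univ : Set X).Nonempty := by
        have := nonempty_of_measure_ne_zero (μ := μ) (s := univ) (by simp)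
        exact this
      simp [← hF] at this
    have h3 : ∑ g ∈ F, μ.real (V ∩ g • B) < ∑ g ∈ F, 2 * μ.real Y :=
      Finset.sum_lt_sum_of_nonempty hFne fun g hg => (h1 g hg).trans_lt hcon
    rw [Finset.sum_const, nsmul_eq_mul] at h3
    linarith

theorem MeasMatching.measure_freeRight_eq_zero {ι : Type*} [Fintype ι] {τ : ι → X ≃ᵐ X}
    {A B : Set X} (M : MeasMatching τ A B) (hτ : ∀ i, MeasurePreserving (τ i) μ μ)
    (hAB : μ.real A = μ.real B)
    (h : μ M.freeLeft = 0) : μ M.freeRight = 0 := by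
  have hm := fun i => (τ i).measurableSet_image.2 (M.measurableSet_piece i)
  have h1 : μ.real A ≤ ∑ i, μ.real (M.piece i) := by
    have hsub : A ⊆ M.freeLeft ∪ ⋃ i, M.piece i := by
      intro x hx
      by_cases hxM : x ∈ ⋃ i, M.piece i
      exacts [Or.inr hxM, Or.inl ⟨hx, hxM⟩]
    have h2 := (measureReal_mono (μ := μ) hsub).trans (measureReal_union_le _ _)
    rw [measureReal_def μ M.freeLeft, h] at h2
    have h3 := measureReal_iUnion_fintype_le (μ := μ) M.piece
    simp at h2
    linarith
  have h2 : ∑ i, μ.real (M.piece i) = μ.real (⋃ i, τ i '' M.piece i) := by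
    rw [measureReal_iUnion_fintype _ hm]
    · refine Finset.sum_congr rfl fun i _ => ?_
      rw [← (hτ i).measureReal_preimage (hm i).nullMeasurableSet,
        preimage_image_eq _ (τ i).injective]
    · intro i j hij
      refine disjoint_left.2 ?_
      rintro _ ⟨x, hx, rfl⟩ ⟨y, hy, hxy⟩
      exact hij (M.eq_of_apply_eq i j x hx y hy hxy.symm)
  have h3 : (⋃ i, τ i '' M.piece i) ⊆ B := by
    rintro _ hy
    obtain ⟨i, x, hx, rfl⟩ := mem_iUnion.1 hy
    exact M.mem_right i x hx
  have h4 := measureReal_sdiff (μ := μ) h3 (MeasurableSet.iUnion hm)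
  have h5 : μ.real (B \ ⋃ i, τ i '' M.piece i) = 0 :=
    le_antisymm (by linarith) measureReal_nonneg
  exact (measureReal_eq_zero_iff).1 h5

/-- Sets of equal measure, finitely many translates of which cover the space, can be matched along
finitely many group elements up to null sets. -/
theorem exists_measMatching_of_expansion
    (hexp : ∀ ε > 0, ∀ K : ℝ, ∃ S : Finset G, ∀ Y : Set X, MeasurableSet Y →
      min (1 - ε) (K * μ.real Y) ≤ μ.real (⋃ g ∈ S, g • Y))
    {A B : Set X} (hA : MeasurableSet A) (hB : MeasurableSet B) (hAB : μ.real A = μ.real B)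
    (hA0 : 0 < μ.real A) {F F' : Finset G} (hF : ⋃ g ∈ F, g • A = univ)
    (hF' : ⋃ g ∈ F', g • B = univ) :
    ∃ (S : Finset G) (M : MeasMatching (fun g : S => MeasurableEquiv.smul (g : G)) A B),
      μ M.freeLeft = 0 ∧ μ M.freeRight = 0 := by
  classical
  obtain ⟨S, hS⟩ := exists_finset_le_measureReal_inter hexp hA0 hF
  obtain ⟨S', hS'⟩ := exists_finset_le_measureReal_inter hexp (hAB ▸ hA0) hF'
  have hτ : ∀ g : ↥(S' ∪ S⁻¹), MeasurePreserving
      (MeasurableEquiv.smul (g : G) : X ≃ᵐ X) μ μ := fun g => measurePreserving_smul (g : G) μ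
  obtain ⟨M, hM⟩ := MeasMatching.exists_measure_freeLeft_eq_zero μ hτ hA hB hAB
    (fun Y _ hY => by
      rw [hAB]
      refine (hS' Y hY).trans (measureReal_mono (inter_subset_inter_left _ ?_))
      intro x hx
      obtain ⟨g, hg, y, hy, rfl⟩ := mem_iUnion₂.1 hx
      exact mem_iUnion.2 ⟨⟨g, Finset.mem_union_left _ hg⟩, y, hy, rfl⟩)
    (fun Z _ hZ => by
      refine (hS Z hZ).trans (measureReal_mono (inter_subset_inter_left _ ?_))
      intro x hx
      obtain ⟨g, hg, y, hy, rfl⟩ := mem_iUnion₂.1 hx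
      refine mem_iUnion.2 ⟨⟨g⁻¹, Finset.mem_union_right _ (Finset.inv_mem_inv hg)⟩, ?_⟩
      simpa using hy)
  exact ⟨_, M, hM, M.measure_freeRight_eq_zero hτ hAB hM⟩

end Expansion

/-- The rotations of `ℝⁿ` as a subgroup of the linear isometries. -/
def rotationGroup (n : ℕ) : Subgroup (EucSp n ≃ₗᵢ[ℝ] EucSp n) where
  carrier := {γ | IsRotation γ}
  one_mem' := by
    change LinearMap.det (LinearMap.id : EucSp n →ₗ[ℝ] EucSp n) = 1
    exact LinearMap.det_id
  mul_mem' := by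
    intro γ δ hγ hδ
    change LinearMap.det ((γ.toLinearEquiv.toLinearMap).comp δ.toLinearEquiv.toLinearMap) = 1
    rw [LinearMap.det_comp]
    have h₁ : LinearMap.det γ.toLinearEquiv.toLinearMap = 1 := hγ
    have h₂ : LinearMap.det δ.toLinearEquiv.toLinearMap = 1 := hδ
    rw [h₁, h₂, one_mul]
  inv_mem' := by
    intro γ hγ
    have h : LinearMap.det ((γ⁻¹).toLinearEquiv.toLinearMap) *
        LinearMap.det (γ.toLinearEquiv.toLinearMap) = 1 := by
      rw [← LinearMap.det_comp]
      convert LinearMap.det_id (M := EucSp n) (A := ℝ)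
      ext1 x
      exact γ.symm_apply_apply x
    rwa [show LinearMap.det (γ.toLinearEquiv.toLinearMap) = 1 from hγ, mul_one] at h

theorem mem_rotationGroup {n : ℕ} {γ : EucSp n ≃ₗᵢ[ℝ] EucSp n} :
    γ ∈ rotationGroup n ↔ IsRotation γ := Iff.rfl

namespace rotationGroup

variable {n : ℕ}

instance : MulAction (rotationGroup n) (Sph n) where
  smul γ x := rotateSphere γ x
  one_smul _ := Subtype.ext rfl
  mul_smul _ _ _ := Subtype.ext rfl

theorem smul_def (γ : rotationGroup n) (x : Sph n) : γ • x = rotateSphere γ x := rfl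

theorem coe_smul (γ : rotationGroup n) (x : Sph n) :
    ((γ • x : Sph n) : EucSp n) = (γ : EucSp n ≃ₗᵢ[ℝ] EucSp n) x := rfl

instance : ContinuousConstSMul (rotationGroup n) (Sph n) where
  continuous_const_smul γ := by
    refine Continuous.subtype_mk ?_ _
    exact (γ : EucSp n ≃ₗᵢ[ℝ] EucSp n).continuous.comp continuous_subtype_val

instance : MeasurableConstSMul (rotationGroup n) (Sph n) where
  measurable_const_smul γ := (continuous_const_smul γ).measurable

theorem smulInvariantMeasure {μ : Measure (Sph n)}
    (hinv : ∀ γ : EucSp n ≃ₗᵢ[ℝ] EucSp n, IsRotation γ →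
      ∀ U : Set (Sph n), μ (rotateSphere γ '' U) = μ U) :
    SMulInvariantMeasure (rotationGroup n) (Sph n) μ where
  measure_preimage_smul γ s _ := by
    rw [← hinv γ γ.2 ((fun x => γ • x) ⁻¹' s)]
    congr 1
    exact image_preimage_eq _ (MulAction.surjective γ)

theorem det_reflection_span_singleton {v : EucSp n} (hv : v ≠ 0) :
    LinearMap.det (((ℝ ∙ v)ᗮ).reflection.toLinearEquiv.toLinearMap) = -1 := by
  have h := (ℝ ∙ v)ᗮ.det_reflection
  rw [Submodule.orthogonal_orthogonal, finrank_span_singleton hv, pow_one] at h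
  exact h

theorem exists_smul_eq (hn : 3 ≤ n) (x y : Sph n) : ∃ γ : rotationGroup n, γ • x = y := by
  by_cases hxy : x = y
  · exact ⟨1, by rw [hxy, one_smul]⟩
  have hxy' : (x : EucSp n) - y ≠ 0 := fun h => hxy (Subtype.ext (sub_eq_zero.1 h))
  obtain ⟨z, hz, hz0⟩ : ∃ z ∈ (ℝ ∙ (y : EucSp n))ᗮ, z ≠ 0 := by
    by_contra! hcon
    have h1 := (ℝ ∙ (y : EucSp n)).finrank_add_finrank_orthogonal
    rw [(Submodule.eq_bot_iff _).2 hcon, finrank_bot, finrank_euclideanSpace_fin] at h1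
    have h2 := finrank_span_le_card (R := ℝ) ({(y : EucSp n)} : Set (EucSp n))
    simp at h2
    omega
  let γ : EucSp n ≃ₗᵢ[ℝ] EucSp n := (ℝ ∙ z)ᗮ.reflection * (ℝ ∙ ((x : EucSp n) - y))ᗮ.reflection
  have hγ : IsRotation γ := by
    change LinearMap.det (((ℝ ∙ z)ᗮ.reflection.toLinearEquiv.toLinearMap).comp
      (ℝ ∙ ((x : EucSp n) - y))ᗮ.reflection.toLinearEquiv.toLinearMap) = 1
    rw [LinearMap.det_comp, det_reflection_span_singleton hz0,
      det_reflection_span_singleton hxy']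
    norm_num
  have hx : ‖(x : EucSp n)‖ = 1 := by simp
  have hy : ‖(y : EucSp n)‖ = 1 := by simp
  refine ⟨⟨γ, hγ⟩, Subtype.ext ?_⟩
  change (ℝ ∙ z)ᗮ.reflection ((ℝ ∙ ((x : EucSp n) - y))ᗮ.reflection x) = y
  rw [Submodule.reflection_sub (hx.trans hy.symm)]
  refine Submodule.reflection_mem_subspace_eq_self ?_
  rw [Submodule.mem_orthogonal_singleton_iff_inner_left] at hz
  rw [Submodule.mem_orthogonal_singleton_iff_inner_left, real_inner_comm]
  exact hz

open scoped Pointwise in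
theorem exists_finset_iUnion_smul_eq_univ (hn : 3 ≤ n) {A : Set (Sph n)}
    (hA : (interior A).Nonempty) :
    ∃ F : Finset (rotationGroup n), ⋃ g ∈ F, g • A = univ := by
  obtain ⟨x, hx⟩ := hA
  obtain ⟨F, hF⟩ := isCompact_univ.elim_finite_subcover
    (fun g : rotationGroup n => g • interior A) (fun g => isOpen_interior.smul g) (by
      intro y _
      obtain ⟨g, rfl⟩ := exists_smul_eq hn x y
      exact mem_iUnion.2 ⟨g, smul_mem_smul_set hx⟩)
  refine ⟨F, univ_subset_iff.1 (hF.trans ?_)⟩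
  exact iUnion₂_mono fun g _ => smul_set_mono interior_subset

open scoped Pointwise in
theorem measure_pos_of_interior_nonempty (hn : 3 ≤ n) {μ : Measure (Sph n)}
    [IsProbabilityMeasure μ] [SMulInvariantMeasure (rotationGroup n) (Sph n) μ] {A : Set (Sph n)}
    (hA : (interior A).Nonempty) : 0 < μ.real A := by
  obtain ⟨F, hF⟩ := exists_finset_iUnion_smul_eq_univ hn hA
  refine ENNReal.toReal_pos (fun h0 => ?_) (measure_ne_top _ _)
  have h : μ (⋃ g ∈ F, g • A) = 0 := by
    refine (measure_biUnion_null_iff (Finset.countable_toSet F)).2 fun g _ => ?_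
    rwa [measure_smul]
  rw [hF, measure_univ] at h
  exact one_ne_zero h

end rotationGroup

section

open MvPolynomial

section LinSubst

variable {ι R S : Type*} [Fintype ι] [CommRing R] [CommRing S]

/-- The linear substitution `p ↦ p(M x)`. -/
noncomputable def linSubst (M : Matrix ι ι R) : MvPolynomial ι R →ₐ[R] MvPolynomial ι R :=
  bind₁ M.toMvPolynomial

theorem toMvPolynomial_eq_sum (M : Matrix ι ι R) (i : ι) :
    M.toMvPolynomial i = ∑ j, C (M i j) * X j := by
  simp only [Matrix.toMvPolynomial, C_mul_X_eq_monomial]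

theorem linSubst_X (M : Matrix ι ι R) (i : ι) : linSubst M (X i) = ∑ j, C (M i j) * X j := by
  rw [linSubst, bind₁_X_right, toMvPolynomial_eq_sum]

theorem linSubst_C (M : Matrix ι ι R) (a : R) : linSubst M (C a) = C a :=
  bind₁_C_right _ _

theorem linSubst_mul_apply [DecidableEq ι] (M N : Matrix ι ι R) (p : MvPolynomial ι R) :
    linSubst (M * N) p = linSubst N (linSubst M p) := by
  simp only [linSubst, bind₁_bind₁]
  congr 2
  ext1 i
  rw [Matrix.toMvPolynomial_mul]

theorem linSubst_one [DecidableEq ι] (p : MvPolynomial ι R) :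
    linSubst (1 : Matrix ι ι R) p = p := by
  have : (1 : Matrix ι ι R).toMvPolynomial = X := by
    ext1 i; rw [Matrix.toMvPolynomial_one]
  rw [linSubst, this]
  exact aeval_X_left_apply p

theorem eval_linSubst (M : Matrix ι ι R) (p : MvPolynomial ι R) (x : ι → R) :
    eval x (linSubst M p) = eval (M.mulVec x) p := by
  induction p using MvPolynomial.induction_on with
  | C a => simp
  | add p q hp hq => simp [hp, hq]
  | mul_X p i hp => simp [hp, linSubst_X, Matrix.mulVec, dotProduct]

theorem map_linSubst (f : R →+* S) (M : Matrix ι ι R) (p : MvPolynomial ι R) :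
    map f (linSubst M p) = linSubst (M.map f) (map f p) := by
  induction p using MvPolynomial.induction_on with
  | C a => simp
  | add p q hp hq => simp [hp, hq]
  | mul_X p i hp => simp [hp, linSubst_X]

theorem MvPolynomial.IsHomogeneous.linSubst {p : MvPolynomial ι R} {k : ℕ}
    (hp : p.IsHomogeneous k) (M : Matrix ι ι R) : (linSubst M p).IsHomogeneous k := by
  have := hp.aeval (M.toMvPolynomial) (n := 1) (fun i => M.toMvPolynomial_isHomogeneous i)
  simpa [_root_.linSubst] using this

theorem linSubst_smul_apply {p : MvPolynomial ι R} {k : ℕ}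
    (hp : p.IsHomogeneous k) (c : R) (M : Matrix ι ι R) :
    linSubst (c • M) p = c ^ k • linSubst M p := by
  rw [p.as_sum, map_sum, map_sum, Finset.smul_sum]
  refine Finset.sum_congr rfl fun d hd => ?_
  have hk : d.degree = k := by
    rw [← hp (mem_support_iff.1 hd), Finsupp.degree_eq_weight_one]
    rfl
  rw [monomial_eq, map_mul, map_mul, linSubst_C, linSubst_C, Finsupp.prod, map_prod, map_prod,
    ← mul_smul_comm, ← hk, Finsupp.degree_apply, ← Finset.prod_pow_eq_pow_sum, smul_eq_C_mul,
    map_prod, ← Finset.prod_mul_distrib]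
  congr 1
  refine Finset.prod_congr rfl fun i _ => ?_
  simp only [map_pow]
  rw [← mul_pow, linSubst_X, linSubst_X, Finset.mul_sum]
  simp [mul_assoc]

theorem pderiv_linSubst [DecidableEq ι] (M : Matrix ι ι R) (i : ι) (p : MvPolynomial ι R) :
    pderiv i (linSubst M p) = ∑ j, M j i • linSubst M (pderiv j p) := by
  induction p using MvPolynomial.induction_on with
  | C a => simp
  | add p q hp hq => simp [hp, hq, Finset.sum_add_distrib]
  | mul_X p l hp =>
    simp only [map_mul, pderiv_mul, hp, linSubst_X, map_sum, map_add, smul_add,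
      Finset.sum_add_distrib, pderiv_X, Pi.single_apply, smul_eq_C_mul, pderiv_C]
    simp only [Finset.mul_sum, Finset.sum_mul, apply_ite (linSubst M), map_one, map_zero]
    rw [Finset.sum_comm]
    simp [mul_assoc, mul_comm, mul_left_comm]

/-- The Fischer pairing `⟨p, q⟩ = p(∂) q (0)`. -/
noncomputable def fischer (q : MvPolynomial ι R) : MvPolynomial ι R →ₗ[R] R :=
  (basisMonomials ι R).constr R fun d => (∏ i, (d i).factorial : ℕ) * coeff d q

theorem fischer_monomial (q : MvPolynomial ι R) (d : ι →₀ ℕ) (a : R) :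
    fischer q (monomial d a) = a * ((∏ i, (d i).factorial : ℕ) * coeff d q) := by
  have : (monomial d a : MvPolynomial ι R) = a • basisMonomials ι R d := by
    simp [smul_monomial]
  rw [this, map_smul, fischer, Module.Basis.constr_basis, smul_eq_mul]

theorem fischer_X_mul (q p : MvPolynomial ι R) (i : ι) :
    fischer q (X i * p) = fischer (pderiv i q) p := by
  induction p using MvPolynomial.induction_on' with
  | add p q hp hq => simp [mul_add, hp, hq]
  | monomial d a =>
    classical
    rw [X, monomial_mul, fischer_monomial, fischer_monomial, coeff_pderiv, one_mul, add_comm d]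
    have : ∏ j, ((Finsupp.single i 1 + d : ι →₀ ℕ) j).factorial =
        (d i + 1) * ∏ j, (d j).factorial := by
      rw [← Finset.mul_prod_erase _ _ (Finset.mem_univ i),
        ← Finset.mul_prod_erase _ (fun j => (d j).factorial) (Finset.mem_univ i), ← mul_assoc]
      congr 1
      · rw [Finsupp.add_apply, Finsupp.single_eq_same, add_comm 1, Nat.factorial_succ]
      · refine Finset.prod_congr rfl fun j hj => ?_
        simp [(Finset.ne_of_mem_erase hj).symm]
    rw [this]
    push_cast
    ring

theorem fischer_add (q q' p : MvPolynomial ι R) :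
    fischer (q + q') p = fischer q p + fischer q' p := by
  induction p using MvPolynomial.induction_on' with
  | add p q hp hq => simp only [map_add, hp, hq]; ring
  | monomial d a => simp only [fischer_monomial, coeff_add]; ring

theorem fischer_smul (c : R) (q p : MvPolynomial ι R) :
    fischer (c • q) p = c * fischer q p := by
  induction p using MvPolynomial.induction_on' with
  | add p q hp hq => simp only [map_add, hp, hq]; ring
  | monomial d a => simp only [fischer_monomial, coeff_smul, smul_eq_mul]; ring

theorem fischer_sum {κ : Type*} (s : Finset κ) (q : κ → MvPolynomial ι R) (p : MvPolynomial ι R) :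
    fischer (∑ j ∈ s, q j) p = ∑ j ∈ s, fischer (q j) p := by
  classical
  induction s using Finset.induction_on with
  | empty => simpa using fischer_smul 0 0 p
  | insert a s ha ih => rw [Finset.sum_insert ha, Finset.sum_insert ha, fischer_add, ih]

theorem fischer_comm (q p : MvPolynomial ι R) : fischer q p = fischer p q := by
  induction p using MvPolynomial.induction_on' with
  | add p p' hp hp' => rw [map_add, fischer_add, hp, hp']
  | monomial d a =>
    induction q using MvPolynomial.induction_on' with
    | add q q' hq hq' => rw [map_add, fischer_add, hq, hq']
    | monomial e b =>
      classical
      rw [fischer_monomial, fischer_monomial, coeff_monomial, coeff_monomial]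
      by_cases h : e = d
      · subst h; simp only [if_true]; ring
      · simp [h, Ne.symm h]

theorem fischer_linSubst [DecidableEq ι] (M : Matrix ι ι R) (q p : MvPolynomial ι R) :
    fischer q (linSubst M p) = fischer (linSubst M.transpose q) p := by
  induction p using MvPolynomial.induction_on generalizing q with
  | C a =>
    have h : coeff 0 (linSubst M.transpose q) = coeff 0 q := by
      have := eval_linSubst M.transpose q 0
      simpa [← constantCoeff_eq, eval_zero'] using this
    rw [linSubst_C, ← monomial_zero', fischer_monomial, fischer_monomial, h]
  | add p q hp hq => simp [hp, hq]
  | mul_X p i hp =>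
    rw [mul_comm, map_mul, linSubst_X, Finset.sum_mul, map_sum, fischer_X_mul, pderiv_linSubst,
      fischer_sum]
    refine Finset.sum_congr rfl fun j _ => ?_
    rw [fischer_smul, ← hp, mul_assoc, ← smul_eq_C_mul, map_smul, fischer_X_mul, smul_eq_mul,
      Matrix.transpose_apply]

end LinSubst

end

section

open MvPolynomial

section SymPow

variable {R : Type*} [CommRing R]

/-- The exponent of the `i`-th monomial of degree `k` in two variables. -/
noncomputable def symExp (k : ℕ) (i : Fin (k + 1)) : Fin 2 →₀ ℕ :=
  Finsupp.single 0 (i : ℕ) + Finsupp.single 1 (k - i)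

theorem symExp_zero (k : ℕ) (i : Fin (k + 1)) : symExp k i 0 = i := by simp [symExp]

theorem symExp_one (k : ℕ) (i : Fin (k + 1)) : symExp k i 1 = k - i := by simp [symExp]

theorem symExp_injective (k : ℕ) : Function.Injective (symExp k) := fun i j h => by
  have := DFunLike.congr_fun h 0
  rw [symExp_zero, symExp_zero] at this
  exact Fin.ext this

theorem monomial_symExp (k : ℕ) (i : Fin (k + 1)) (a : R) :
    monomial (symExp k i) a = C a * (X 0 ^ (i : ℕ) * X 1 ^ (k - i)) := by
  rw [monomial_eq, Finsupp.prod_fintype _ _ (by simp), Fin.prod_univ_two, symExp_zero, symExp_one]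

theorem isHomogeneous_monomial_symExp (k : ℕ) (i : Fin (k + 1)) (a : R) :
    (monomial (symExp k i) a).IsHomogeneous k := by
  apply isHomogeneous_monomial
  rw [symExp, map_add, Finsupp.degree_single, Finsupp.degree_single]
  omega

theorem MvPolynomial.IsHomogeneous.sum_symExp {p : MvPolynomial (Fin 2) R} {k : ℕ}
    (hp : p.IsHomogeneous k) :
    ∑ i, monomial (symExp k i) (coeff (symExp k i) p) = p := by
  ext d
  rw [coeff_sum]
  simp only [coeff_monomial]
  by_cases hd : d.degree = k
  · have h : d 0 + d 1 = k := by
      rw [← hd, Finsupp.degree_eq_sum, Fin.sum_univ_two]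
    have hd' : symExp k ⟨d 0, by omega⟩ = d := by
      ext i
      fin_cases i
      · simp [symExp]
      · simp [symExp]; omega
    rw [Finset.sum_eq_single ⟨d 0, by omega⟩]
    · rw [if_pos hd', hd']
    · intro j _ hj
      rw [if_neg]
      intro h'
      exact hj (symExp_injective k (h'.trans hd'.symm))
    · simp
  · rw [hp.coeff_eq_zero hd]
    refine Finset.sum_eq_zero fun i _ => ?_
    rw [if_neg]
    rintro rfl
    apply hd
    rw [symExp, map_add, Finsupp.degree_single, Finsupp.degree_single]
    omega

/-- The matrix of `linSubst M` on homogeneous polynomials of degree `k` in two variables. -/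
noncomputable def symPow (k : ℕ) (M : Matrix (Fin 2) (Fin 2) R) :
    Matrix (Fin (k + 1)) (Fin (k + 1)) R :=
  Matrix.of fun i j => coeff (symExp k i) (linSubst M (monomial (symExp k j) 1))

theorem symPow_apply (k : ℕ) (M : Matrix (Fin 2) (Fin 2) R) (i j : Fin (k + 1)) :
    symPow k M i j = coeff (symExp k i) (linSubst M (monomial (symExp k j) 1)) := rfl

theorem symPow_mulVec {k : ℕ} (M : Matrix (Fin 2) (Fin 2) R) {p : MvPolynomial (Fin 2) R}
    (hp : p.IsHomogeneous k) :
    (symPow k M).mulVec (fun i => coeff (symExp k i) p) =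
      fun i => coeff (symExp k i) (linSubst M p) := by
  ext i
  conv_rhs => rw [← hp.sum_symExp, map_sum, coeff_sum]
  simp only [Matrix.mulVec, dotProduct, symPow_apply]
  refine Finset.sum_congr rfl fun j _ => ?_
  have : (monomial (symExp k j) (coeff (symExp k j) p) : MvPolynomial (Fin 2) R) =
      coeff (symExp k j) p • monomial (symExp k j) 1 := by simp [smul_monomial]
  rw [this, map_smul, coeff_smul, smul_eq_mul, mul_comm]

theorem symPow_mul (k : ℕ) (M N : Matrix (Fin 2) (Fin 2) R) :
    symPow k (M * N) = symPow k N * symPow k M := by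
  ext i j
  have := congrFun (symPow_mulVec N ((isHomogeneous_monomial_symExp k j (1 : R)).linSubst M)) i
  rw [symPow_apply, linSubst_mul_apply, ← this]
  rfl

theorem symPow_one (k : ℕ) : symPow k (1 : Matrix (Fin 2) (Fin 2) R) = 1 := by
  ext i j
  rw [symPow_apply, linSubst_one, coeff_monomial, Matrix.one_apply]
  simp only [(symExp_injective k).eq_iff, eq_comm]

theorem symPow_smul (k : ℕ) (c : R) (M : Matrix (Fin 2) (Fin 2) R) :
    symPow k (c • M) = c ^ k • symPow k M := by
  ext i j
  rw [symPow_apply, linSubst_smul_apply (isHomogeneous_monomial_symExp k j 1)]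
  simp [symPow_apply]

theorem symPow_map {S : Type*} [CommRing S] (f : R →+* S) (k : ℕ)
    (M : Matrix (Fin 2) (Fin 2) R) : symPow k (M.map f) = (symPow k M).map f := by
  ext i j
  rw [Matrix.map_apply, symPow_apply, symPow_apply, ← coeff_map, map_linSubst, map_monomial,
    RingHom.map_one]

theorem factorial_mul_symPow_transpose (k : ℕ) (M : Matrix (Fin 2) (Fin 2) R)
    (i j : Fin (k + 1)) :
    (((j : ℕ).factorial * (k - j).factorial : ℕ) : R) * symPow k M.transpose j i =
      (((i : ℕ).factorial * (k - i).factorial : ℕ) : R) * symPow k M i j := by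
  have hf (q : MvPolynomial (Fin 2) R) (i : Fin (k + 1)) :
      fischer q (monomial (symExp k i) 1) =
        (((i : ℕ).factorial * (k - i).factorial : ℕ) : R) * coeff (symExp k i) q := by
    rw [fischer_monomial, Fin.prod_univ_two, symExp_zero, symExp_one, one_mul]
  rw [symPow_apply, symPow_apply, ← hf, ← hf, ← fischer_linSubst, fischer_comm]

theorem trace_symPow_of_upper (k : ℕ) (t s u : R) :
    (symPow k !![t, u; 0, s]).trace = ∑ j ∈ Finset.range (k + 1), t ^ j * s ^ (k - j) := by
  rw [Finset.sum_range, Matrix.trace]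
  refine Finset.sum_congr rfl fun j _ => ?_
  have hpow (n : ℕ) : coeff (Finsupp.single (0 : Fin 2) n)
      ((C t * X 0 + C u * X 1 : MvPolynomial (Fin 2) R) ^ n) = t ^ n := by
    induction n with
    | zero => simp
    | succ n ih =>
      rw [pow_succ, mul_add, coeff_add, mul_left_comm, mul_left_comm _ (C u), coeff_C_mul,
        coeff_C_mul, coeff_mul_X', coeff_mul_X']
      simp [ih, pow_succ']
  have h1 : (C s * X 1 : MvPolynomial (Fin 2) R) ^ (k - j) =
      monomial (Finsupp.single 1 (k - j)) (s ^ (k - j)) := by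
    rw [mul_pow, ← C_pow, X_pow_eq_monomial, C_mul_monomial, mul_one]
  rw [Matrix.diag_apply, symPow_apply, monomial_symExp]
  simp only [map_mul, map_pow, linSubst_X, Fin.sum_univ_two, map_one]
  simp only [Matrix.cons_val', Matrix.cons_val_zero, Matrix.cons_val_one, Matrix.of_apply,
    Matrix.cons_val_fin_one, map_zero, zero_mul, zero_add, one_mul]
  rw [h1, symExp, coeff_mul_monomial, hpow]

theorem trace_symPow {K : Type*} [Field K] (k : ℕ) (M : Matrix (Fin 2) (Fin 2) K) {t s : K}
    (hts : t + s = M.trace) (hdet : t * s = M.det) :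
    (symPow k M).trace = ∑ j ∈ Finset.range (k + 1), t ^ j * s ^ (k - j) := by
  rw [Matrix.trace_fin_two] at hts
  rw [Matrix.det_fin_two] at hdet
  by_cases hc : M 1 0 = 0
  · rw [hc, mul_zero, sub_zero] at hdet
    have hM : M = !![M 0 0, M 0 1; 0, M 1 1] := by
      rw [← hc]; exact Matrix.eta_fin_two M
    have h : (t - M 0 0) * (t - M 1 1) = 0 := by linear_combination t * hts - hdet
    rw [hM, trace_symPow_of_upper]
    rcases mul_eq_zero.1 h with h | h
    · have h1 : M 0 0 = t := by linear_combination -h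
      have h2 : M 1 1 = s := by linear_combination h - hts
      rw [h1, h2]
    · have h1 : M 0 0 = s := by linear_combination h - hts
      have h2 : M 1 1 = t := by linear_combination -h
      rw [h1, h2, ← Finset.sum_range_reflect]
      refine Finset.sum_congr rfl fun j hj => ?_
      rw [Finset.mem_range] at hj
      rw [mul_comm]
      congr 2 <;> omega
  · let P : Matrix (Fin 2) (Fin 2) K := !![t - M 1 1, 1; M 1 0, 0]
    have hP : IsUnit P.det := by
      rw [Matrix.det_fin_two_of]; simpa using hc
    have hMP : M * P = P * !![t, 1; 0, s] := by
      rw [Matrix.eta_fin_two M]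
      simp only [P, Matrix.mul_fin_two]
      ext i j
      fin_cases i <;> fin_cases j <;> simp
      · linear_combination -t * hts + hdet
      · linear_combination -hts
      · ring
    have h1 : symPow k P * symPow k P⁻¹ = 1 := by
      rw [← symPow_mul, Matrix.nonsing_inv_mul P hP, symPow_one]
    have h2 := congrArg (symPow k) hMP
    rw [symPow_mul, symPow_mul] at h2
    calc (symPow k M).trace = (symPow k P * (symPow k M * symPow k P⁻¹)).trace := by
          rw [Matrix.trace_mul_comm, Matrix.mul_assoc, mul_eq_one_comm.1 h1, Matrix.mul_one]
      _ = _ := by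
          rw [← Matrix.mul_assoc, h2, Matrix.mul_assoc, h1, Matrix.mul_one,
            trace_symPow_of_upper]

end SymPow

end

section

open Polynomial (Chebyshev.U)

section Character

/-- The character of the `(2m+1)`-dimensional representation of `SU(2)` at an element with
eigenvalues `exp (± i arccos c)`. -/
noncomputable def sphChar (m : ℤ) (c : ℝ) : ℝ := (Chebyshev.U ℝ (2 * m)).eval c

theorem sphChar_zero (c : ℝ) : sphChar 0 c = 1 := by simp [sphChar]

theorem sphChar_add_one_add_sub_one (m : ℤ) (c : ℝ) :
    sphChar (m + 1) c + sphChar (m - 1) c = (4 * c ^ 2 - 2) * sphChar m c := by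
  have h (n : ℤ) : (Chebyshev.U ℝ (n + 2)).eval c =
      2 * c * (Chebyshev.U ℝ (n + 1)).eval c - (Chebyshev.U ℝ n).eval c := by
    rw [Polynomial.Chebyshev.U_add_two]; simp
  have h1 := h (2 * m)
  have h2 := h (2 * m - 1)
  have h3 := h (2 * m - 2)
  simp only [sphChar]
  ring_nf at h1 h2 h3 ⊢
  linear_combination h1 + 2 * c * h2 + h3

theorem sphChar_one (c : ℝ) : sphChar 1 c = 1 + (4 * c ^ 2 - 2) := by
  have := sphChar_add_one_add_sub_one 0 c
  have h : sphChar (-1) c = -1 := by simp [sphChar]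
  simp only [zero_add, zero_sub, h, sphChar_zero] at this
  linarith

theorem sphChar_mul (l : ℤ) (n : ℕ) (c : ℝ) :
    sphChar l c * sphChar n c = ∑ i ∈ Finset.range (2 * n + 1), sphChar (l - n + i) c := by
  induction n using Nat.twoStepInduction with
  | zero => simp [sphChar_zero]
  | one =>
    have := sphChar_add_one_add_sub_one l c
    simp [Finset.sum_range_succ, sphChar_one]
    ring_nf at this ⊢
    linarith
  | more n h1 h2 =>
    have hr := sphChar_add_one_add_sub_one (n + 1) c
    have e1 : ((n : ℤ) + 1 + 1) = ((n + 2 : ℕ) : ℤ) := by push_cast; ring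
    have e2 : ((n : ℤ) + 1 - 1) = (n : ℤ) := by ring
    have e3 : ((n : ℤ) + 1) = ((n + 1 : ℕ) : ℤ) := by push_cast; ring
    rw [e1, e2, e3] at hr
    have hr' : sphChar ((n + 2 : ℕ) : ℤ) c =
      (4 * c ^ 2 - 2) * sphChar ((n + 1 : ℕ) : ℤ) c - sphChar n c := by linarith
    rw [hr', mul_sub, mul_left_comm, h1, h2, Finset.mul_sum]
    have hf (i : ℕ) : (4 * c ^ 2 - 2) * sphChar (l - (n + 1 : ℕ) + i) c =
        sphChar (l - (n + 2 : ℕ) + i) c + sphChar (l - n + i) c := by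
      rw [← sphChar_add_one_add_sub_one, add_comm]
      congr 2 <;> push_cast <;> ring
    simp only [hf, Finset.sum_add_distrib]
    have e4 : 2 * (n + 1) + 1 = 2 * n + 1 + 1 + 1 := by ring
    have e5 : 2 * (n + 2) + 1 = 2 * n + 1 + 1 + 1 + 1 + 1 := by ring
    rw [e4, e5]
    simp only [Finset.sum_range_succ]
    push_cast
    ring_nf

theorem sphChar_sq_mul_le {c : ℝ} (hc : |c| ≤ 1) (m : ℤ) :
    sphChar m c ^ 2 * (1 - c ^ 2) ≤ 1 := by
  have h1 := abs_le.1 hc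
  have h2 := Polynomial.Chebyshev.U_real_cos (Real.arccos c) (2 * m)
  rw [Real.cos_arccos h1.1 h1.2] at h2
  have h3 : 1 - c ^ 2 = Real.sin (Real.arccos c) ^ 2 := by
    rw [Real.sin_sq, Real.cos_arccos h1.1 h1.2]
  rw [h3, ← mul_pow, sphChar, h2]
  exact (sq_le_one_iff_abs_le_one _).2 (Real.abs_sin_le_one _)

theorem abs_sphChar_le {c : ℝ} (hc : |c| ≤ 1) (m : ℕ) : |sphChar m c| ≤ 2 * m + 1 := by
  have h (n : ℕ) : |(Chebyshev.U ℝ n).eval c| ≤ n + 1 := by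
    induction n with
    | zero => simp
    | succ n ih =>
      push_cast
      rw [Polynomial.Chebyshev.U_eq_X_mul_U_add_T, Polynomial.eval_add, Polynomial.eval_mul,
        Polynomial.eval_X]
      have hT := Polynomial.Chebyshev.abs_eval_T_real_le_one (n + 1 : ℤ) hc
      calc _ ≤ |c * (Chebyshev.U ℝ n).eval c| + _ := abs_add_le _ _
        _ ≤ 1 * (n + 1) + 1 := by
          rw [abs_mul]
          gcongr
        _ = _ := by ring
  simpa [sphChar] using h (2 * m)

theorem sum_pow_mul_pow_eq_eval_U (k : ℕ) {r c : ℝ} {t s : ℂ} (h1 : t + s = 2 * r * c)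
    (h2 : t * s = r ^ 2) :
    ∑ j ∈ Finset.range (k + 1), t ^ j * s ^ (k - j) =
      ((r ^ k * (Chebyshev.U ℝ k).eval c : ℝ) : ℂ) := by
  have hs (k : ℕ) : ∑ j ∈ Finset.range (k + 1 + 1), t ^ j * s ^ (k + 1 - j) =
      t ^ (k + 1) + s * ∑ j ∈ Finset.range (k + 1), t ^ j * s ^ (k - j) := by
    rw [Finset.sum_range_succ, Nat.sub_self, pow_zero, mul_one, add_comm, Finset.mul_sum]
    congr 1
    refine Finset.sum_congr rfl fun j hj => ?_
    rw [Finset.mem_range] at hj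
    rw [show k + 1 - j = (k - j) + 1 by omega, pow_succ]; ring
  induction k using Nat.twoStepInduction with
  | zero => simp
  | one =>
    simp [Finset.sum_range_succ]
    linear_combination h1
  | more n ih1 ih2 =>
    rw [hs (n + 1)]
    push_cast
    rw [Polynomial.Chebyshev.U_add_two]
    have := hs n
    rw [ih2] at this
    rw [ih2]
    rw [ih1] at this
    push_cast at this ⊢
    simp only [Polynomial.eval_sub, Polynomial.eval_mul, Polynomial.eval_X,
      Polynomial.eval_ofNat]
    linear_combination -t * this - h2 * r ^ n * (Chebyshev.U ℂ n).eval (c : ℂ) +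
      h1 * r ^ (n + 1) * (Chebyshev.U ℂ (n + 1)).eval (c : ℂ)

theorem sphChar_pow_four_functional {W : (ℝ → ℝ) →ₗ[ℝ] ℝ} (hW : ∀ i : ℕ, 0 ≤ W (sphChar i))
    (m : ℕ) : ((m : ℝ) + 1) ^ 2 * W (sphChar m) ≤ W (fun c => sphChar m c ^ 4) := by
  have hmul {l n : ℕ} (h : n ≤ l) : (sphChar l * sphChar n : ℝ → ℝ) =
      ∑ i ∈ Finset.range (2 * n + 1), sphChar ((l - n + i : ℕ) : ℤ) := by
    ext c
    rw [Pi.mul_apply, sphChar_mul, Finset.sum_apply]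
    simp [h]
  have hnn' {l n : ℕ} (h : n ≤ l) : 0 ≤ W (sphChar l * sphChar n) := by
    rw [hmul h, map_sum]
    exact Finset.sum_nonneg fun i _ => hW _
  have hnn (l n : ℕ) : 0 ≤ W (sphChar l * sphChar n) := by
    rcases le_total n l with h | h
    · exact hnn' h
    · rw [mul_comm]; exact hnn' h
  have hle' {l n : ℕ} (h : n ≤ l) (hn : m ≤ n) (hl : l ≤ 2 * m) :
      W (sphChar m) ≤ W (sphChar l * sphChar n) := by
    rw [hmul h, map_sum]
    have := Finset.single_le_sum (f := fun i : ℕ => W (sphChar ((l - n + i : ℕ) : ℤ)))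
      (fun i _ => hW _) (Finset.mem_range.2 (show m - (l - n) < 2 * n + 1 by omega))
    simpa [show l - n + (m - (l - n)) = m by omega] using this
  have hle {l n : ℕ} (hml : m ≤ l) (hn : m ≤ n) (hl : l ≤ 2 * m) (hn' : n ≤ 2 * m) :
      W (sphChar m) ≤ W (sphChar l * sphChar n) := by
    rcases le_total n l with h | h
    · exact hle' h hn hl
    · rw [mul_comm]; exact hle' h hml hn'
  have h4 : (fun c => sphChar m c ^ 4) =
      ∑ l ∈ Finset.range (2 * m + 1), ∑ n ∈ Finset.range (2 * m + 1),
        (sphChar (l : ℕ) * sphChar (n : ℕ) : ℝ → ℝ) := by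
    have h2 : (sphChar m * sphChar m : ℝ → ℝ) =
        ∑ i ∈ Finset.range (2 * m + 1), sphChar (i : ℕ) := by
      rw [hmul le_rfl]; simp
    rw [← Finset.sum_mul_sum, ← h2]
    ext c
    simp only [Pi.mul_apply]
    ring
  rw [h4, map_sum]
  have hsub : Finset.Ico m (2 * m + 1) ⊆ Finset.range (2 * m + 1) := fun x hx => by
    rw [Finset.mem_Ico] at hx; exact Finset.mem_range.2 hx.2
  calc ((m : ℝ) + 1) ^ 2 * W (sphChar m)
      = ∑ _l ∈ Finset.Ico m (2 * m + 1), ∑ _n ∈ Finset.Ico m (2 * m + 1), W (sphChar m) := by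
        simp only [Finset.sum_const, Nat.card_Ico, nsmul_eq_mul,
          show 2 * m + 1 - m = m + 1 by omega]
        push_cast
        ring
    _ ≤ ∑ l ∈ Finset.Ico m (2 * m + 1), ∑ n ∈ Finset.Ico m (2 * m + 1),
          W (sphChar l * sphChar n) := by
        refine Finset.sum_le_sum fun l hl => Finset.sum_le_sum fun n hn => ?_
        rw [Finset.mem_Ico] at hl hn
        exact hle hl.1 hn.1 (by omega) (by omega)
    _ ≤ ∑ l ∈ Finset.range (2 * m + 1), ∑ n ∈ Finset.range (2 * m + 1),
          W (sphChar l * sphChar n) := by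
        refine (Finset.sum_le_sum fun l _ => Finset.sum_le_sum_of_subset_of_nonneg hsub
          fun n _ _ => hnn l n).trans ?_
        exact Finset.sum_le_sum_of_subset_of_nonneg hsub
          fun l _ _ => Finset.sum_nonneg fun n _ => hnn l n
    _ = _ := by simp only [map_sum]

end Character

end

section

open Quaternion

section SphRep

/-- The `2 × 2` complex matrix of an integral quaternion. -/
noncomputable def quatMat (q : ℍ[ℤ]) : Matrix (Fin 2) (Fin 2) ℂ :=
  !![(q.re : ℂ) + q.imI * Complex.I, (q.imJ : ℂ) + q.imK * Complex.I;
    -(q.imJ : ℂ) + q.imK * Complex.I, (q.re : ℂ) - q.imI * Complex.I]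

theorem quatMat_mul (p q : ℍ[ℤ]) : quatMat (p * q) = quatMat p * quatMat q := by
  have hI : Complex.I ^ 2 = -1 := Complex.I_sq
  simp only [quatMat, Matrix.mul_fin_two]
  ext i j
  fin_cases i <;> fin_cases j <;> simp <;> ring_nf <;> simp only [hI]
  all_goals ring

theorem quatMat_star (q : ℍ[ℤ]) :
    quatMat (star q) = ((quatMat q).map (starRingEnd ℂ)).transpose := by
  ext i j
  fin_cases i <;> fin_cases j <;> simp [quatMat]

theorem quatMat_natCast_mul (n : ℕ) (q : ℍ[ℤ]) : quatMat (n * q) = (n : ℂ) • quatMat q := by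
  ext i j
  fin_cases i <;> fin_cases j <;> simp [quatMat, mul_add, mul_sub] <;> ring

theorem trace_quatMat (q : ℍ[ℤ]) : (quatMat q).trace = 2 * q.re := by
  simp [quatMat, Matrix.trace_fin_two]; ring

theorem det_quatMat (q : ℍ[ℤ]) : (quatMat q).det = (normSq q : ℤ) := by
  rw [quatMat, Matrix.det_fin_two_of, normSq_def']
  push_cast
  ring_nf
  simp only [Complex.I_sq]
  ring

/-- The `(2m+1)`-dimensional irreducible representation of the quaternions modulo scalars,
as an anti-homomorphism. -/
noncomputable def sphRep (m : ℕ) (q : ℍ[ℤ]) : Matrix (Fin (2 * m + 1)) (Fin (2 * m + 1)) ℂ :=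
  ((normSq q : ℤ) : ℂ)⁻¹ ^ m • symPow (2 * m) (quatMat q)

theorem sphRep_mul (m : ℕ) (p q : ℍ[ℤ]) : sphRep m (p * q) = sphRep m q * sphRep m p := by
  rw [sphRep, sphRep, sphRep, quatMat_mul, symPow_mul, map_mul, Int.cast_mul, mul_inv, mul_pow,
    Matrix.smul_mul, Matrix.mul_smul, smul_smul, mul_comm (_ ^ m)]

theorem sphRep_natCast_mul (m : ℕ) {n : ℕ} (hn : n ≠ 0) (q : ℍ[ℤ]) :
    sphRep m (n * q) = sphRep m q := by
  have hn' : (n : ℂ) ≠ 0 := Nat.cast_ne_zero.2 hn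
  have : normSq (n : ℍ[ℤ]) = (n : ℤ) ^ 2 := by
    rw [normSq_def']; simp
  rw [sphRep, sphRep, quatMat_natCast_mul, symPow_smul, map_mul, smul_smul, this]
  congr 1
  push_cast
  rw [pow_mul, ← mul_pow]
  congr 1
  field_simp

theorem sphRep_neg (m : ℕ) (q : ℍ[ℤ]) : sphRep m (-q) = sphRep m q := by
  have h : quatMat (-q) = (-1 : ℂ) • quatMat q := by
    ext i j
    fin_cases i <;> fin_cases j <;> simp [quatMat] <;> ring
  rw [sphRep, sphRep, h, symPow_smul, pow_mul, normSq_neg]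
  simp

theorem sphRep_one (m : ℕ) : sphRep m 1 = 1 := by
  have h : quatMat 1 = 1 := by
    ext i j
    fin_cases i <;> fin_cases j <;> simp [quatMat]
  rw [sphRep, h, symPow_one]
  simp

/-- The weights of the invariant inner product on homogeneous polynomials. -/
def symWeight (k : ℕ) (i : Fin (k + 1)) : ℝ := ((i : ℕ).factorial * (k - i).factorial : ℕ)

theorem symWeight_pos (k : ℕ) (i : Fin (k + 1)) : 0 < symWeight k i := by
  rw [symWeight]
  exact_mod_cast Nat.mul_pos (Nat.factorial_pos _) (Nat.factorial_pos _)

theorem sphRep_star_apply (m : ℕ) (q : ℍ[ℤ]) (i j : Fin (2 * m + 1)) :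
    symWeight (2 * m) j * sphRep m (star q) j i =
      symWeight (2 * m) i * starRingEnd ℂ (sphRep m q i j) := by
  have := factorial_mul_symPow_transpose (2 * m) ((quatMat q).map (starRingEnd ℂ)) i j
  rw [symPow_map] at this
  simp only [sphRep, quatMat_star, normSq_star, symWeight, Matrix.smul_apply, smul_eq_mul, map_mul,
    map_pow, map_inv₀, map_intCast, Matrix.map_apply] at this ⊢
  push_cast at this ⊢
  linear_combination ((normSq q : ℤ) : ℂ)⁻¹ ^ m * this

theorem trace_sphRep (m : ℕ) {q : ℍ[ℤ]} (hq : q ≠ 0) :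
    (sphRep m q).trace = (sphChar m (q.re / √(normSq q : ℤ)) : ℝ) := by
  have hN : 0 < normSq q := lt_of_le_of_ne normSq_nonneg (Ne.symm (normSq_ne_zero.2 hq))
  have hr : (0 : ℝ) < (normSq q : ℤ) := Int.cast_pos.2 hN
  set r : ℝ := √(normSq q : ℤ) with hrdef
  have hr0 : 0 < r := Real.sqrt_pos.2 hr
  have hr2 : r ^ 2 = (normSq q : ℤ) := Real.sq_sqrt hr.le
  obtain ⟨t, ht⟩ := IsAlgClosed.exists_pow_nat_eq ((q.re : ℂ) ^ 2 - (normSq q : ℤ)) two_pos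
  have h1 : ((q.re : ℂ) + t) + (q.re - t) = 2 * (r : ℂ) * ((q.re / r : ℝ) : ℂ) := by
    push_cast
    have : (r : ℂ) ≠ 0 := by exact_mod_cast hr0.ne'
    field_simp
    ring
  have hr2' : (r : ℂ) ^ 2 = (normSq q : ℤ) := by exact_mod_cast congrArg (fun x : ℝ => (x : ℂ)) hr2
  have h2 : ((q.re : ℂ) + t) * (q.re - t) = (r : ℂ) ^ 2 := by
    rw [hr2']; linear_combination -ht
  have := sum_pow_mul_pow_eq_eval_U (2 * m) h1 h2
  rw [← trace_symPow (2 * m) (quatMat q) (t := q.re + t) (s := q.re - t)] at this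
  · rw [sphRep, Matrix.trace_smul, this, smul_eq_mul, sphChar, ← hr2', pow_mul]
    have : (r : ℂ) ≠ 0 := by exact_mod_cast hr0.ne'
    push_cast
    rw [← mul_assoc, ← mul_pow, inv_mul_cancel₀ (pow_ne_zero 2 this), one_pow, one_mul]
  · rw [trace_quatMat]; ring
  · rw [det_quatMat, h2, hr2']

end SphRep

end

section

open Polynomial

section HeckePoly

/-- The Hecke polynomials at `5`: rescaled Chebyshev polynomials of the second kind. -/
noncomputable def heckePoly : ℕ → ℝ[X]
  | 0 => 1
  | 1 => X
  | n + 2 => X * heckePoly (n + 1) - 5 * heckePoly n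

theorem heckePoly_zero : heckePoly 0 = 1 := by rw [heckePoly]

theorem heckePoly_one : heckePoly 1 = X := by rw [heckePoly]

theorem heckePoly_add_two (n : ℕ) :
    heckePoly (n + 2) = X * heckePoly (n + 1) - 5 * heckePoly n := by rw [heckePoly]

theorem heckePoly_add_add_two (a b : ℕ) :
    heckePoly (a + b + 2) =
      heckePoly (a + 1) * heckePoly (b + 1) - 5 * (heckePoly a * heckePoly b) := by
  induction b using Nat.twoStepInduction with
  | zero => rw [heckePoly_one, heckePoly_zero, add_zero, heckePoly_add_two]; ring
  | one =>
    rw [heckePoly_add_two (a + 1), heckePoly_add_two 0, add_assoc a 1 1, heckePoly_add_two a,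
      heckePoly_one, heckePoly_zero]
    ring
  | more n h1 h2 =>
    have e1 : a + (n + 2) + 2 = (a + n + 2) + 2 := by ring
    have e2 : a + (n + 1) + 2 = (a + n + 2) + 1 := by ring
    rw [e2] at h2
    rw [e1, heckePoly_add_two, h2, h1, heckePoly_add_two (n + 1), heckePoly_add_two n]
    ring

theorem heckePoly_sq (L : ℕ) :
    heckePoly L ^ 2 = ∑ j ∈ Finset.range (L + 1), 5 ^ (L - j) * heckePoly (2 * j) := by
  induction L with
  | zero => simp [heckePoly_zero]
  | succ L ih =>
    rw [Finset.sum_range_succ, Nat.sub_self, pow_zero, one_mul]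
    have h : ∑ j ∈ Finset.range (L + 1), 5 ^ (L + 1 - j) * heckePoly (2 * j) =
        5 * heckePoly L ^ 2 := by
      rw [ih, Finset.mul_sum]
      refine Finset.sum_congr rfl fun j hj => ?_
      rw [Finset.mem_range] at hj
      rw [show L + 1 - j = (L - j) + 1 by omega, pow_succ]
      ring
    rw [h, show 2 * (L + 1) = L + L + 2 by ring, heckePoly_add_add_two]
    ring

theorem pow_le_eval_heckePoly {τ x : ℝ} (hτ : 0 < τ) (hx : τ + 5 / τ ≤ x) (n : ℕ) :
    τ ^ n ≤ (heckePoly n).eval x := by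
  have h (n : ℕ) : 0 < (heckePoly n).eval x ∧
      τ * (heckePoly n).eval x ≤ (heckePoly (n + 1)).eval x := by
    induction n with
    | zero =>
      have : 0 < 5 / τ := by positivity
      rw [heckePoly_one, heckePoly_zero]
      simp only [eval_one, eval_X, mul_one]
      exact ⟨one_pos, by linarith⟩
    | succ n ih =>
      obtain ⟨h1, h2⟩ := ih
      have h3 : 0 < (heckePoly (n + 1)).eval x := lt_of_lt_of_le (by positivity) h2
      refine ⟨h3, ?_⟩
      rw [heckePoly_add_two]
      simp only [eval_sub, eval_mul, eval_X, eval_ofNat]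
      have h4 : 5 * (heckePoly n).eval x ≤ 5 / τ * (heckePoly (n + 1)).eval x := by
        rw [div_mul_eq_mul_div, le_div_iff₀ hτ]
        nlinarith
      nlinarith [mul_le_mul_of_nonneg_right hx h3.le]
  induction n with
  | zero => simp [heckePoly_zero]
  | succ n ih =>
    rw [pow_succ']
    exact (mul_le_mul_of_nonneg_left ih hτ.le).trans (h n).2

end HeckePoly

section WeightedSelfAdjoint

variable {n : Type*} [Fintype n] [DecidableEq n]

/-- `A` is self-adjoint for the inner product with diagonal weights `w`. -/
def IsWeightedSelfAdjoint (w : n → ℝ) (A : Matrix n n ℂ) : Prop :=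
  ∀ i j, w i * A i j = w j * starRingEnd ℂ (A j i)

variable {w : n → ℝ} {A B : Matrix n n ℂ}

omit [Fintype n] [DecidableEq n] in
theorem IsWeightedSelfAdjoint.add (hA : IsWeightedSelfAdjoint w A)
    (hB : IsWeightedSelfAdjoint w B) : IsWeightedSelfAdjoint w (A + B) := fun i j => by
  rw [Matrix.add_apply, Matrix.add_apply, mul_add, hA, hB, map_add, mul_add]

theorem isWeightedSelfAdjoint_algebraMap (r : ℝ) :
    IsWeightedSelfAdjoint w (algebraMap ℝ (Matrix n n ℂ) r) := fun i j => by
  rw [Matrix.algebraMap_matrix_apply, Matrix.algebraMap_matrix_apply]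
  by_cases h : i = j
  · subst h; simp
  · simp [h, Ne.symm h]

omit [DecidableEq n] in
theorem IsWeightedSelfAdjoint.mul (hA : IsWeightedSelfAdjoint w A)
    (hB : IsWeightedSelfAdjoint w B) (h : Commute A B) :
    IsWeightedSelfAdjoint w (A * B) := fun i j => by
  conv_rhs => rw [h.eq]
  rw [Matrix.mul_apply, Matrix.mul_apply, map_sum, Finset.mul_sum, Finset.mul_sum]
  refine Finset.sum_congr rfl fun k _ => ?_
  rw [← mul_assoc, hA, map_mul]
  linear_combination starRingEnd ℂ (A k i) * hB k j

theorem IsWeightedSelfAdjoint.aeval (hA : IsWeightedSelfAdjoint w A) (p : ℝ[X]) :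
    IsWeightedSelfAdjoint w (aeval A p) := by
  induction p using Polynomial.induction_on' with
  | add p q hp hq => rw [map_add]; exact hp.add hq
  | monomial k r =>
    rw [aeval_monomial]
    have hk : IsWeightedSelfAdjoint w (A ^ k) := by
      induction k with
      | zero => simpa using isWeightedSelfAdjoint_algebraMap (w := w) (n := n) 1
      | succ k ih => rw [pow_succ]; exact ih.mul hA (Commute.pow_left (Commute.refl A) k)
    exact (isWeightedSelfAdjoint_algebraMap r).mul hk (Algebra.commutes r _)

omit [DecidableEq n] in
theorem IsWeightedSelfAdjoint.trace_mul_self (hw : ∀ i, 0 < w i)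
    (hA : IsWeightedSelfAdjoint w A) :
    (A * A).trace = (∑ i, ∑ j, w i / w j * ‖A i j‖ ^ 2 : ℝ) := by
  rw [Matrix.trace]
  push_cast
  refine Finset.sum_congr rfl fun i _ => ?_
  rw [Matrix.diag_apply, Matrix.mul_apply]
  refine Finset.sum_congr rfl fun j _ => ?_
  have hj : (w j : ℂ) ≠ 0 := by exact_mod_cast (hw j).ne'
  have h1 : A j i = w i / w j * starRingEnd ℂ (A i j) := by
    rw [div_mul_eq_mul_div, eq_div_iff hj, mul_comm, hA]
  rw [h1, mul_left_comm, Complex.mul_conj, Complex.normSq_eq_norm_sq]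
  push_cast
  ring

omit [DecidableEq n] in
theorem IsWeightedSelfAdjoint.sq_le_trace_mul_self (hw : ∀ i, 0 < w i)
    (hA : IsWeightedSelfAdjoint w A) {v : n → ℂ} (hv : v ≠ 0) {r : ℝ}
    (h : A.mulVec v = (r : ℂ) • v) : r ^ 2 ≤ (A * A).trace.re := by
  rw [hA.trace_mul_self hw, Complex.ofReal_re]
  set V := ∑ j, w j * ‖v j‖ ^ 2 with hV
  have hVpos : 0 < V := by
    obtain ⟨j, hj⟩ := Function.ne_iff.1 hv
    have hj' : 0 < ‖v j‖ := norm_pos_iff.2 hj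
    refine Finset.sum_pos' (fun i _ => by have := hw i; positivity) ⟨j, Finset.mem_univ j, ?_⟩
    have := hw j
    positivity
  have hrow (i : n) : r ^ 2 * ‖v i‖ ^ 2 ≤ (∑ j, ‖A i j‖ ^ 2 / w j) * V := by
    have h1 : ‖(r : ℂ) * v i‖ ≤ ∑ j, ‖A i j‖ * ‖v j‖ := by
      have := congrFun h i
      simp only [Matrix.mulVec, dotProduct, Pi.smul_apply, smul_eq_mul] at this
      rw [← this]
      refine (norm_sum_le _ _).trans (le_of_eq ?_)
      simp
    have h2 : r ^ 2 * ‖v i‖ ^ 2 ≤ (∑ j, ‖A i j‖ * ‖v j‖) ^ 2 := by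
      have := pow_le_pow_left₀ (norm_nonneg _) h1 2
      rwa [norm_mul, mul_pow, Complex.norm_real, Real.norm_eq_abs, sq_abs] at this
    refine h2.trans ?_
    refine Finset.sum_sq_le_sum_mul_sum_of_sq_le_mul _ (fun j _ => ?_) (fun j _ => ?_)
      (fun j _ => ?_)
    · have := hw j; positivity
    · have := hw j; positivity
    · have := (hw j).ne'; field_simp; rfl
  have : r ^ 2 * V ≤ (∑ i, ∑ j, w i / w j * ‖A i j‖ ^ 2) * V := by
    calc r ^ 2 * V = ∑ i, w i * (r ^ 2 * ‖v i‖ ^ 2) := by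
          rw [hV, Finset.mul_sum]; exact Finset.sum_congr rfl fun i _ => by ring
      _ ≤ ∑ i, w i * ((∑ j, ‖A i j‖ ^ 2 / w j) * V) :=
          Finset.sum_le_sum fun i _ => mul_le_mul_of_nonneg_left (hrow i) (hw i).le
      _ = _ := by
          rw [Finset.sum_mul]
          refine Finset.sum_congr rfl fun i _ => ?_
          rw [← mul_assoc]
          congr 1
          rw [Finset.mul_sum]
          exact Finset.sum_congr rfl fun j _ => by ring
  exact le_of_mul_le_mul_right this hVpos

theorem Matrix.aeval_mulVec_of_mulVec_eq_smul {A : Matrix n n ℂ} {v : n → ℂ} {r : ℝ}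
    (h : A.mulVec v = (r : ℂ) • v) (p : ℝ[X]) :
    (Polynomial.aeval A p).mulVec v = ((p.eval r : ℝ) : ℂ) • v := by
  have hk (k : ℕ) : (A ^ k).mulVec v = ((r ^ k : ℝ) : ℂ) • v := by
    induction k with
    | zero => simp
    | succ k ih =>
      rw [pow_succ, ← Matrix.mulVec_mulVec, h, Matrix.mulVec_smul, ih, smul_smul]
      congr 1; push_cast; ring
  induction p using Polynomial.induction_on' with
  | add p q hp hq => rw [map_add, Matrix.add_mulVec, hp, hq, eval_add, ← add_smul]; push_cast; rfl
  | monomial k s =>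
    rw [aeval_monomial, ← Algebra.smul_def, Matrix.smul_mulVec, hk, eval_monomial]
    ext i
    simp [mul_assoc]

end WeightedSelfAdjoint

end

section

open Quaternion

section HeckeQuaternion

/-- The six integral quaternions `1 ± 2i`, `1 ± 2j`, `1 ± 2k` of norm `5`. -/
def heckeGen (i : Fin 6) : ℍ[ℤ] :=
  ⟨1, ![2, -2, 0, 0, 0, 0] i, ![0, 0, 2, -2, 0, 0] i, ![0, 0, 0, 0, 2, -2] i⟩

/-- Integral quaternions of norm `5 ^ r` congruent to `1` modulo `2`. -/
def oddQuat (r : ℕ) : Set ℍ[ℤ] :=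
  {q | normSq q = 5 ^ r ∧ Odd q.re ∧ Even q.imI ∧ Even q.imJ ∧ Even q.imK}

theorem finite_setOf_normSq_eq (N : ℤ) : {q : ℍ[ℤ] | normSq q = N}.Finite := by
  have hs : (Set.Icc (-N) N).Finite := Set.finite_Icc _ _
  have hinj : Function.Injective (fun q : ℍ[ℤ] => (q.re, q.imI, q.imJ, q.imK)) := by
    intro p q h
    simp only [Prod.mk.injEq] at h
    exact QuaternionAlgebra.ext h.1 h.2.1 h.2.2.1 h.2.2.2
  refine Set.Finite.of_finite_image ((hs.prod (hs.prod (hs.prod hs))).subset ?_) hinj.injOn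
  rintro _ ⟨q, hq, rfl⟩
  have hq' : normSq q = N := hq
  rw [normSq_def'] at hq'
  simp only [Set.mem_prod, Set.mem_Icc]
  refine ⟨⟨?_, ?_⟩, ⟨?_, ?_⟩, ⟨?_, ?_⟩, ⟨?_, ?_⟩⟩ <;>
  nlinarith [Int.le_self_sq q.re, Int.le_self_sq (-q.re), Int.le_self_sq q.imI,
    Int.le_self_sq (-q.imI), Int.le_self_sq q.imJ, Int.le_self_sq (-q.imJ),
    Int.le_self_sq q.imK, Int.le_self_sq (-q.imK), sq_nonneg q.re, sq_nonneg q.imI,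
    sq_nonneg q.imJ, sq_nonneg q.imK]

theorem finite_oddQuat (r : ℕ) : (oddQuat r).Finite :=
  (finite_setOf_normSq_eq (5 ^ r)).subset fun _ hq => hq.1

/-- `oddQuat r` as a finite set. -/
noncomputable def oddQuatFinset (r : ℕ) : Finset ℍ[ℤ] := (finite_oddQuat r).toFinset

theorem mem_oddQuatFinset {r : ℕ} {q : ℍ[ℤ]} : q ∈ oddQuatFinset r ↔
    normSq q = 5 ^ r ∧ Odd q.re ∧ Even q.imI ∧ Even q.imJ ∧ Even q.imK := by
  rw [oddQuatFinset, Set.Finite.mem_toFinset]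
  rfl

theorem normSq_heckeGen (i : Fin 6) : normSq (heckeGen i) = 5 := by
  rw [normSq_def']
  fin_cases i <;> simp [heckeGen]

theorem heckeGen_mul_star (i : Fin 6) : heckeGen i * star (heckeGen i) = 5 := by
  rw [self_mul_star, normSq_heckeGen]; rfl

theorem heckeGen_star_mul (i : Fin 6) : star (heckeGen i) * heckeGen i = 5 := by
  rw [star_mul_self, normSq_heckeGen]; rfl

theorem five_dvd_quaternion_iff {q : ℍ[ℤ]} :
    5 ∣ q ↔ 5 ∣ q.re ∧ 5 ∣ q.imI ∧ 5 ∣ q.imJ ∧ 5 ∣ q.imK := by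
  have h1 : (5 : ℍ[ℤ]).re = 5 := rfl
  have h2 : (5 : ℍ[ℤ]).imI = 0 := rfl
  have h3 : (5 : ℍ[ℤ]).imJ = 0 := rfl
  have h4 : (5 : ℍ[ℤ]).imK = 0 := rfl
  constructor
  · rintro ⟨c, rfl⟩
    simp [h1, h2, h3, h4]
  · rintro ⟨⟨a, ha⟩, ⟨b, hb⟩, ⟨c, hc⟩, ⟨d, hd⟩⟩
    obtain ⟨x, rfl, rfl, rfl, rfl⟩ :
        ∃ x : ℍ[ℤ], x.re = a ∧ x.imI = b ∧ x.imJ = c ∧ x.imK = d :=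
      ⟨⟨a, b, c, d⟩, rfl, rfl, rfl, rfl⟩
    exact ⟨x, by ext <;> simp [h1, h2, h3, h4, ha, hb, hc, hd]⟩

theorem card_isotropic_zmod_five : ∀ a b c d : ZMod 5, a * a + b * b + c * c + d * d = 0 →
    ¬(a = 0 ∧ b = 0 ∧ c = 0 ∧ d = 0) →
    (Finset.univ.filter fun i : Fin 6 =>
      a + ![2, -2, 0, 0, 0, 0] i * b + ![0, 0, 2, -2, 0, 0] i * c +
          ![0, 0, 0, 0, 2, -2] i * d = 0 ∧
        b - ![2, -2, 0, 0, 0, 0] i * a - ![0, 0, 2, -2, 0, 0] i * d +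
          ![0, 0, 0, 0, 2, -2] i * c = 0 ∧
        c - ![0, 0, 2, -2, 0, 0] i * a - ![0, 0, 0, 0, 2, -2] i * b +
          ![2, -2, 0, 0, 0, 0] i * d = 0 ∧
        d - ![0, 0, 0, 0, 2, -2] i * a - ![2, -2, 0, 0, 0, 0] i * c +
          ![0, 0, 2, -2, 0, 0] i * b = 0).card = 1 := by
  decide +kernel

open Classical in
theorem card_five_dvd_star_heckeGen_mul {w : ℍ[ℤ]} (hw : 5 ∣ normSq w) :
    (Finset.univ.filter fun i : Fin 6 => 5 ∣ star (heckeGen i) * w).card =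
      if 5 ∣ w then 6 else 1 := by
  split_ifs with h
  · rw [Finset.filter_true_of_mem fun i _ => ?_]
    · simp
    · obtain ⟨c, rfl⟩ := h
      refine ⟨star (heckeGen i) * c, ?_⟩
      rw [← mul_assoc, ← mul_assoc]
      congr 1
      exact (Nat.cast_commute 5 (star (heckeGen i))).eq.symm
  · have h5 (n : ℤ) : 5 ∣ n ↔ (n : ZMod 5) = 0 := by
      rw [ZMod.intCast_zmod_eq_zero_iff_dvd]; rfl
    have h0 : ((w.re : ZMod 5)) * w.re + w.imI * w.imI + w.imJ * w.imJ + w.imK * w.imK = 0 := by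
      rw [h5, normSq_def'] at hw
      push_cast at hw
      linear_combination hw
    rw [five_dvd_quaternion_iff] at h
    simp only [h5] at h
    rw [← card_isotropic_zmod_five _ _ _ _ h0 h]
    congr 1
    ext i
    simp only [Finset.mem_filter, Finset.mem_univ, true_and]
    rw [five_dvd_quaternion_iff]
    simp only [h5]
    have h1 : (heckeGen i).re = 1 := rfl
    have h2 : (heckeGen i).imI = ![2, -2, 0, 0, 0, 0] i := rfl
    have h3 : (heckeGen i).imJ = ![0, 0, 2, -2, 0, 0] i := rfl
    have h4 : (heckeGen i).imK = ![0, 0, 0, 0, 2, -2] i := rfl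
    simp only [Quaternion.re_mul, Quaternion.imI_mul, Quaternion.imJ_mul, Quaternion.imK_mul,
      Quaternion.re_star, Quaternion.imI_star, Quaternion.imJ_star, Quaternion.imK_star, h1, h2,
      h3, h4]
    push_cast
    fin_cases i <;> simp <;> ring_nf
    all_goals exact fun _ => by simp

theorem heckeGen_mul_mem_oddQuatFinset (i : Fin 6) {r : ℕ} {q : ℍ[ℤ]}
    (hq : q ∈ oddQuatFinset r) : heckeGen i * q ∈ oddQuatFinset (r + 1) := by
  rw [mem_oddQuatFinset] at hq ⊢
  obtain ⟨h, ha, hb, hc, hd⟩ := hq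
  refine ⟨by rw [map_mul, normSq_heckeGen, h, pow_succ'], ?_⟩
  have h1 : (heckeGen i).re = 1 := rfl
  have h2 : Even (heckeGen i).imI := by fin_cases i <;> simp [heckeGen]
  have h3 : Even (heckeGen i).imJ := by fin_cases i <;> simp [heckeGen]
  have h4 : Even (heckeGen i).imK := by fin_cases i <;> simp [heckeGen]
  simp only [Quaternion.re_mul, Quaternion.imI_mul, Quaternion.imJ_mul, Quaternion.imK_mul, h1,
    one_mul]
  exact ⟨((ha.sub_even (h2.mul_right _)).sub_even (h3.mul_right _)).sub_even (h4.mul_right _),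
    ((hb.add (h2.mul_right _)).add (h3.mul_right _)).sub (h4.mul_right _),
    ((hc.sub (h2.mul_right _)).add (h3.mul_right _)).add (h4.mul_right _),
    ((hd.add (h2.mul_right _)).sub (h3.mul_right _)).add (h4.mul_right _)⟩

theorem five_mul_mem_oddQuatFinset_iff {r : ℕ} {q : ℍ[ℤ]} :
    5 * q ∈ oddQuatFinset (r + 2) ↔ q ∈ oddQuatFinset r := by
  have h1 : (5 * q).re = 5 * q.re := by
    rw [Quaternion.re_mul]
    change 5 * q.re - 0 * q.imI - 0 * q.imJ - 0 * q.imK = _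
    ring
  have h2 : (5 * q).imI = 5 * q.imI := by
    rw [Quaternion.imI_mul]
    change 5 * q.imI + 0 * q.re + 0 * q.imK - 0 * q.imJ = _
    ring
  have h3 : (5 * q).imJ = 5 * q.imJ := by
    rw [Quaternion.imJ_mul]
    change 5 * q.imJ - 0 * q.imK + 0 * q.re + 0 * q.imI = _
    ring
  have h4 : (5 * q).imK = 5 * q.imK := by
    rw [Quaternion.imK_mul]
    change 5 * q.imK + 0 * q.imJ - 0 * q.imI + 0 * q.re = _
    ring
  have h5 : normSq (5 * q) = 25 * normSq q := by
    rw [normSq_def', normSq_def', h1, h2, h3, h4]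
    ring
  rw [mem_oddQuatFinset, mem_oddQuatFinset, h1, h2, h3, h4, h5, Int.odd_mul, Int.even_mul,
    Int.even_mul, Int.even_mul, pow_add]
  have h6 : ¬ Even (5 : ℤ) := by decide
  have h7 : Odd (5 : ℤ) := by decide
  simp only [h6, h7, true_and, false_or]
  refine and_congr ⟨fun h => by linarith, fun h => by rw [h]; ring⟩ Iff.rfl

theorem exists_star_heckeGen_eq (i : Fin 6) : ∃ j, star (heckeGen i) = heckeGen j := by
  fin_cases i
  exacts [⟨1, by ext <;> rfl⟩, ⟨0, by ext <;> rfl⟩, ⟨3, by ext <;> rfl⟩,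
    ⟨2, by ext <;> rfl⟩, ⟨5, by ext <;> rfl⟩, ⟨4, by ext <;> rfl⟩]

theorem five_quaternion_ne_zero : (5 : ℍ[ℤ]) ≠ 0 := by
  intro h
  have : (5 : ℍ[ℤ]).re = 0 := by rw [h]; rfl
  exact absurd this (by decide)

open Classical in
theorem sum_heckeGen_mul_eq_sum_filter {M : Type*} [AddCommMonoid M] (φ : ℍ[ℤ] → M) (r : ℕ)
    (i : Fin 6) : ∑ q ∈ oddQuatFinset r, φ (heckeGen i * q) =
      ∑ w ∈ oddQuatFinset (r + 1) with 5 ∣ star (heckeGen i) * w, φ w := by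
  have hcomm (x : ℍ[ℤ]) : x * 5 = 5 * x := (Nat.cast_commute 5 x).eq.symm
  refine Finset.sum_nbij (heckeGen i * ·) (fun q hq => ?_) (fun p _ q _ h => ?_)
    (fun w hw => ?_) (fun q _ => rfl)
  · rw [Finset.mem_filter]
    refine ⟨heckeGen_mul_mem_oddQuatFinset i hq, q, ?_⟩
    rw [← mul_assoc, heckeGen_star_mul]
  · have := congrArg (star (heckeGen i) * ·) h
    simp only [← mul_assoc, heckeGen_star_mul] at this
    exact mul_left_cancel₀ five_quaternion_ne_zero this
  · rw [Finset.mem_coe, Finset.mem_filter] at hw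
    obtain ⟨hw, q, hq⟩ := hw
    have hwq : heckeGen i * q = w := by
      have := congrArg (heckeGen i * ·) hq
      simp only [← mul_assoc, heckeGen_mul_star, hcomm] at this
      rw [mul_assoc] at this
      exact (mul_left_cancel₀ five_quaternion_ne_zero this).symm
    refine ⟨q, ?_, hwq⟩
    rw [Finset.mem_coe, ← five_mul_mem_oddQuatFinset_iff, ← hq]
    obtain ⟨j, hj⟩ := exists_star_heckeGen_eq i
    rw [hj]
    exact heckeGen_mul_mem_oddQuatFinset j hw

theorem sum_heckeGen_mul_zero {M : Type*} [AddCommMonoid M] (φ : ℍ[ℤ] → M) :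
    ∑ i, ∑ q ∈ oddQuatFinset 0, φ (heckeGen i * q) = ∑ q ∈ oddQuatFinset 1, φ q := by
  classical
  simp only [sum_heckeGen_mul_eq_sum_filter, Finset.sum_filter, zero_add]
  rw [Finset.sum_comm]
  refine Finset.sum_congr rfl fun w hw => ?_
  have hN := (mem_oddQuatFinset.1 hw).1
  rw [← Finset.sum_filter, Finset.sum_const, card_five_dvd_star_heckeGen_mul, if_neg, one_smul]
  · rintro ⟨q, rfl⟩
    have h5 : normSq (5 : ℍ[ℤ]) = 25 := by rw [normSq_def']; rfl
    rw [map_mul, h5] at hN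
    omega
  · rw [hN, pow_one]

theorem sum_oddQuatFinset_zero {M : Type*} [AddCommMonoid M] (φ : ℍ[ℤ] → M) :
    ∑ q ∈ oddQuatFinset 0, φ q = φ 1 + φ (-1) := by
  classical
  have h : oddQuatFinset 0 = {1, -1} := by
    ext q
    rw [mem_oddQuatFinset, Finset.mem_insert, Finset.mem_singleton]
    constructor
    · rintro ⟨h, ha, -⟩
      rw [normSq_def', pow_zero] at h
      have ha0 : 1 ≤ q.re ^ 2 := by
        have : q.re ≠ 0 := by rintro h0; rw [h0] at ha; exact absurd ha (by decide)
        have := pow_pos (abs_pos.2 this) 2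
        rw [sq_abs] at this
        omega
      have hb := sq_nonneg q.imI
      have hc := sq_nonneg q.imJ
      have hd := sq_nonneg q.imK
      have hb0 : q.imI = 0 := pow_eq_zero_iff two_ne_zero |>.1 (by omega)
      have hc0 : q.imJ = 0 := pow_eq_zero_iff two_ne_zero |>.1 (by omega)
      have hd0 : q.imK = 0 := pow_eq_zero_iff two_ne_zero |>.1 (by omega)
      have ha1 : q.re ^ 2 = 1 := by omega
      rcases (sq_eq_one_iff).1 ha1 with h | h
      · left; ext <;> simp [*]
      · right; ext <;> simp [*]
    · rintro (rfl | rfl)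
      · refine ⟨by simp, ?_⟩
        simp
      · refine ⟨by simp, ?_⟩
        simp
  rw [h, Finset.sum_pair]
  intro h
  have : (1 : ℍ[ℤ]).re = (-1 : ℍ[ℤ]).re := by rw [← h]
  exact absurd this (by decide)

theorem sum_heckeGen_mul {M : Type*} [AddCommMonoid M] {φ : ℍ[ℤ] → M}
    (hφ : ∀ q, φ (5 * q) = φ q) (r : ℕ) :
    ∑ i, ∑ q ∈ oddQuatFinset (r + 1), φ (heckeGen i * q) =
      ∑ q ∈ oddQuatFinset (r + 2), φ q + 5 • ∑ q ∈ oddQuatFinset r, φ q := by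
  classical
  have hright : ∑ q ∈ oddQuatFinset r, φ q = ∑ w ∈ oddQuatFinset (r + 2) with 5 ∣ w, φ w := by
    refine Finset.sum_nbij (5 * ·) (fun q hq => ?_)
      (fun p _ q _ h => mul_left_cancel₀ five_quaternion_ne_zero h)
      (fun w hw => ?_) (fun q _ => (hφ q).symm)
    · rw [Finset.mem_filter]
      exact ⟨five_mul_mem_oddQuatFinset_iff.2 hq, q, rfl⟩
    · rw [Finset.mem_coe, Finset.mem_filter] at hw
      obtain ⟨hw, q, rfl⟩ := hw
      exact ⟨q, five_mul_mem_oddQuatFinset_iff.1 hw, rfl⟩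
  simp only [sum_heckeGen_mul_eq_sum_filter, hright, Finset.sum_filter]
  rw [Finset.sum_comm, ← Finset.sum_nsmul, ← Finset.sum_add_distrib]
  refine Finset.sum_congr rfl fun w hw => ?_
  rw [← Finset.sum_filter, Finset.sum_const, card_five_dvd_star_heckeGen_mul]
  · split_ifs
    · rw [← succ_nsmul']
    · simp
  · rw [(mem_oddQuatFinset.1 hw).1, pow_succ]
    exact Dvd.intro_left _ rfl

end HeckeQuaternion

end

section

open Quaternion

section HeckeOperator

/-- The sum of the six Hecke generators in the `(2m+1)`-dimensional representation. -/
noncomputable def sphHecke (m : ℕ) : Matrix (Fin (2 * m + 1)) (Fin (2 * m + 1)) ℂ :=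
  ∑ i, sphRep m (heckeGen i)

theorem isWeightedSelfAdjoint_sphHecke (m : ℕ) :
    IsWeightedSelfAdjoint (symWeight (2 * m)) (sphHecke m) := by
  intro i j
  choose σ hσ using exists_star_heckeGen_eq
  have hinj : Function.Injective heckeGen := by
    intro a b h
    have h1 := congrArg QuaternionAlgebra.imI h
    have h2 := congrArg QuaternionAlgebra.imJ h
    have h3 := congrArg QuaternionAlgebra.imK h
    clear h
    revert h1 h2 h3
    simp only [heckeGen]
    revert a b
    decide
  have hinv : Function.Involutive σ := fun a => by
    apply hinj
    rw [← hσ, ← hσ, star_star]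
  rw [sphHecke, Matrix.sum_apply, Matrix.sum_apply, ← Equiv.sum_comp hinv.toPerm, Finset.mul_sum,
    map_sum, Finset.mul_sum]
  refine Finset.sum_congr rfl fun a _ => ?_
  rw [Function.Involutive.coe_toPerm, ← hσ, sphRep_star_apply]

theorem sum_sphRep_mul_sphHecke (m : ℕ) (s : Finset ℍ[ℤ]) :
    (∑ q ∈ s, sphRep m q) * sphHecke m = ∑ i, ∑ q ∈ s, sphRep m (heckeGen i * q) := by
  rw [sphHecke, Finset.mul_sum]
  refine Finset.sum_congr rfl fun i _ => ?_
  rw [Finset.sum_mul]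
  exact Finset.sum_congr rfl fun q _ => (sphRep_mul m _ _).symm

theorem sum_sphRep_oddQuatFinset (m r : ℕ) :
    ∑ q ∈ oddQuatFinset r, sphRep m q = 2 * Polynomial.aeval (sphHecke m) (heckePoly r) := by
  have h5 (q : ℍ[ℤ]) : sphRep m (5 * q) = sphRep m q :=
    sphRep_natCast_mul m (n := 5) (by norm_num) q
  induction r using Nat.twoStepInduction with
  | zero =>
    rw [sum_oddQuatFinset_zero, sphRep_neg, sphRep_one, heckePoly_zero, map_one, mul_one,
      one_add_one_eq_two]
  | one =>
    rw [← sum_heckeGen_mul_zero, ← sum_sphRep_mul_sphHecke, sum_oddQuatFinset_zero, sphRep_neg,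
      sphRep_one, heckePoly_one, Polynomial.aeval_X, one_add_one_eq_two]
  | more r h0 h1 =>
    have := sum_heckeGen_mul h5 r
    rw [← sum_sphRep_mul_sphHecke, h0, h1] at this
    rw [eq_sub_of_add_eq this.symm, heckePoly_add_two, mul_comm Polynomial.X, map_sub, map_mul,
      map_mul, Polynomial.aeval_X, mul_sub, mul_assoc, nsmul_eq_mul]
    congr 1
    rw [show ((5 : Polynomial ℝ)) = ((5 : ℕ) : Polynomial ℝ) by norm_num, map_natCast,
      ← mul_assoc, ← mul_assoc, (Nat.cast_commute 5 (2 : Matrix _ _ ℂ)).eq]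

/-- The functional dual to the square of the Hecke operator. -/
noncomputable def heckeFunctional (L : ℕ) : (ℝ → ℝ) →ₗ[ℝ] ℝ :=
  ∑ j ∈ Finset.range (L + 1), ((5 : ℝ) ^ (L - j) / 2) •
    ∑ q ∈ oddQuatFinset (2 * j), LinearMap.proj ((q.re : ℝ) / 5 ^ j)

theorem heckeFunctional_apply (L : ℕ) (f : ℝ → ℝ) :
    heckeFunctional L f = ∑ j ∈ Finset.range (L + 1), (5 : ℝ) ^ (L - j) / 2 *
      ∑ q ∈ oddQuatFinset (2 * j), f ((q.re : ℝ) / 5 ^ j) := by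
  simp [heckeFunctional, LinearMap.sum_apply]

theorem trace_aeval_heckePoly_mul_self (m L : ℕ) :
    (Polynomial.aeval (sphHecke m) (heckePoly L) *
      Polynomial.aeval (sphHecke m) (heckePoly L)).trace = (heckeFunctional L (sphChar m) : ℝ) := by
  rw [← map_mul, ← sq, heckePoly_sq, map_sum, Matrix.trace_sum, heckeFunctional_apply]
  push_cast
  refine Finset.sum_congr rfl fun j _ => ?_
  have h : Polynomial.aeval (sphHecke m) (heckePoly (2 * j)) =
      (2⁻¹ : ℂ) • ∑ q ∈ oddQuatFinset (2 * j), sphRep m q := by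
    rw [sum_sphRep_oddQuatFinset, two_mul (Polynomial.aeval _ _), ← two_smul ℂ,
      smul_smul, inv_mul_cancel₀ two_ne_zero,
      one_smul]
  rw [map_mul, h, map_pow, Matrix.mul_smul, show ((5 : Polynomial ℝ)) = ((5 : ℕ) : Polynomial ℝ) by
    norm_num, map_natCast, ← Nat.cast_pow, ← nsmul_eq_mul, Matrix.trace_smul, Matrix.trace_smul,
    Matrix.trace_sum, nsmul_eq_mul, smul_eq_mul]
  push_cast
  rw [← mul_assoc, div_eq_mul_inv, mul_comm (2⁻¹ : ℂ)]
  congr 1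
  refine Finset.sum_congr rfl fun q hq => ?_
  have hn := (mem_oddQuatFinset.1 hq).1
  have hq0 : q ≠ 0 := by
    rintro rfl
    rw [map_zero] at hn
    exact pow_ne_zero _ (by norm_num) hn.symm
  rw [trace_sphRep m hq0, hn, mul_comm 2 j, pow_mul]
  push_cast
  rw [Real.sqrt_sq (by positivity)]

theorem sq_eval_heckePoly_le (L : ℕ) {m : ℕ} {v : Fin (2 * m + 1) → ℂ} (hv : v ≠ 0) {Λ : ℝ}
    (h : (sphHecke m).mulVec v = (Λ : ℂ) • v) :
    ((m : ℝ) + 1) ^ 2 * (heckePoly L).eval Λ ^ 2 ≤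
      heckeFunctional L fun c => sphChar m c ^ 4 := by
  have hpos (i : ℕ) : 0 ≤ heckeFunctional L (sphChar i) := by
    have h1 := trace_aeval_heckePoly_mul_self i L
    rw [((isWeightedSelfAdjoint_sphHecke i).aeval _).trace_mul_self (symWeight_pos _)] at h1
    rw [← Complex.ofReal_inj.1 h1]
    exact Finset.sum_nonneg fun a _ => Finset.sum_nonneg fun b _ =>
      mul_nonneg (div_nonneg (symWeight_pos _ _).le (symWeight_pos _ _).le) (sq_nonneg _)
  refine le_trans (mul_le_mul_of_nonneg_left ?_ (by positivity))
    (sphChar_pow_four_functional hpos m)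
  have := ((isWeightedSelfAdjoint_sphHecke m).aeval (heckePoly L)).sq_le_trace_mul_self
    (symWeight_pos _) hv (Matrix.aeval_mulVec_of_mulVec_eq_smul h _)
  rwa [trace_aeval_heckePoly_mul_self, Complex.ofReal_re] at this

end HeckeOperator

end

section LatticePoints

theorem mul_sq_det_eq_of_mem_circle {n x₁ y₁ x₂ y₂ x₃ y₃ : ℤ} (h₁ : x₁ ^ 2 + y₁ ^ 2 = n)
    (h₂ : x₂ ^ 2 + y₂ ^ 2 = n) (h₃ : x₃ ^ 2 + y₃ ^ 2 = n) :
    4 * n * ((x₂ - x₁) * (y₃ - y₁) - (x₃ - x₁) * (y₂ - y₁)) ^ 2 =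
      ((x₁ - x₂) ^ 2 + (y₁ - y₂) ^ 2) * ((x₂ - x₃) ^ 2 + (y₂ - y₃) ^ 2) *
        ((x₁ - x₃) ^ 2 + (y₁ - y₃) ^ 2) := by
  obtain ⟨g, hg⟩ : ∃ g, g = x₁ * x₂ + y₁ * y₂ - n := ⟨_, rfl⟩
  obtain ⟨u, hu⟩ : ∃ u, u = x₂ * x₃ + y₂ * y₃ - n := ⟨_, rfl⟩
  obtain ⟨v, hv⟩ : ∃ v, v = x₁ * x₃ + y₁ * y₃ - n := ⟨_, rfl⟩
  have key : -n * ((x₂ - x₁) * (y₃ - y₁) - (x₃ - x₁) * (y₂ - y₁)) ^ 2 =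
      (x₁ ^ 2 + y₁ ^ 2 - n) * (x₂ ^ 2 + y₂ ^ 2 - n) * (x₃ ^ 2 + y₃ ^ 2 - n) + 2 * g * u * v
        - (x₁ ^ 2 + y₁ ^ 2 - n) * u ^ 2 - (x₂ ^ 2 + y₂ ^ 2 - n) * v ^ 2
        - (x₃ ^ 2 + y₃ ^ 2 - n) * g ^ 2 := by
    rw [hg, hu, hv]; ring
  have e₁ : (x₁ - x₂) ^ 2 + (y₁ - y₂) ^ 2 = -2 * g := by rw [hg]; linear_combination h₁ + h₂
  have e₂ : (x₂ - x₃) ^ 2 + (y₂ - y₃) ^ 2 = -2 * u := by rw [hu]; linear_combination h₂ + h₃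
  have e₃ : (x₁ - x₃) ^ 2 + (y₁ - y₃) ^ 2 = -2 * v := by rw [hv]; linear_combination h₁ + h₃
  rw [e₁, e₂, e₃]
  rw [h₁, h₂, h₃] at key
  linear_combination -4 * key

theorem abs_sub_le_of_mem_circle {n x₁ y₁ x₂ y₂ : ℤ} (hn : 0 < n) (h₁ : x₁ ^ 2 + y₁ ^ 2 = n)
    (h₂ : x₂ ^ 2 + y₂ ^ 2 = n) (h₁' : |x₁| ≤ y₁) (h₂' : |x₂| ≤ y₂) : |y₁ - y₂| ≤ |x₁ - x₂| := by
  have hy₁ : 0 ≤ y₁ := (abs_nonneg _).trans h₁'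
  have hy₂ : 0 ≤ y₂ := (abs_nonneg _).trans h₂'
  have hpos : 0 < y₁ + y₂ := by
    by_contra! h
    have hy : y₁ = 0 := by omega
    rw [hy] at h₁ h₁'
    have : x₁ = 0 := abs_nonpos_iff.1 h₁'
    rw [this] at h₁
    omega
  have h : |y₁ - y₂| * (y₁ + y₂) = |x₁ - x₂| * |x₁ + x₂| := by
    rw [← abs_of_pos hpos, ← abs_mul, ← abs_mul, ← abs_neg]
    congr 1
    linear_combination h₂ - h₁
  refine le_of_mul_le_mul_right ?_ hpos
  rw [h]
  exact mul_le_mul_of_nonneg_left ((abs_add_le _ _).trans (add_le_add h₁' h₂')) (abs_nonneg _)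

theorem card_le_of_mem_circle_sector {n : ℤ} {t : ℕ} (hn : 0 < n) (ht : n ≤ t ^ 6)
    {S : Finset (ℤ × ℤ)} (hS : ∀ p ∈ S, p.1 ^ 2 + p.2 ^ 2 = n) (hS' : ∀ p ∈ S, |p.1| ≤ p.2) :
    S.card ≤ 10 * t ^ 2 := by
  have hex : ∃ k : ℕ, n ≤ 2 * (k : ℤ) ^ 6 :=
    ⟨t, by linarith [pow_nonneg (Nat.cast_nonneg (α := ℤ) t) 6]⟩
  set k := Nat.find hex with hkdef
  have hk : n ≤ 2 * (k : ℤ) ^ 6 := Nat.find_spec hex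
  have hkt : k ≤ t := Nat.find_min' hex (by linarith [pow_nonneg (Nat.cast_nonneg (α := ℤ) t) 6])
  have hk0 : 0 < k := by
    rw [Nat.pos_iff_ne_zero]
    intro h
    rw [h] at hk
    norm_num at hk
    omega
  have hk' : 2 * ((k : ℤ) - 1) ^ 6 < n := by
    have := Nat.find_min hex (m := k - 1) (by omega)
    rw [Nat.cast_sub hk0] at this
    push_cast at this
    linarith
  have hkZ : (0 : ℤ) < k := by exact_mod_cast hk0
  have hmaps : ∀ p ∈ S, p.1 / (k : ℤ) ∈ Finset.Icc (-(2 * k ^ 2 : ℤ)) (2 * k ^ 2) := by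
    intro p hp
    have h1 : p.1 ^ 2 ≤ (2 * (k : ℤ) ^ 3) ^ 2 := by
      have := hS p hp
      nlinarith [sq_nonneg p.2, pow_pos hkZ 6]
    have h2 := abs_le.1 (abs_le_of_sq_le_sq h1 (by positivity))
    rw [Finset.mem_Icc]
    constructor
    · rw [Int.le_ediv_iff_mul_le hkZ]; linarith
    · exact Int.le_of_lt_add_one ((Int.ediv_lt_iff_lt_mul hkZ).2 (by nlinarith))
  have hfib : ∀ b ∈ Finset.Icc (-(2 * k ^ 2 : ℤ)) (2 * k ^ 2),
      (S.filter fun p => p.1 / (k : ℤ) = b).card ≤ 2 := by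
    intro b _
    by_contra! h
    obtain ⟨p, hp, q, hq, r, hr, hpq, hpr, hqr⟩ := Finset.two_lt_card.1 h
    rw [Finset.mem_filter] at hp hq hr
    have hside {p q : ℤ × ℤ} (hp : p ∈ S ∧ p.1 / (k : ℤ) = b) (hq : q ∈ S ∧ q.1 / (k : ℤ) = b) :
        (p.1 - q.1) ^ 2 + (p.2 - q.2) ^ 2 ≤ 2 * ((k : ℤ) - 1) ^ 2 := by
      have h1 : |p.1 - q.1| ≤ (k : ℤ) - 1 := by
        have e1 := Int.emod_add_mul_ediv p.1 k
        have e2 := Int.emod_add_mul_ediv q.1 k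
        rw [hp.2] at e1
        rw [hq.2] at e2
        have := Int.emod_nonneg p.1 hkZ.ne'
        have := Int.emod_nonneg q.1 hkZ.ne'
        have := Int.emod_lt_of_pos p.1 hkZ
        have := Int.emod_lt_of_pos q.1 hkZ
        rw [abs_le]
        constructor <;> linarith
      have h2 := (abs_sub_le_of_mem_circle hn (hS p hp.1) (hS q hq.1) (hS' p hp.1)
        (hS' q hq.1)).trans h1
      have h3 := pow_le_pow_left₀ (abs_nonneg _) h1 2
      have h4 := pow_le_pow_left₀ (abs_nonneg _) h2 2
      rw [sq_abs] at h3 h4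
      linarith
    have hne {p q : ℤ × ℤ} (h : p ≠ q) : 0 < (p.1 - q.1) ^ 2 + (p.2 - q.2) ^ 2 := by
      by_contra! h0
      have a1 : p.1 - q.1 = 0 := pow_eq_zero_iff two_ne_zero |>.1
        (le_antisymm (by linarith [sq_nonneg (p.2 - q.2)]) (sq_nonneg _))
      have a2 : p.2 - q.2 = 0 := pow_eq_zero_iff two_ne_zero |>.1
        (le_antisymm (by linarith [sq_nonneg (p.1 - q.1)]) (sq_nonneg _))
      exact h (Prod.ext (sub_eq_zero.1 a1) (sub_eq_zero.1 a2))
    have hdet := mul_sq_det_eq_of_mem_circle (hS p hp.1) (hS q hq.1) (hS r hr.1)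
    set d := (q.1 - p.1) * (r.2 - p.2) - (r.1 - p.1) * (q.2 - p.2)
    have hprod : 0 < 4 * n * d ^ 2 := by
      rw [hdet]; exact mul_pos (mul_pos (hne hpq) (hne hqr)) (hne hpr)
    have hd : 1 ≤ d ^ 2 := by
      by_contra! h0
      have : d ^ 2 = 0 := le_antisymm (by linarith) (sq_nonneg _)
      rw [this] at hprod
      omega
    have hle : 4 * n * d ^ 2 ≤ (2 * ((k : ℤ) - 1) ^ 2) ^ 3 := by
      rw [hdet, pow_succ (2 * ((k : ℤ) - 1) ^ 2), sq (2 * ((k : ℤ) - 1) ^ 2)]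
      exact mul_le_mul (mul_le_mul (hside hp hq) (hside hq hr) (hne hqr).le (by positivity))
        (hside hp hr) (hne hpr).le (by positivity)
    have hge : 4 * n ≤ 4 * n * d ^ 2 := le_mul_of_one_le_right (by linarith) hd
    have : (2 * ((k : ℤ) - 1) ^ 2) ^ 3 = 8 * ((k : ℤ) - 1) ^ 6 := by ring
    linarith
  refine (Finset.card_le_mul_card_image_of_maps_to hmaps 2 hfib).trans ?_
  rw [Int.card_Icc]
  have h1 : (2 * (k : ℤ) ^ 2 + 1 - -(2 * k ^ 2)).toNat = 4 * k ^ 2 + 1 := by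
    rw [show 2 * (k : ℤ) ^ 2 + 1 - -(2 * k ^ 2) = ((4 * k ^ 2 + 1 : ℕ) : ℤ) by push_cast; ring,
      Int.toNat_natCast]
  rw [h1]
  have h2 : k ^ 2 ≤ t ^ 2 := Nat.pow_le_pow_left hkt 2
  have h3 : 1 ≤ k ^ 2 := Nat.one_le_pow _ _ hk0
  omega

theorem card_le_of_mem_circle {n : ℤ} {t : ℕ} (ht0 : t ≠ 0) (ht : n ≤ t ^ 6)
    {S : Finset (ℤ × ℤ)} (hS : ∀ p ∈ S, p.1 ^ 2 + p.2 ^ 2 = n) : S.card ≤ 40 * t ^ 2 := by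
  rcases le_or_gt n 0 with hn | hn
  · have : S ⊆ {(0, 0)} := by
      intro p hp
      have h := hS p hp
      rw [Finset.mem_singleton]
      refine Prod.ext (pow_eq_zero_iff two_ne_zero |>.1 ?_) (pow_eq_zero_iff two_ne_zero |>.1 ?_)
      · nlinarith [sq_nonneg p.1, sq_nonneg p.2]
      · nlinarith [sq_nonneg p.1, sq_nonneg p.2]
    have h1 := Finset.card_le_card this
    rw [Finset.card_singleton] at h1
    have : 1 ≤ t ^ 2 := Nat.one_le_pow _ _ (Nat.pos_of_ne_zero ht0)
    omega
  have hcard (e : ℤ × ℤ → ℤ × ℤ) (he : Function.Injective e)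
      (hen : ∀ p, (e p).1 ^ 2 + (e p).2 ^ 2 = p.1 ^ 2 + p.2 ^ 2) :
      (S.filter fun p => |(e p).1| ≤ (e p).2).card ≤ 10 * t ^ 2 := by
    rw [← Finset.card_map ⟨e, he⟩]
    refine card_le_of_mem_circle_sector hn ht (fun p hp => ?_) fun p hp => ?_
    all_goals
      obtain ⟨q, hq, rfl⟩ := Finset.mem_map.1 hp
      rw [Finset.mem_filter] at hq
    · exact (hen q).trans (hS q hq.1)
    · exact hq.2
  have h1 := hcard id Function.injective_id fun _ => rfl
  have h2 := hcard (fun p => (p.1, -p.2)) (fun p q h => by simpa [Prod.ext_iff] using h)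
    fun p => by ring
  have h3 := hcard (fun p => (p.2, p.1)) (fun p q h => by simpa [Prod.ext_iff, and_comm] using h)
    fun p => by ring
  have h4 := hcard (fun p => (p.2, -p.1)) (fun p q h => by simpa [Prod.ext_iff, and_comm] using h)
    fun p => by ring
  have hsub : S ⊆ ((S.filter fun p => |p.1| ≤ p.2) ∪ (S.filter fun p => |p.1| ≤ -p.2)) ∪
      ((S.filter fun p => |p.2| ≤ p.1) ∪ (S.filter fun p => |p.2| ≤ -p.1)) := by
    intro p hp
    simp only [Finset.mem_union, Finset.mem_filter, hp, true_and, abs_le]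
    omega
  have h5 := Finset.card_le_card hsub
  have h6 := Finset.card_union_le ((S.filter fun p => |p.1| ≤ p.2) ∪
    (S.filter fun p => |p.1| ≤ -p.2))
      ((S.filter fun p => |p.2| ≤ p.1) ∪ (S.filter fun p => |p.2| ≤ -p.1))
  have h7 := Finset.card_union_le (S.filter fun p => |p.1| ≤ p.2) (S.filter fun p => |p.1| ≤ -p.2)
  have h8 := Finset.card_union_le (S.filter fun p => |p.2| ≤ p.1) (S.filter fun p => |p.2| ≤ -p.1)
  simp only [id] at h1 h2 h3 h4
  omega

theorem card_le_of_mem_sphere {n : ℤ} {t : ℕ} (ht0 : t ≠ 0) (ht : n ≤ t ^ 6)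
    {S : Finset (ℤ × ℤ × ℤ)} (hS : ∀ p ∈ S, p.1 ^ 2 + p.2.1 ^ 2 + p.2.2 ^ 2 = n) :
    S.card ≤ 120 * t ^ 5 := by
  have hmaps : ∀ p ∈ S, p.1 ∈ Finset.Icc (-(t ^ 3 : ℤ)) (t ^ 3) := by
    intro p hp
    have h1 : p.1 ^ 2 ≤ ((t : ℤ) ^ 3) ^ 2 := by
      nlinarith [hS p hp, sq_nonneg p.2.1, sq_nonneg p.2.2]
    rw [Finset.mem_Icc, ← abs_le]
    exact abs_le_of_sq_le_sq h1 (by positivity)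
  have hfib : ∀ b ∈ Finset.Icc (-(t ^ 3 : ℤ)) (t ^ 3),
      (S.filter fun p => p.1 = b).card ≤ 40 * t ^ 2 := by
    intro b _
    rw [← Finset.card_image_of_injOn (f := fun p => p.2)]
    · refine card_le_of_mem_circle ht0 (n := n - b ^ 2) (by nlinarith) fun p hp => ?_
      obtain ⟨q, hq, rfl⟩ := Finset.mem_image.1 hp
      rw [Finset.mem_filter] at hq
      rw [← hS q hq.1, hq.2]
      ring
    · intro p hp q hq h
      rw [Finset.mem_coe, Finset.mem_filter] at hp hq
      exact Prod.ext (hp.2.trans hq.2.symm) h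
  refine (Finset.card_le_mul_card_image_of_maps_to hmaps _ hfib).trans ?_
  rw [Int.card_Icc]
  have h1 : ((t : ℤ) ^ 3 + 1 - -(t ^ 3)).toNat = 2 * t ^ 3 + 1 := by
    rw [show (t : ℤ) ^ 3 + 1 - -(t ^ 3) = ((2 * t ^ 3 + 1 : ℕ) : ℤ) by push_cast; ring,
      Int.toNat_natCast]
  rw [h1]
  have h3 : 1 ≤ t ^ 3 := Nat.one_le_pow _ _ (Nat.pos_of_ne_zero ht0)
  calc 40 * t ^ 2 * (2 * t ^ 3 + 1) ≤ 40 * t ^ 2 * (3 * t ^ 3) :=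
        Nat.mul_le_mul_left _ (by omega)
    _ = 120 * t ^ 5 := by ring

end LatticePoints

section

open Quaternion

section HeckeBound

theorem exists_nat_pow_six {s : ℤ} (hs : 0 < s) :
    ∃ t : ℕ, t ≠ 0 ∧ s ≤ t ^ 6 ∧ (t : ℝ) ^ 5 ≤ 32 * (s : ℝ) ^ (5 / 6 : ℝ) := by
  have hs1 : (1 : ℝ) ≤ s := by exact_mod_cast hs
  have hs0 : (0 : ℝ) ≤ s := by linarith
  have h1 : 1 ≤ (s : ℝ) ^ (1 / 6 : ℝ) := Real.one_le_rpow hs1 (by norm_num)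
  refine ⟨⌈(s : ℝ) ^ (1 / 6 : ℝ)⌉₊, (Nat.ceil_pos.2 (by linarith)).ne', ?_, ?_⟩
  · have h2 : ((s : ℝ) ^ (1 / 6 : ℝ)) ^ 6 = s := by
      rw [← Real.rpow_natCast, ← Real.rpow_mul hs0]; norm_num
    have h3 := pow_le_pow_left₀ (by positivity) (Nat.le_ceil ((s : ℝ) ^ (1 / 6 : ℝ))) 6
    rw [h2] at h3
    exact_mod_cast h3
  · have h2 : ((s : ℝ) ^ (1 / 6 : ℝ)) ^ 5 = (s : ℝ) ^ (5 / 6 : ℝ) := by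
      rw [← Real.rpow_natCast, ← Real.rpow_mul hs0]; norm_num
    have h3 := (Nat.ceil_lt_add_one (zero_le_one.trans h1)).le
    have h4 : (⌈(s : ℝ) ^ (1 / 6 : ℝ)⌉₊ : ℝ) ≤ 2 * (s : ℝ) ^ (1 / 6 : ℝ) := by linarith
    have h5 := pow_le_pow_left₀ (Nat.cast_nonneg _) h4 5
    rw [mul_pow, h2] at h5
    linarith

theorem card_filter_re_eq_le {j : ℕ} {a : ℤ} (ha : a ^ 2 < ((5 : ℤ) ^ j) ^ 2) :
    (((oddQuatFinset (2 * j)).filter fun q => q.re = a).card : ℝ) ≤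
      3840 * ((((5 : ℤ) ^ j) ^ 2 - a ^ 2 : ℤ) : ℝ) ^ (5 / 6 : ℝ) := by
  obtain ⟨t, ht0, ht, ht5⟩ := exists_nat_pow_six (sub_pos.2 ha)
  have h : ((oddQuatFinset (2 * j)).filter fun q => q.re = a).card ≤ 120 * t ^ 5 := by
    rw [← Finset.card_image_of_injOn (f := fun q : ℍ[ℤ] => (q.imI, q.imJ, q.imK))]
    · refine card_le_of_mem_sphere ht0 ht fun p hp => ?_
      obtain ⟨q, hq, rfl⟩ := Finset.mem_image.1 hp
      rw [Finset.mem_filter, mem_oddQuatFinset, normSq_def'] at hq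
      obtain ⟨⟨h, -⟩, rfl⟩ := hq
      rw [← pow_mul, mul_comm j, ← h]
      ring
    · intro p hp q hq h
      rw [Finset.mem_coe, Finset.mem_filter] at hp hq
      simp only [Prod.mk.injEq] at h
      exact QuaternionAlgebra.ext (hp.2.trans hq.2.symm) h.1 h.2.1 h.2.2
  calc (((oddQuatFinset (2 * j)).filter fun q => q.re = a).card : ℝ) ≤ 120 * (t : ℝ) ^ 5 := by
        exact_mod_cast h
    _ ≤ _ := by linarith

theorem abs_re_div_le {j : ℕ} {q : ℍ[ℤ]} (hq : q ∈ oddQuatFinset (2 * j)) :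
    |(q.re : ℝ) / 5 ^ j| ≤ 1 := by
  have h := (mem_oddQuatFinset.1 hq).1
  rw [normSq_def', mul_comm, pow_mul] at h
  have h1 : q.re ^ 2 ≤ ((5 : ℤ) ^ j) ^ 2 := by
    nlinarith [sq_nonneg q.imI, sq_nonneg q.imJ, sq_nonneg q.imK]
  have h2 := abs_le_of_sq_le_sq h1 (by positivity)
  rw [abs_div, abs_of_pos (by positivity : (0 : ℝ) < 5 ^ j), div_le_one (by positivity)]
  exact_mod_cast h2

theorem sphChar_pow_four_le {c : ℝ} (hc : |c| < 1) (m : ℤ) :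
    sphChar m c ^ 4 ≤ ((1 - c ^ 2) ^ 2)⁻¹ := by
  have h := sphChar_sq_mul_le hc.le m
  have h1 : 0 < 1 - c ^ 2 := by
    have := (sq_lt_one_iff_abs_lt_one c).2 hc
    linarith
  have h2 : sphChar m c ^ 2 ≤ (1 - c ^ 2)⁻¹ := by
    rwa [← one_div, le_div_iff₀ h1]
  calc sphChar m c ^ 4 = (sphChar m c ^ 2) ^ 2 := by ring
    _ ≤ ((1 - c ^ 2)⁻¹) ^ 2 := pow_le_pow_left₀ (sq_nonneg _) h2 2
    _ = _ := inv_pow _ 2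

theorem sum_filter_re_eq_le {j : ℕ} {a : ℤ} (ha : a ^ 2 < ((5 : ℤ) ^ j) ^ 2) (m : ℤ) :
    ∑ q ∈ oddQuatFinset (2 * j) with q.re = a, sphChar m ((q.re : ℝ) / 5 ^ j) ^ 4 ≤
      3840 * ((5 : ℝ) ^ (17 / 6 : ℝ)) ^ j *
        (|((5 ^ j - a : ℤ) : ℝ)| ^ (-(7 / 6) : ℝ) + |((5 ^ j + a : ℤ) : ℝ)| ^ (-(7 / 6) : ℝ)) := by
  obtain ⟨n, hn⟩ : ∃ n : ℝ, n = 5 ^ j := ⟨_, rfl⟩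
  have hn0 : 0 < n := by rw [hn]; positivity
  have haR : (a : ℝ) ^ 2 < n ^ 2 := by rw [hn]; exact_mod_cast ha
  have han : |(a : ℝ)| < n := abs_lt_of_sq_lt_sq haR hn0.le
  set s : ℝ := n ^ 2 - a ^ 2 with hs
  have hs0 : 0 < s := sub_pos.2 haR
  have hterm : ∀ q ∈ (oddQuatFinset (2 * j)).filter fun q => q.re = a,
      sphChar m ((q.re : ℝ) / 5 ^ j) ^ 4 ≤ n ^ 4 * s ^ (-2 : ℝ) := by
    intro q hq
    rw [(Finset.mem_filter.1 hq).2, ← hn]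
    refine (sphChar_pow_four_le ?_ m).trans_eq ?_
    · rwa [abs_div, abs_of_pos hn0, div_lt_one hn0]
    · rw [Real.rpow_neg hs0.le, Real.rpow_two, hs]
      field_simp
  refine (Finset.sum_le_card_nsmul _ _ _ hterm).trans ?_
  have hcard := card_filter_re_eq_le ha
  push_cast at hcard
  rw [← hn, ← hs] at hcard
  rw [nsmul_eq_mul]
  set b : ℝ := n - |(a : ℝ)| with hb
  have hb0 : 0 < b := sub_pos.2 han
  have hsb : n * b ≤ s := by
    rw [hs, hb, ← sq_abs (a : ℝ)]
    nlinarith [abs_nonneg (a : ℝ)]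
  have h1 : s ^ (5 / 6 : ℝ) * s ^ (-2 : ℝ) = s ^ (-(7 / 6) : ℝ) := by
    rw [← Real.rpow_add hs0]; norm_num
  have h2 : s ^ (-(7 / 6) : ℝ) ≤ n ^ (-(7 / 6) : ℝ) * b ^ (-(7 / 6) : ℝ) := by
    rw [← Real.mul_rpow hn0.le hb0.le]
    exact Real.rpow_le_rpow_of_nonpos (by positivity) hsb (by norm_num)
  have h3 : n ^ 4 * n ^ (-(7 / 6) : ℝ) = ((5 : ℝ) ^ (17 / 6 : ℝ)) ^ j := by
    rw [Real.rpow_pow_comm (by norm_num), ← hn, ← Real.rpow_natCast, ← Real.rpow_add hn0]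
    norm_num
  have h4 : b ^ (-(7 / 6) : ℝ) ≤ |((5 ^ j - a : ℤ) : ℝ)| ^ (-(7 / 6) : ℝ) +
      |((5 ^ j + a : ℤ) : ℝ)| ^ (-(7 / 6) : ℝ) := by
    push_cast
    rw [← hn]
    rcases abs_cases (a : ℝ) with ⟨h, -⟩ | ⟨h, -⟩
    · rw [hb, h, ← abs_of_pos (show 0 < n - a by rw [← h]; exact hb0)]
      rw [abs_abs]
      exact le_add_of_nonneg_right (by positivity)
    · rw [hb, h, sub_neg_eq_add, ← abs_of_pos (show 0 < n + a by linarith)]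
      rw [abs_abs]
      exact le_add_of_nonneg_left (by positivity)
  calc _ ≤ 3840 * s ^ (5 / 6 : ℝ) * (n ^ 4 * s ^ (-2 : ℝ)) :=
        mul_le_mul_of_nonneg_right hcard (by positivity)
    _ = 3840 * n ^ 4 * s ^ (-(7 / 6) : ℝ) := by rw [← h1]; ring
    _ ≤ 3840 * n ^ 4 * (n ^ (-(7 / 6) : ℝ) * b ^ (-(7 / 6) : ℝ)) :=
        mul_le_mul_of_nonneg_left h2 (by positivity)
    _ = 3840 * ((5 : ℝ) ^ (17 / 6 : ℝ)) ^ j * b ^ (-(7 / 6) : ℝ) := by rw [← h3]; ring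
    _ ≤ _ := mul_le_mul_of_nonneg_left h4 (by positivity)

theorem sum_oddQuatFinset_sphChar_le : ∃ C : ℝ, 0 < C ∧ ∀ m j : ℕ,
    ∑ q ∈ oddQuatFinset (2 * j), sphChar m ((q.re : ℝ) / 5 ^ j) ^ 4 ≤
      C * ((m : ℝ) + 1) ^ 4 + C * ((5 : ℝ) ^ (17 / 6 : ℝ)) ^ j := by
  classical
  have hsum : Summable fun k : ℤ => |(k : ℝ)| ^ (-(7 / 6) : ℝ) :=
    Real.summable_abs_int_rpow (by norm_num)
  set Z := ∑' k : ℤ, |(k : ℝ)| ^ (-(7 / 6) : ℝ) with hZ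
  have hZ0 : 0 ≤ Z := tsum_nonneg fun _ => by positivity
  refine ⟨32 + 7680 * Z, by positivity, fun m j => ?_⟩
  rw [← Finset.sum_filter_add_sum_filter_not _ (fun q : ℍ[ℤ] => q.re ^ 2 = (5 ^ j) ^ 2)]
  have hdef {q : ℍ[ℤ]} (hq : q ∈ oddQuatFinset (2 * j)) :
      q.re ^ 2 + q.imI ^ 2 + q.imJ ^ 2 + q.imK ^ 2 = (5 ^ j) ^ 2 := by
    rw [← normSq_def', (mem_oddQuatFinset.1 hq).1, mul_comm, pow_mul]
  have hm0 : (0 : ℝ) ≤ m := Nat.cast_nonneg m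
  refine add_le_add ?_ ?_
  · have hterm : ∀ q ∈ (oddQuatFinset (2 * j)).filter fun q : ℍ[ℤ] => q.re ^ 2 = (5 ^ j) ^ 2,
        sphChar m ((q.re : ℝ) / 5 ^ j) ^ 4 ≤ 16 * ((m : ℝ) + 1) ^ 4 := by
      intro q hq
      have h := abs_sphChar_le (abs_re_div_le (Finset.mem_filter.1 hq).1) m
      have h' := pow_le_pow_left₀ (abs_nonneg _) h 4
      rw [Even.pow_abs (by decide)] at h'
      refine h'.trans ((pow_le_pow_left₀ (by positivity)
        (show 2 * (m : ℝ) + 1 ≤ 2 * (m + 1) by linarith) 4).trans_eq ?_)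
      ring
    refine (Finset.sum_le_card_nsmul _ _ _ hterm).trans ?_
    have hcard : ((oddQuatFinset (2 * j)).filter
        fun q : ℍ[ℤ] => q.re ^ 2 = (5 ^ j) ^ 2).card ≤ 2 := by
      refine (Finset.card_le_card (t := {(⟨5 ^ j, 0, 0, 0⟩ : ℍ[ℤ]),
        (⟨-5 ^ j, 0, 0, 0⟩ : ℍ[ℤ])}) ?_).trans
        Finset.card_le_two
      intro q hq
      replace hq := Finset.mem_filter.1 hq
      have h := hdef hq.1
      have hI : q.imI = 0 := pow_eq_zero_iff two_ne_zero |>.1 (le_antisymm (by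
        nlinarith [sq_nonneg q.imJ, sq_nonneg q.imK]) (sq_nonneg _))
      have hJ : q.imJ = 0 := pow_eq_zero_iff two_ne_zero |>.1 (le_antisymm (by
        nlinarith [sq_nonneg q.imI, sq_nonneg q.imK]) (sq_nonneg _))
      have hK : q.imK = 0 := pow_eq_zero_iff two_ne_zero |>.1 (le_antisymm (by
        nlinarith [sq_nonneg q.imI, sq_nonneg q.imJ]) (sq_nonneg _))
      refine Finset.mem_insert.2 ?_
      rcases sq_eq_sq_iff_eq_or_eq_neg.1 hq.2 with h | h
      · exact Or.inl (QuaternionAlgebra.ext h hI hJ hK)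
      · exact Or.inr (Finset.mem_singleton.2 (QuaternionAlgebra.ext h hI hJ hK))
    rw [nsmul_eq_mul]
    calc _ ≤ (2 : ℝ) * (16 * ((m : ℝ) + 1) ^ 4) :=
          mul_le_mul_of_nonneg_right (by exact_mod_cast hcard) (by positivity)
      _ ≤ (32 + 7680 * Z) * ((m : ℝ) + 1) ^ 4 := by
          nlinarith [mul_nonneg hZ0 (pow_nonneg (by linarith : (0 : ℝ) ≤ m + 1) 4)]
  · have hmaps : ∀ q ∈ (oddQuatFinset (2 * j)).filter fun q : ℍ[ℤ] => ¬ q.re ^ 2 = (5 ^ j) ^ 2,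
        q.re ∈ Finset.Ioo (-(5 ^ j) : ℤ) (5 ^ j) := by
      intro q hq
      rw [Finset.mem_filter] at hq
      have h := hdef hq.1
      rw [Finset.mem_Ioo, ← abs_lt]
      refine abs_lt_of_sq_lt_sq (lt_of_le_of_ne ?_ hq.2) (by positivity)
      linarith [sq_nonneg q.imI, sq_nonneg q.imJ, sq_nonneg q.imK]
    rw [← Finset.sum_fiberwise_of_maps_to hmaps]
    have hfib : ∀ a ∈ Finset.Ioo (-(5 ^ j) : ℤ) (5 ^ j),
        ∑ q ∈ (oddQuatFinset (2 * j)).filter (fun q : ℍ[ℤ] => ¬ q.re ^ 2 = (5 ^ j) ^ 2)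
          with q.re = a, sphChar m ((q.re : ℝ) / 5 ^ j) ^ 4 ≤
        3840 * ((5 : ℝ) ^ (17 / 6 : ℝ)) ^ j *
        (|((5 ^ j - a : ℤ) : ℝ)| ^ (-(7 / 6) : ℝ) +
          |((5 ^ j + a : ℤ) : ℝ)| ^ (-(7 / 6) : ℝ)) := by
      intro a ha
      rw [Finset.mem_Ioo, ← abs_lt] at ha
      refine le_trans (Finset.sum_le_sum_of_subset_of_nonneg ?_ fun _ _ _ => by positivity)
        (sum_filter_re_eq_le (sq_lt_sq' (abs_lt.1 ha).1 (abs_lt.1 ha).2) m)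
      exact Finset.filter_subset_filter _ (Finset.filter_subset _ _)
    refine (Finset.sum_le_sum hfib).trans ?_
    rw [← Finset.mul_sum, Finset.sum_add_distrib]
    have hZ1 (e : ℤ → ℤ) (he : Function.Injective e) :
        ∑ a ∈ Finset.Ioo (-(5 ^ j) : ℤ) (5 ^ j), |((e a : ℤ) : ℝ)| ^ (-(7 / 6) : ℝ) ≤ Z := by
      have := Finset.sum_map (Finset.Ioo (-(5 ^ j) : ℤ) (5 ^ j)) ⟨e, he⟩
        fun k : ℤ => |(k : ℝ)| ^ (-(7 / 6) : ℝ)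
      exact this.symm.trans_le (hsum.sum_le_tsum _ fun _ _ => by positivity)
    have h1 := hZ1 (fun a => 5 ^ j - a) fun _ _ h => by simpa using h
    have h2 := hZ1 (fun a => 5 ^ j + a) fun _ _ h => by simpa using h
    have hx : (0 : ℝ) ≤ ((5 : ℝ) ^ (17 / 6 : ℝ)) ^ j := by positivity
    calc _ ≤ 3840 * ((5 : ℝ) ^ (17 / 6 : ℝ)) ^ j * (Z + Z) :=
          mul_le_mul_of_nonneg_left (add_le_add h1 h2) (by positivity)
      _ ≤ _ := by nlinarith

theorem exists_heckeFunctional_sphChar_le : ∃ C : ℝ, 0 < C ∧ ∀ m L : ℕ,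
    heckeFunctional L (fun c => sphChar m c ^ 4) ≤
      C * (5 ^ L * ((m : ℝ) + 1) ^ 4 + ((5 : ℝ) ^ (17 / 6 : ℝ)) ^ L) := by
  obtain ⟨C, hC, h⟩ := sum_oddQuatFinset_sphChar_le
  refine ⟨C, hC, fun m L => ?_⟩
  rw [heckeFunctional_apply]
  set x := (5 : ℝ) ^ (17 / 6 : ℝ) with hx
  have hx25 : 25 ≤ x := by
    calc (25 : ℝ) = 5 ^ (2 : ℝ) := by norm_num
      _ ≤ x := Real.rpow_le_rpow_of_exponent_le (by norm_num) (by norm_num)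
  have hgeom (y : ℝ) (hy : 25 ≤ y) : ∑ j ∈ Finset.range (L + 1), (5 : ℝ) ^ (L - j) * y ^ j ≤
      5 / 4 * y ^ L := by
    induction L with
    | zero => norm_num
    | succ L ih =>
      rw [Finset.sum_range_succ, Nat.sub_self, pow_zero, one_mul]
      have : ∑ j ∈ Finset.range (L + 1), (5 : ℝ) ^ (L + 1 - j) * y ^ j =
          5 * ∑ j ∈ Finset.range (L + 1), (5 : ℝ) ^ (L - j) * y ^ j := by
        rw [Finset.mul_sum]
        refine Finset.sum_congr rfl fun j hj => ?_
        rw [Nat.succ_sub (Nat.lt_succ_iff.1 (Finset.mem_range.1 hj)), pow_succ]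
        ring
      rw [this, pow_succ]
      nlinarith [pow_nonneg (by linarith : (0 : ℝ) ≤ y) L]
  have hgeom' : ∑ j ∈ Finset.range (L + 1), (5 : ℝ) ^ (L - j) ≤ 5 / 4 * 5 ^ L := by
    have := Finset.sum_range_reflect (fun j => (5 : ℝ) ^ j) (L + 1)
    simp only [Nat.add_sub_cancel] at this
    rw [this, geom_sum_eq (by norm_num), pow_succ]
    have : (0 : ℝ) < 5 ^ L := by positivity
    linarith
  have hM : (0 : ℝ) ≤ ((m : ℝ) + 1) ^ 4 := by positivity
  calc _ ≤ ∑ j ∈ Finset.range (L + 1), (5 : ℝ) ^ (L - j) / 2 *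
        (C * ((m : ℝ) + 1) ^ 4 + C * x ^ j) :=
        Finset.sum_le_sum fun j _ => mul_le_mul_of_nonneg_left (h m j) (by positivity)
    _ = C / 2 * ((m : ℝ) + 1) ^ 4 * ∑ j ∈ Finset.range (L + 1), (5 : ℝ) ^ (L - j) +
        C / 2 * ∑ j ∈ Finset.range (L + 1), (5 : ℝ) ^ (L - j) * x ^ j := by
        rw [Finset.mul_sum, Finset.mul_sum, ← Finset.sum_add_distrib]
        exact Finset.sum_congr rfl fun j _ => by ring
    _ ≤ C / 2 * ((m : ℝ) + 1) ^ 4 * (5 / 4 * 5 ^ L) + C / 2 * (5 / 4 * x ^ L) :=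
        add_le_add (mul_le_mul_of_nonneg_left hgeom' (by positivity))
          (mul_le_mul_of_nonneg_left (hgeom x hx25) (by positivity))
    _ ≤ _ := by
        have h1 : 0 ≤ C * ((m : ℝ) + 1) ^ 4 * 5 ^ L := by positivity
        have h2 : 0 ≤ C * x ^ L := by positivity
        nlinarith

end HeckeBound

end

section HeckeGap

theorem exists_pow_between {y z C : ℝ} (hy : 1 < y) (hz : 0 < z) (hzy : z < y) (hC : 0 < C) :
    ∃ M₀ : ℝ, ∀ M ≥ M₀, ∃ L : ℕ, C * M ^ 2 < y ^ L ∧ C * z ^ L < M ^ 2 := by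
  have hy0 : 0 < y := by linarith
  have hq : z / y < 1 := (div_lt_one hy0).2 hzy
  have hq0 : 0 < z / y := by positivity
  obtain ⟨K, hK⟩ := exists_pow_lt_of_lt_one (show 0 < 1 / (C ^ 2 * z) by positivity) hq
  refine ⟨max 1 (y ^ (K + 1) / C), fun M hM => ?_⟩
  have hM1 : 1 ≤ M := (le_max_left _ _).trans hM
  have hM2 : y ^ (K + 1) ≤ C * M ^ 2 := by
    have := (div_le_iff₀ hC).1 ((le_max_right _ _).trans hM)
    have h2 : M ≤ M ^ 2 := le_self_pow₀ hM1 two_ne_zero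
    nlinarith
  have hex := pow_unbounded_of_one_lt (C * M ^ 2) hy
  classical
  have hL := Nat.find_spec hex
  have hL' := fun m => @Nat.find_min _ _ hex m
  set L := Nat.find hex
  refine ⟨L, hL, ?_⟩
  have hKL : K + 1 < L := by
    by_contra! h
    exact absurd (hL.trans_le (pow_le_pow_right₀ hy.le h)) (not_lt.2 hM2)
  obtain ⟨N, hN⟩ : ∃ N, L = N + 1 := ⟨L - 1, by omega⟩
  have h1 : y ^ N ≤ C * M ^ 2 := not_lt.1 (hL' N (by omega))
  have h2 : (z / y) ^ N < 1 / (C ^ 2 * z) :=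
    (pow_le_pow_of_le_one hq0.le hq.le (by omega : K ≤ N)).trans_lt hK
  have hM0 : 0 < M ^ 2 := by positivity
  rw [hN, pow_succ]
  calc C * (z ^ N * z) = C * z * ((z / y) ^ N * y ^ N) := by
        rw [← mul_pow, div_mul_cancel₀ _ hy0.ne']; ring
    _ ≤ C * z * ((z / y) ^ N * (C * M ^ 2)) := by gcongr
    _ < C * z * (1 / (C ^ 2 * z) * (C * M ^ 2)) := by gcongr
    _ = M ^ 2 := by field_simp

theorem exists_sphHecke_eigenvalue_lt : ∃ m₀ : ℕ, ∃ r < (6 : ℝ), ∀ m ≥ m₀,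
    ∀ v : Fin (2 * m + 1) → ℂ, v ≠ 0 → ∀ Λ : ℝ, (sphHecke m).mulVec v = (Λ : ℂ) • v → Λ < r := by
  obtain ⟨C, hC, hbound⟩ := exists_heckeFunctional_sphChar_le
  have h5 : (1 : ℝ) < 5 := by norm_num
  set τ : ℝ := 5 ^ (49 / 50 : ℝ) with hτ
  have hτ1 : 1 < τ := Real.one_lt_rpow h5 (by norm_num)
  have hτ5 : τ < 5 := by
    calc τ < 5 ^ (1 : ℝ) := Real.rpow_lt_rpow_of_exponent_lt h5 (by norm_num)
      _ = 5 := Real.rpow_one 5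
  have hτ0 : 0 < τ := by linarith
  set y : ℝ := 5 ^ (24 / 25 : ℝ) with hy
  set z : ℝ := 5 ^ (131 / 150 : ℝ) with hz
  have hτy : τ ^ 2 = 5 * y := by
    rw [hτ, hy, ← Real.rpow_natCast, ← Real.rpow_mul (by norm_num)]
    nth_rewrite 2 [← Real.rpow_one 5]
    rw [← Real.rpow_add (by norm_num)]
    norm_num
  have hxz : (5 : ℝ) ^ (17 / 6 : ℝ) = 5 * y * z := by
    rw [hy, hz]
    nth_rewrite 2 [← Real.rpow_one 5]
    rw [← Real.rpow_add (by norm_num), ← Real.rpow_add (by norm_num)]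
    norm_num
  obtain ⟨M₀, hM₀⟩ := exists_pow_between (Real.one_lt_rpow h5 (by norm_num : (0 : ℝ) < 24 / 25))
    (Real.rpow_pos_of_pos (by norm_num) (131 / 150))
    (Real.rpow_lt_rpow_of_exponent_lt h5 (by norm_num : (131 / 150 : ℝ) < 24 / 25))
    (show 0 < 2 * C by positivity)
  refine ⟨⌈M₀⌉₊, τ + 5 / τ, ?_, fun m hm v hv Λ h => ?_⟩
  · have : 5 / τ < 6 - τ := by
      rw [div_lt_iff₀ hτ0]
      nlinarith
    linarith
  by_contra! hΛ
  obtain ⟨L, hL1, hL2⟩ := hM₀ ((m : ℝ) + 1) (by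
    have := (Nat.le_ceil M₀).trans (Nat.cast_le.2 hm)
    linarith)
  rw [← hy] at hL1
  rw [← hz] at hL2
  set M : ℝ := (m : ℝ) + 1
  have hM : 0 < M := by positivity
  have h1 := pow_le_pow_left₀ (by positivity) (pow_le_eval_heckePoly hτ0 hΛ L) 2
  have h2 := (sq_eval_heckePoly_le L hv h).trans (hbound m L)
  have h3 : M ^ 2 * (5 ^ L * y ^ L) ≤ C * (5 ^ L * M ^ 4 + 5 ^ L * y ^ L * z ^ L) := by
    rw [← pow_mul, mul_comm L, pow_mul, hτy, mul_pow] at h1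
    rw [hxz, mul_pow, mul_pow] at h2
    exact (mul_le_mul_of_nonneg_left h1 (by positivity)).trans h2
  have hyL : 0 < y ^ L := by positivity
  have h5L : (0 : ℝ) < 5 ^ L := by positivity
  have h4 : M ^ 2 * y ^ L ≤ C * M ^ 4 + C * (y ^ L * z ^ L) := by
    refine le_of_mul_le_mul_left ?_ h5L
    linarith
  have h5 : M ^ 2 * (2 * C * M ^ 2) < M ^ 2 * y ^ L := mul_lt_mul_of_pos_left hL1 (by positivity)
  have h6 : y ^ L * (2 * C * z ^ L) < y ^ L * M ^ 2 := mul_lt_mul_of_pos_left hL2 hyL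
  nlinarith

theorem exists_sphHecke_eigenvalue_le : ∃ r < (6 : ℝ), ∀ m : ℕ,
    ∀ v : Fin (2 * m + 1) → ℂ, v ≠ 0 → ∀ Λ : ℝ, (sphHecke m).mulVec v = (Λ : ℂ) • v → Λ < 6 →
      Λ ≤ r := by
  obtain ⟨m₀, r₀, hr₀, h⟩ := exists_sphHecke_eigenvalue_lt
  let E (m : ℕ) : Set ℝ := {Λ | Λ < 6 ∧ ∃ v : Fin (2 * m + 1) → ℂ, v ≠ 0 ∧
    (sphHecke m).mulVec v = (Λ : ℂ) • v}
  have hE (m : ℕ) : (E m).Finite := by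
    refine Set.Finite.subset (Set.Finite.preimage (Complex.ofReal_injective.injOn)
      (Module.End.finite_hasEigenvalue (Matrix.toLin' (sphHecke m)))) ?_
    rintro Λ ⟨-, v, hv, hΛ⟩
    exact Module.End.hasEigenvalue_of_hasEigenvector
      (Module.End.hasEigenvector_iff.2 ⟨Module.End.mem_eigenspace_iff.2 (by
        rwa [Matrix.toLin'_apply]), hv⟩)
  set S : Set ℝ := {r₀} ∪ ⋃ m ∈ Finset.range m₀, E m with hS
  have hSfin : S.Finite := (Set.finite_singleton _).union
    (Set.Finite.biUnion (Finset.finite_toSet _) fun m _ => hE m)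
  have hmem : sSup S ∈ S := Set.Nonempty.csSup_mem ⟨r₀, Or.inl rfl⟩ hSfin
  refine ⟨sSup S, ?_, fun m v hv Λ hΛ hΛ6 => ?_⟩
  · rcases hmem with h1 | h1
    · exact h1.trans_lt hr₀
    · obtain ⟨m, -, h2⟩ := Set.mem_iUnion₂.1 h1
      exact h2.1
  · rcases le_or_gt m₀ m with hm | hm
    · exact (h m hm v hv Λ hΛ).le.trans (le_csSup hSfin.bddAbove (Or.inl rfl))
    · exact le_csSup hSfin.bddAbove
        (Or.inr (Set.mem_biUnion (Finset.mem_range.2 hm) ⟨hΛ6, v, hv, hΛ⟩))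

end HeckeGap

section

open Quaternion
open MvPolynomial

section Homogeneous

variable {ι R : Type*} [CommRing R]

theorem homogeneousComponent_linSubst [Fintype ι] (M : Matrix ι ι R) (d : ℕ)
    (p : MvPolynomial ι R) :
    homogeneousComponent d (linSubst M p) = linSubst M (homogeneousComponent d p) := by
  conv_lhs => rw [← sum_homogeneousComponent p]
  rw [map_sum, map_sum]
  have h (i : ℕ) : homogeneousComponent d (linSubst M (homogeneousComponent i p)) =
      if d = i then linSubst M (homogeneousComponent i p) else 0 :=
    homogeneousComponent_of_mem ((homogeneousComponent_isHomogeneous i p).linSubst M)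
  simp only [h]
  rw [Finset.sum_ite_eq]
  split_ifs with hd
  · rfl
  · rw [Finset.mem_range, not_lt] at hd
    rw [homogeneousComponent_eq_zero _ _ (by omega), map_zero]

theorem totalDegree_homogeneousComponent_le (d : ℕ) (p : MvPolynomial ι R)
    (h : homogeneousComponent d p ≠ 0) : d ≤ p.totalDegree := by
  by_contra! hd
  exact h (homogeneousComponent_eq_zero _ _ hd)

end Homogeneous

section Cone

/-- The quadric `x² + y² + z²`. -/
noncomputable def quadric (R : Type*) [CommRing R] : MvPolynomial (Fin 3) R :=
  X 0 ^ 2 + X 1 ^ 2 + X 2 ^ 2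

theorem finSuccEquiv_quadric : finSuccEquiv ℂ 2 (quadric ℂ) =
    Polynomial.X ^ 2 + Polynomial.C (X 0 ^ 2 + X 1 ^ 2) := by
  have h1 : (1 : Fin 3) = Fin.succ 0 := rfl
  have h2 : (2 : Fin 3) = Fin.succ 1 := rfl
  rw [quadric, map_add, map_add, map_pow, map_pow, map_pow, finSuccEquiv_X_zero, h1, h2,
    finSuccEquiv_X_succ, finSuccEquiv_X_succ, add_assoc, Polynomial.C_add, Polynomial.C_pow,
    Polynomial.C_pow]

theorem quadric_dvd {F : MvPolynomial (Fin 3) ℂ}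
    (hF : ∀ w s t : ℂ, w ^ 2 + (s ^ 2 + t ^ 2) = 0 → eval ![w, s, t] F = 0) : quadric ℂ ∣ F := by
  set p : Polynomial (MvPolynomial (Fin 2) ℂ) :=
    Polynomial.X ^ 2 + Polynomial.C (X 0 ^ 2 + X 1 ^ 2) with hp
  have hpm : p.Monic := Polynomial.monic_X_pow_add_C _ two_ne_zero
  have hpd : p.natDegree = 2 := Polynomial.natDegree_X_pow_add_C
  set f := finSuccEquiv ℂ 2 F with hf
  have hdeg : (f %ₘ p).natDegree ≤ 1 := by
    have := Polynomial.natDegree_modByMonic_lt f hpm (by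
      intro h; rw [h, Polynomial.natDegree_one] at hpd; omega)
    omega
  obtain ⟨α, β, hαβ⟩ := Polynomial.exists_eq_X_add_C_of_natDegree_le_one hdeg
  have hroot (w s t : ℂ) (h : w ^ 2 + (s ^ 2 + t ^ 2) = 0) :
      eval ![s, t] α * w + eval ![s, t] β = 0 := by
    have h1 := hF w s t h
    have h2 := eval_eq_eval_mv_eval' (R := ℂ) ![s, t] w F
    have h3 : (Fin.cons w ![s, t] : Fin 3 → ℂ) = ![w, s, t] := rfl
    rw [h3, h1, ← hf, ← Polynomial.modByMonic_add_div f p, hαβ] at h2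
    have h4 : Polynomial.eval w (Polynomial.map (eval ![s, t]) p) = 0 := by
      rw [hp]
      simpa using h
    rw [Polynomial.map_add, Polynomial.map_mul, Polynomial.eval_add, Polynomial.eval_mul, h4,
      zero_mul, add_zero] at h2
    simpa using h2.symm
  have hboth (s t : ℂ) : eval ![s, t] (α * (X 0 ^ 2 + X 1 ^ 2)) = 0 ∧ eval ![s, t] β = 0 := by
    obtain ⟨w, hw⟩ := IsAlgClosed.exists_pow_nat_eq (-(s ^ 2 + t ^ 2)) (zero_lt_two)
    have h1 := hroot w s t (by rw [hw]; ring)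
    have h2 := hroot (-w) s t (by rw [neg_sq, hw]; ring)
    refine ⟨?_, by linear_combination (h1 + h2) / 2⟩
    simp only [map_mul, map_add, map_pow, eval_X, Matrix.cons_val_zero, Matrix.cons_val_one]
    have h3 : s ^ 2 + t ^ 2 = - w ^ 2 := by rw [hw]; ring
    rw [h3]
    linear_combination (- w / 2) * (h1 - h2)
  have hfun (x : Fin 2 → ℂ) : x = ![x 0, x 1] := by ext i; fin_cases i <;> rfl
  have hβ : β = 0 := MvPolynomial.funext fun x => by rw [hfun x, (hboth _ _).2, map_zero]
  have hα : α * (X 0 ^ 2 + X 1 ^ 2) = 0 :=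
    MvPolynomial.funext fun x => by rw [hfun x, (hboth _ _).1, map_zero]
  have hne : (X 0 ^ 2 + X 1 ^ 2 : MvPolynomial (Fin 2) ℂ) ≠ 0 := by
    intro h
    have := congrArg (eval ![1, 0]) h
    simp at this
  have hα0 : α = 0 := (mul_eq_zero.1 hα).resolve_right hne
  rw [hα0, hβ, map_zero, zero_mul, add_zero] at hαβ
  refine ⟨(finSuccEquiv ℂ 2).symm (f /ₘ p), (finSuccEquiv ℂ 2).injective ?_⟩
  rw [map_mul, finSuccEquiv_quadric, AlgEquiv.apply_symm_apply, ← hp, ← hf]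
  conv_lhs => rw [← Polynomial.modByMonic_add_div f p, hαβ, zero_add]

/-- The quadratic parametrization of the null cone of the quadric. -/
noncomputable def coneMap : Fin 3 → MvPolynomial (Fin 2) ℂ :=
  ![2 * C Complex.I * (X 0 * X 1), X 0 ^ 2 + X 1 ^ 2, -C Complex.I * (X 0 ^ 2 - X 1 ^ 2)]

/-- Pullback of polynomials along the parametrization of the null cone. -/
noncomputable def coneSubst : MvPolynomial (Fin 3) ℂ →ₐ[ℂ] MvPolynomial (Fin 2) ℂ := aeval coneMap

theorem isHomogeneous_coneMap (i : Fin 3) : (coneMap i).IsHomogeneous 2 := by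
  have h0 (i : Fin 2) : (X i : MvPolynomial (Fin 2) ℂ).IsHomogeneous 1 := isHomogeneous_X _ _
  have hI := isHomogeneous_C (Fin 2) Complex.I
  have h2 : (2 : MvPolynomial (Fin 2) ℂ).IsHomogeneous 0 := isHomogeneous_C (Fin 2) (2 : ℂ)
  fin_cases i
  · exact (h2.mul hI).mul ((h0 0).mul (h0 1))
  · exact ((h0 0).pow 2).add ((h0 1).pow 2)
  · exact hI.neg.mul (((h0 0).pow 2).sub ((h0 1).pow 2))

theorem MvPolynomial.IsHomogeneous.coneSubst {F : MvPolynomial (Fin 3) ℂ} {m : ℕ}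
    (hF : F.IsHomogeneous m) : (coneSubst F).IsHomogeneous (2 * m) :=
  hF.aeval coneMap isHomogeneous_coneMap

theorem quadric_dvd_of_coneSubst_eq_zero {F : MvPolynomial (Fin 3) ℂ} (hF : coneSubst F = 0) :
    quadric ℂ ∣ F := by
  refine quadric_dvd fun w s t h => ?_
  obtain ⟨a, ha⟩ := IsAlgClosed.exists_pow_nat_eq ((s + Complex.I * t) / 2) (zero_lt_two)
  obtain ⟨b, hb⟩ := IsAlgClosed.exists_pow_nat_eq ((s - Complex.I * t) / 2) (zero_lt_two)
  have hI : Complex.I ^ 2 = -1 := Complex.I_sq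
  have hw : (w - 2 * Complex.I * (a * b)) * (w + 2 * Complex.I * (a * b)) = 0 := by
    have : (w - 2 * Complex.I * (a * b)) * (w + 2 * Complex.I * (a * b)) =
      w ^ 2 - 4 * Complex.I ^ 2 * (a ^ 2 * b ^ 2) := by ring
    rw [this, ha, hb, hI]
    linear_combination h - t ^ 2 * hI
  have hval (c : ℂ) (hc : c ^ 2 = a ^ 2) (hcb : w = 2 * Complex.I * (c * b)) :
      eval ![w, s, t] F = 0 := by
    have h1 := congrArg (eval ![c, b]) hF
    have h2 : (eval ![c, b]).comp (coneSubst : MvPolynomial (Fin 3) ℂ →+* _) =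
        eval ![w, s, t] := by
      refine MvPolynomial.ringHom_ext (fun r => ?_) fun i => ?_
      · simp [coneSubst]
      · fin_cases i
        · simp [coneSubst, coneMap, hcb]
        · simp [coneSubst, coneMap, hc, ha, hb]
          ring
        · simp [coneSubst, coneMap, hc, ha, hb]
          linear_combination (-t) * hI
    rw [map_zero] at h1
    rw [← h2]
    exact h1
  rcases mul_eq_zero.1 hw with h | h
  · exact hval a rfl (by linear_combination h)
  · exact hval (-a) (by ring) (by linear_combination h)

end Cone

end

section

open Quaternion
open MvPolynomial

section ThreeVariables

/-- The matrix of the map `v ↦ q v q*` on purely imaginary quaternions. -/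
def quatConj (q : ℍ[ℤ]) : Matrix (Fin 3) (Fin 3) ℤ :=
  !![q.re ^ 2 + q.imI ^ 2 - q.imJ ^ 2 - q.imK ^ 2, 2 * (q.imI * q.imJ - q.re * q.imK),
      2 * (q.imI * q.imK + q.re * q.imJ);
    2 * (q.imI * q.imJ + q.re * q.imK), q.re ^ 2 - q.imI ^ 2 + q.imJ ^ 2 - q.imK ^ 2,
      2 * (q.imJ * q.imK - q.re * q.imI);
    2 * (q.imI * q.imK - q.re * q.imJ), 2 * (q.imJ * q.imK + q.re * q.imI),
      q.re ^ 2 - q.imI ^ 2 - q.imJ ^ 2 + q.imK ^ 2]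

theorem linSubst_coneSubst (q : ℍ[ℤ]) (F : MvPolynomial (Fin 3) ℂ) :
    linSubst (quatMat q) (coneSubst F) =
      coneSubst (linSubst ((quatConj q).map (Int.cast : ℤ → ℂ)) F) := by
  have h : (linSubst (quatMat q)).comp coneSubst =
      coneSubst.comp (linSubst ((quatConj q).map (Int.cast : ℤ → ℂ))) := by
    refine MvPolynomial.algHom_ext fun i => ?_
    have hI : (C Complex.I : MvPolynomial (Fin 2) ℂ) ^ 2 = -1 := by
      rw [← C_pow, Complex.I_sq, C_neg, C_1]
    have h2 (M : Matrix (Fin 2) (Fin 2) ℂ) : linSubst M 2 = 2 := map_ofNat _ 2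
    have h3 (v : Fin 3 → MvPolynomial (Fin 2) ℂ) : bind₁ v 2 = 2 := map_ofNat _ 2
    clear F
    fin_cases i
    · simp [coneSubst, coneMap, linSubst_X, Fin.sum_univ_succ, quatMat, quatConj, h2, h3,
        algebraMap_eq]
      grind
    · simp [coneSubst, coneMap, linSubst_X, Fin.sum_univ_succ, quatMat, quatConj, h3]
      grind
    · simp [coneSubst, coneMap, linSubst_X, Fin.sum_univ_succ, quatMat, quatConj, h3,
        algebraMap_eq]
      grind
  exact DFunLike.congr_fun h F

/-- The rotation matrix of the conjugation by a quaternion. -/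
noncomputable def quatRot (𝕜 : Type*) [Field 𝕜] (q : ℍ[ℤ]) : Matrix (Fin 3) (Fin 3) 𝕜 :=
  ((normSq q : ℤ) : 𝕜)⁻¹ • (quatConj q).map (Int.cast : ℤ → 𝕜)

theorem quatConj_transpose_mul (q : ℍ[ℤ]) :
    (quatConj q).transpose * quatConj q = (normSq q ^ 2) • (1 : Matrix (Fin 3) (Fin 3) ℤ) := by
  rw [normSq_def']
  ext i j
  fin_cases i <;> fin_cases j <;>
    simp [quatConj, Matrix.mul_apply, Fin.sum_univ_succ] <;> ring

theorem det_quatConj (q : ℍ[ℤ]) : (quatConj q).det = normSq q ^ 3 := by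
  rw [normSq_def', quatConj, Matrix.det_fin_three]
  simp
  ring

theorem quatRot_transpose_mul (𝕜 : Type*) [Field 𝕜] {q : ℍ[ℤ]}
    (hq : ((normSq q : ℤ) : 𝕜) ≠ 0) : (quatRot 𝕜 q).transpose * quatRot 𝕜 q = 1 := by
  have h := congrArg (fun M => M.map (Int.castRingHom 𝕜)) (quatConj_transpose_mul q)
  simp only [Matrix.map_mul, Matrix.transpose_map] at h
  rw [quatRot, Matrix.transpose_smul, Matrix.smul_mul, Matrix.mul_smul, smul_smul]
  rw [Int.coe_castRingHom] at h
  rw [h]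
  ext i j
  rw [Matrix.smul_apply, Matrix.map_apply, Matrix.smul_apply, Matrix.one_apply, Matrix.one_apply]
  split_ifs
  · simp only [smul_eq_mul, mul_one, Int.cast_pow]
    field_simp
  · simp

theorem det_quatRot (𝕜 : Type*) [Field 𝕜] {q : ℍ[ℤ]}
    (hq : ((normSq q : ℤ) : 𝕜) ≠ 0) : (quatRot 𝕜 q).det = 1 := by
  have h : ((quatConj q).map (Int.cast : ℤ → 𝕜)).det = ((quatConj q).det : ℤ) :=
    ((Int.castRingHom 𝕜).map_det _).symm
  rw [quatRot, Matrix.det_smul, h, det_quatConj, Fintype.card_fin, Int.cast_pow, ← mul_pow,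
    inv_mul_cancel₀ hq, one_pow]

theorem map_quatRot (q : ℍ[ℤ]) : (quatRot ℝ q).map Complex.ofRealHom = quatRot ℂ q := by
  ext i j
  simp [quatRot]

theorem linSubst_quadric {R : Type*} [CommRing R] {M : Matrix (Fin 3) (Fin 3) R}
    (hM : M.transpose * M = 1) : linSubst M (quadric R) = quadric R := by
  have h (i j : Fin 3) := congrArg (fun N => (C (N i j) : MvPolynomial (Fin 3) R)) hM
  have h00 := h 0 0
  have h01 := h 0 1
  have h02 := h 0 2
  have h11 := h 1 1
  have h12 := h 1 2
  have h22 := h 2 2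
  clear h
  simp [Matrix.mul_apply, Fin.sum_univ_succ] at h00 h01 h02 h11 h12 h22
  simp [quadric, linSubst_X, Fin.sum_univ_succ]
  linear_combination X 0 ^ 2 * h00 + 2 * X 0 * X 1 * h01 + 2 * X 0 * X 2 * h02 + X 1 ^ 2 * h11 +
    2 * X 1 * X 2 * h12 + X 2 ^ 2 * h22

theorem sphRep_mulVec_coneSubst {m : ℕ} {F : MvPolynomial (Fin 3) ℂ} (hF : F.IsHomogeneous m)
    (q : ℍ[ℤ]) : (sphRep m q).mulVec (fun i => coeff (symExp (2 * m) i) (coneSubst F)) =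
      fun i => coeff (symExp (2 * m) i) (coneSubst (linSubst (quatRot ℂ q) F)) := by
  rw [sphRep, Matrix.smul_mulVec, symPow_mulVec _ hF.coneSubst, linSubst_coneSubst, quatRot,
    linSubst_smul_apply hF, map_smul]
  ext i
  simp

theorem exists_sum_linSubst_quatRot_eigenvalue_le : ∃ r < (6 : ℝ),
    ∀ F : MvPolynomial (Fin 3) ℝ, F ≠ 0 → ∀ Λ : ℝ,
      ∑ i, linSubst (quatRot ℝ (heckeGen i)) F = Λ • F → Λ < 6 → Λ ≤ r := by
  obtain ⟨r, hr, hgap⟩ := exists_sphHecke_eigenvalue_le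
  refine ⟨r, hr, fun F₀ hF₀ Λ hΛF₀ hΛ => ?_⟩
  by_contra hrΛ
  have key (n : ℕ) : ∀ F : MvPolynomial (Fin 3) ℂ, F.totalDegree = n → F ≠ 0 →
      ∑ i, linSubst (quatRot ℂ (heckeGen i)) F = (Λ : ℂ) • F → False := by
    induction n using Nat.strong_induction_on with
    | _ n ih =>
    intro F hn hF hFΛ
    obtain ⟨d, hd⟩ : ∃ d, homogeneousComponent d F ≠ 0 := by
      by_contra! h
      exact hF (by rw [← sum_homogeneousComponent F, Finset.sum_eq_zero fun i _ => h i])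
    have hdn := totalDegree_homogeneousComponent_le d F hd
    set G := homogeneousComponent d F with hG
    have hGh : G.IsHomogeneous d := homogeneousComponent_isHomogeneous d F
    have hGΛ : ∑ i, linSubst (quatRot ℂ (heckeGen i)) G = (Λ : ℂ) • G := by
      have := congrArg (homogeneousComponent d) hFΛ
      rw [map_sum, map_smul] at this
      simpa only [homogeneousComponent_linSubst] using this
    by_cases hc : coneSubst G = 0
    · obtain ⟨K, hK⟩ := quadric_dvd_of_coneSubst_eq_zero hc
      have hQ : quadric ℂ ≠ 0 := by
        rintro h
        rw [h, zero_mul] at hK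
        exact hd hK
      have hK0 : K ≠ 0 := by
        rintro rfl
        rw [mul_zero] at hK
        exact hd hK
      have hQd : (quadric ℂ).totalDegree = 2 := by
        refine IsHomogeneous.totalDegree ?_ hQ
        exact (((isHomogeneous_X _ _).pow 2).add ((isHomogeneous_X _ _).pow 2)).add
          ((isHomogeneous_X _ _).pow 2)
      have hdeg : G.totalDegree = 2 + K.totalDegree := by
        rw [hK, totalDegree_mul_of_isDomain hQ hK0, hQd]
      have hGd : G.totalDegree = d := hGh.totalDegree hd
      refine ih K.totalDegree (by omega) K rfl hK0 (mul_left_cancel₀ hQ ?_)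
      rw [Finset.mul_sum, mul_smul_comm, ← hK, ← hGΛ]
      refine Finset.sum_congr rfl fun i _ => ?_
      rw [hK, map_mul, linSubst_quadric (quatRot_transpose_mul ℂ (by simp [normSq_heckeGen]))]
    · refine hrΛ (hgap d (fun i => coeff (symExp (2 * d) i) (coneSubst G)) ?_ Λ ?_ hΛ)
      · intro h
        refine hc ?_
        rw [← hGh.coneSubst.sum_symExp]
        exact Finset.sum_eq_zero fun i _ => by rw [congrFun h i, Pi.zero_apply, monomial_zero]
      · have hsum : (sphHecke d).mulVec (fun i => coeff (symExp (2 * d) i) (coneSubst G)) =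
            ∑ i, (sphRep d (heckeGen i)).mulVec
              (fun i => coeff (symExp (2 * d) i) (coneSubst G)) := by
          rw [sphHecke, Matrix.sum_mulVec]
        rw [hsum]
        simp only [sphRep_mulVec_coneSubst hGh]
        ext j
        rw [Finset.sum_apply, ← coeff_sum, ← map_sum, hGΛ, map_smul, coeff_smul, Pi.smul_apply]
  refine key _ (map Complex.ofRealHom F₀) rfl ?_ ?_
  · rwa [Ne, map_eq_zero_iff _ (map_injective _ Complex.ofRealHom.injective)]
  · have := congrArg (map Complex.ofRealHom) hΛF₀
    simp only [map_sum, map_linSubst, map_quatRot] at this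
    rw [this, smul_eq_C_mul, smul_eq_C_mul, map_mul, map_C]
    rfl

end ThreeVariables

end

namespace rotationGroup

variable {n : ℕ}

/-- The rotation of `ℝⁿ` given by a special orthogonal matrix. -/
def ofMatrix (M : Matrix.specialOrthogonalGroup (Fin n) ℝ) : rotationGroup n :=
  ⟨Unitary.linearIsometryEquiv ⟨Matrix.toEuclideanCLM (𝕜 := ℝ) (n := Fin n) M,
    Unitary.map_mem (Matrix.toEuclideanCLM (𝕜 := ℝ) (n := Fin n))
      (Matrix.mem_specialOrthogonalGroup_iff.1 M.2).1⟩, by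
    have h := (Matrix.mem_specialOrthogonalGroup_iff.1 M.2).2
    rw [mem_rotationGroup, IsRotation]
    have : LinearMap.det (Matrix.toLpLin 2 2 (M : Matrix (Fin n) (Fin n) ℝ)) = 1 := by
      rw [Matrix.toLpLin_eq_toLin, LinearMap.det_toLin, h]
    exact this⟩

theorem ofMatrix_apply (M : Matrix.specialOrthogonalGroup (Fin n) ℝ) (x : EucSp n) (i : Fin n) :
    (ofMatrix M : EucSp n ≃ₗᵢ[ℝ] EucSp n) x i = (M : Matrix (Fin n) (Fin n) ℝ).mulVec x i := rfl

theorem ofMatrix_mul (M N : Matrix.specialOrthogonalGroup (Fin n) ℝ) :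
    ofMatrix (M * N) = ofMatrix M * ofMatrix N := by
  refine Subtype.ext (LinearIsometryEquiv.ext fun x => ?_)
  ext i
  rw [ofMatrix_apply]
  change _ = (ofMatrix M : EucSp n ≃ₗᵢ[ℝ] EucSp n) ((ofMatrix N : EucSp n ≃ₗᵢ[ℝ] EucSp n) x) i
  rw [ofMatrix_apply]
  change _ = ((M : Matrix (Fin n) (Fin n) ℝ).mulVec ((N : Matrix (Fin n) (Fin n) ℝ).mulVec x)) i
  rw [Matrix.mulVec_mulVec]
  rfl

/-- The matrix acting on three coordinates, selected by `e`, through a `3 × 3` matrix. -/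
def blockMatrix (e : Fin n ≃ Fin 3 ⊕ Fin (n - 3)) (M : Matrix (Fin 3) (Fin 3) ℝ) :
    Matrix (Fin n) (Fin n) ℝ :=
  (Matrix.fromBlocks M 0 0 1).submatrix e e

theorem blockMatrix_mul (e : Fin n ≃ Fin 3 ⊕ Fin (n - 3)) (M N : Matrix (Fin 3) (Fin 3) ℝ) :
    blockMatrix e (M * N) = blockMatrix e M * blockMatrix e N := by
  rw [blockMatrix, blockMatrix, blockMatrix, Matrix.submatrix_mul_equiv, Matrix.fromBlocks_multiply]
  simp

theorem blockMatrix_mem (e : Fin n ≃ Fin 3 ⊕ Fin (n - 3)) {M : Matrix (Fin 3) (Fin 3) ℝ}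
    (hM : M ∈ Matrix.specialOrthogonalGroup (Fin 3) ℝ) :
    blockMatrix e M ∈ Matrix.specialOrthogonalGroup (Fin n) ℝ := by
  rw [Matrix.mem_specialOrthogonalGroup_iff, Matrix.mem_orthogonalGroup_iff] at hM ⊢
  constructor
  · rw [blockMatrix, Matrix.transpose_submatrix, Matrix.fromBlocks_transpose,
      Matrix.submatrix_mul_equiv, Matrix.fromBlocks_multiply]
    simp [hM.1]
  · rw [blockMatrix, Matrix.det_submatrix_equiv_self, Matrix.det_fromBlocks_zero₂₁, hM.2,
      Matrix.det_one, one_mul]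

/-- The rotation acting on three coordinates, selected by `e`. -/
def block (e : Fin n ≃ Fin 3 ⊕ Fin (n - 3)) (M : Matrix.specialOrthogonalGroup (Fin 3) ℝ) :
    rotationGroup n :=
  ofMatrix ⟨blockMatrix e M, blockMatrix_mem e M.2⟩

theorem block_mul (e : Fin n ≃ Fin 3 ⊕ Fin (n - 3))
    (M N : Matrix.specialOrthogonalGroup (Fin 3) ℝ) :
    block e (M * N) = block e M * block e N := by
  rw [block, block, block, ← ofMatrix_mul]
  congr 1
  exact Subtype.ext (blockMatrix_mul e M N)

theorem block_one (e : Fin n ≃ Fin 3 ⊕ Fin (n - 3)) : block e 1 = 1 := by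
  rw [← mul_eq_left (a := block e 1), ← block_mul, mul_one]

theorem block_apply (e : Fin n ≃ Fin 3 ⊕ Fin (n - 3)) (M : Matrix.specialOrthogonalGroup (Fin 3) ℝ)
    (x : EucSp n) (i : Fin n) :
    (block e M : EucSp n ≃ₗᵢ[ℝ] EucSp n) x i =
      (e i).elim (fun a => ∑ b, (M : Matrix (Fin 3) (Fin 3) ℝ) a b * x (e.symm (Sum.inl b)))
        (fun _ => x i) := by
  rw [block, ofMatrix_apply]
  simp only [Matrix.mulVec, dotProduct, blockMatrix, Matrix.submatrix_apply]
  rw [← e.symm.sum_comp, Fintype.sum_sum_type]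
  simp only [Equiv.apply_symm_apply]
  rcases h : e i with a | b
  · simp
  · have : i = e.symm (Sum.inr b) := by rw [← h, Equiv.symm_apply_apply]
    simp [Matrix.one_apply, this]

/-- The rotation by the angle `θ` in the plane of the first two of three coordinates. -/
def planeRot (θ : ℝ) : Matrix.specialOrthogonalGroup (Fin 3) ℝ :=
  ⟨!![Real.cos θ, -Real.sin θ, 0; Real.sin θ, Real.cos θ, 0; 0, 0, 1], by
    rw [Matrix.mem_specialOrthogonalGroup_iff, Matrix.mem_orthogonalGroup_iff]
    constructor
    · ext i j
      fin_cases i <;> fin_cases j <;>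
        simp [Matrix.mul_apply, Fin.sum_univ_succ, ← sq] <;> ring
    · rw [Matrix.det_fin_three]
      simp [← sq]⟩

theorem planeRot_add (θ η : ℝ) : planeRot (θ + η) = planeRot θ * planeRot η := by
  refine Subtype.ext ?_
  change _ = (planeRot θ : Matrix (Fin 3) (Fin 3) ℝ) * (planeRot η : Matrix (Fin 3) (Fin 3) ℝ)
  ext i j
  fin_cases i <;> fin_cases j <;>
    simp [planeRot, Matrix.mul_apply, Fin.sum_univ_succ, Real.cos_add, Real.sin_add] <;> ring

theorem planeRot_zero : planeRot 0 = 1 := by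
  refine Subtype.ext ?_
  change _ = (1 : Matrix (Fin 3) (Fin 3) ℝ)
  ext i j
  fin_cases i <;> fin_cases j <;> simp [planeRot]

theorem planeRot_two_pi : planeRot (2 * Real.pi) = 1 := by
  rw [← planeRot_zero]
  refine Subtype.ext ?_
  simp [planeRot]

end rotationGroup

namespace rotationGroup

variable {n : ℕ}

theorem exists_equiv_apply_eq (hn : 3 ≤ n) {i k : Fin n} (hik : i ≠ k) :
    ∃ e : Fin n ≃ Fin 3 ⊕ Fin (n - 3), e i = Sum.inl 0 ∧ e k = Sum.inl 1 := by
  let e₀ : Fin n ≃ Fin 3 ⊕ Fin (n - 3) := (finCongr (by omega)).trans finSumFinEquiv.symm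
  let e₁ := e₀.trans (Equiv.swap (e₀ i) (Sum.inl 0))
  have h₁ : e₁ i = Sum.inl 0 := Equiv.swap_apply_left _ _
  refine ⟨e₁.trans (Equiv.swap (e₁ k) (Sum.inl 1)), ?_, Equiv.swap_apply_left _ _⟩
  rw [Equiv.trans_apply, h₁]
  refine Equiv.swap_apply_of_ne_of_ne ?_ (by simp)
  rw [← h₁]
  exact fun h => hik (e₁.injective h)

theorem exists_block_planeRot_apply_eq_zero (hn : 3 ≤ n) {i k : Fin n} (hik : i ≠ k)
    (x : EucSp n) : ∃ (e : Fin n ≃ Fin 3 ⊕ Fin (n - 3)) (θ : ℝ),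
      (block e (planeRot θ) : EucSp n ≃ₗᵢ[ℝ] EucSp n) x i = 0 ∧
      0 ≤ (block e (planeRot θ) : EucSp n ≃ₗᵢ[ℝ] EucSp n) x k ∧
      ∀ (y : EucSp n) (j : Fin n), j ≠ i → j ≠ k →
        (block e (planeRot θ) : EucSp n ≃ₗᵢ[ℝ] EucSp n) y j = y j := by
  obtain ⟨e, hi, hk⟩ := exists_equiv_apply_eq hn hik
  have hi' : e.symm (Sum.inl 0) = i := by rw [← hi, Equiv.symm_apply_apply]
  have hk' : e.symm (Sum.inl 1) = k := by rw [← hk, Equiv.symm_apply_apply]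
  set z : ℂ := ⟨x k, x i⟩
  have hc : ‖z‖ * Real.cos z.arg = x k := Complex.norm_mul_cos_arg z
  have hs : ‖z‖ * Real.sin z.arg = x i := Complex.norm_mul_sin_arg z
  clear_value z
  refine ⟨e, z.arg, ?_, ?_, fun y j hji hjk => ?_⟩
  · rw [block_apply, hi]
    simp only [Sum.elim_inl, Fin.sum_univ_succ, planeRot]
    simp [hi', hk']
    linear_combination (-Real.cos z.arg) * hs + Real.sin z.arg * hc
  · rw [block_apply, hk]
    simp only [Sum.elim_inl, Fin.sum_univ_succ, planeRot]
    simp [hi', hk']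
    rw [← hc, ← hs]
    have := norm_nonneg z
    nlinarith [mul_nonneg this (sq_nonneg (Real.sin z.arg)),
      mul_nonneg this (sq_nonneg (Real.cos z.arg))]
  · rw [block_apply]
    rcases h : e j with a | b
    · fin_cases a
      · exact absurd (e.injective (h.trans hi.symm)) hji
      · exact absurd (e.injective (h.trans hk.symm)) hjk
      · have h2 : e.symm (Sum.inl 2) = j := by rw [← e.symm_apply_apply j, h]; rfl
        simp [Fin.sum_univ_succ, planeRot, h2]
    · rfl

section Length

variable (hn : 3 ≤ n) {D : rotationGroup n → ℝ} {δ : ℝ} (hD1 : D 1 ≤ 0)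
  (hmul : ∀ a b, D (a * b) ≤ D a + D b) (hinv : ∀ a, D a⁻¹ = D a) (hδ0 : 0 ≤ δ)
  (hδ : ∀ e θ, D (block e (planeRot θ)) ≤ δ)

include hn hD1 hmul hδ in
theorem exists_forall_apply_eq_zero (x : EucSp n) (k : Fin n) (s : Finset (Fin n)) (hk : k ∉ s) :
    ∃ g : rotationGroup n, D g ≤ s.card * δ ∧
      (∀ i ∈ s, (g : EucSp n ≃ₗᵢ[ℝ] EucSp n) x i = 0) ∧
      (s.Nonempty → 0 ≤ (g : EucSp n ≃ₗᵢ[ℝ] EucSp n) x k) ∧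
      ∀ (y : EucSp n) (j : Fin n), j ∉ s → j ≠ k →
        (g : EucSp n ≃ₗᵢ[ℝ] EucSp n) y j = y j := by
  induction s using Finset.induction_on with
  | empty => exact ⟨1, by simpa using hD1, by simp, by simp, fun y j _ _ => rfl⟩
  | insert i s his ih =>
    rw [Finset.mem_insert, not_or] at hk
    obtain ⟨g, hg, hg0, -, hgy⟩ := ih hk.2
    obtain ⟨e, θ, hi, hk0, hy⟩ := exists_block_planeRot_apply_eq_zero hn (Ne.symm hk.1)
      ((g : EucSp n ≃ₗᵢ[ℝ] EucSp n) x)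
    refine ⟨block e (planeRot θ) * g, ?_, ?_, fun _ => hk0, ?_⟩
    · rw [Finset.card_insert_of_notMem his]
      push_cast
      linarith [hmul (block e (planeRot θ)) g, hδ e θ]
    · intro j hj
      rcases Finset.mem_insert.1 hj with rfl | hj
      · exact hi
      · exact (hy _ _ (fun h => his (h ▸ hj)) (fun h => hk.2 (h ▸ hj))).trans (hg0 j hj)
    · intro y j hj hjk
      rw [Finset.mem_insert, not_or] at hj
      exact (hy _ _ hj.1 hjk).trans (hgy y j hj.2 hjk)

theorem eq_one_of_forall_single {γ : rotationGroup n}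
    (h : ∀ j, (γ : EucSp n ≃ₗᵢ[ℝ] EucSp n) (EuclideanSpace.single j 1) =
      EuclideanSpace.single j 1) : γ = 1 := by
  refine Subtype.ext (LinearIsometryEquiv.toLinearEquiv_injective
    (LinearEquiv.toLinearMap_injective ?_))
  refine (EuclideanSpace.basisFun (Fin n) ℝ).toBasis.ext fun j => ?_
  simpa using h j

theorem apply_single_apply_eq_zero {γ : rotationGroup n} {j k : Fin n} (hjk : j ≠ k)
    (h : (γ : EucSp n ≃ₗᵢ[ℝ] EucSp n) (EuclideanSpace.single j 1) = EuclideanSpace.single j 1) :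
    (γ : EucSp n ≃ₗᵢ[ℝ] EucSp n) (EuclideanSpace.single k 1) j = 0 := by
  have := (γ : EucSp n ≃ₗᵢ[ℝ] EucSp n).inner_map_map (EuclideanSpace.single j 1)
    (EuclideanSpace.single k 1)
  rw [h] at this
  simpa [EuclideanSpace.inner_single_left, hjk] using this

theorem eq_one_of_forall_single_ne {γ : rotationGroup n} {k : Fin n}
    (h : ∀ j, j ≠ k → (γ : EucSp n ≃ₗᵢ[ℝ] EucSp n) (EuclideanSpace.single j 1) =
      EuclideanSpace.single j 1) : γ = 1 := by
  set c := (γ : EucSp n ≃ₗᵢ[ℝ] EucSp n) (EuclideanSpace.single k 1) k with hc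
  have hk : (γ : EucSp n ≃ₗᵢ[ℝ] EucSp n) (EuclideanSpace.single k 1) =
      EuclideanSpace.single k c := by
    ext j
    by_cases hj : j = k
    · rw [hj, ← hc]
      simp
    · rw [apply_single_apply_eq_zero hj (h j hj)]
      simp [hj]
  have hdet : LinearMap.det
      (γ : EucSp n ≃ₗᵢ[ℝ] EucSp n).toLinearEquiv.toLinearMap = 1 := γ.2
  rw [← LinearMap.det_toMatrix (EuclideanSpace.basisFun (Fin n) ℝ).toBasis] at hdet
  have hM : LinearMap.toMatrix (EuclideanSpace.basisFun (Fin n) ℝ).toBasis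
      (EuclideanSpace.basisFun (Fin n) ℝ).toBasis
      (γ : EucSp n ≃ₗᵢ[ℝ] EucSp n).toLinearEquiv.toLinearMap =
      Matrix.diagonal (Function.update 1 k c) := by
    ext i j
    rw [LinearMap.toMatrix_apply]
    by_cases hj : j = k
    · subst hj
      have : ((γ : EucSp n ≃ₗᵢ[ℝ] EucSp n) (EuclideanSpace.single j 1)) i =
        Matrix.diagonal (Function.update (1 : Fin n → ℝ) j c) i j := by
        rw [hk]
        by_cases hi : i = j
        · simp [hi]
        · simp [hi]
      simpa using this
    · have : ((γ : EucSp n ≃ₗᵢ[ℝ] EucSp n) (EuclideanSpace.single j 1)) i =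
        Matrix.diagonal (Function.update (1 : Fin n → ℝ) k c) i j := by
        rw [h j hj]
        by_cases hi : i = j
        · simp [hi, hj]
        · simp [hi]
      simpa using this
  rw [hM, Matrix.det_diagonal, Finset.prod_update_of_mem (Finset.mem_univ _)] at hdet
  simp only [Pi.one_apply, Finset.prod_const_one, mul_one] at hdet
  refine eq_one_of_forall_single fun j => ?_
  by_cases hj : j = k
  · rw [hj, hk, hdet]
  · exact h j hj

include hn hD1 hmul hinv hδ0 hδ in
theorem le_of_forall_block_planeRot_le (γ : rotationGroup n) : D γ ≤ n * (n * δ) := by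
  have hfix (m : ℕ) (hm : m ≤ n) : ∀ γ : rotationGroup n,
      (∀ j : Fin n, m ≤ j → (γ : EucSp n ≃ₗᵢ[ℝ] EucSp n) (EuclideanSpace.single j 1) =
        EuclideanSpace.single j 1) → D γ ≤ m * (n * δ) := by
    induction m with
    | zero =>
      intro γ hγ
      rw [eq_one_of_forall_single fun j => hγ j (Nat.zero_le _)]
      simpa using hD1
    | succ m ih =>
      intro γ hγ
      have hnδ : 0 ≤ n * δ := by positivity
      set k : Fin n := ⟨m, hm⟩ with hk
      rcases Nat.eq_zero_or_pos m with h0 | h0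
      · rw [eq_one_of_forall_single_ne (k := k) fun j hj => hγ j (by
          have : (j : ℕ) ≠ m := fun h => hj (Fin.ext h)
          omega)]
        exact hD1.trans (by positivity)
      · set x := (γ : EucSp n ≃ₗᵢ[ℝ] EucSp n) (EuclideanSpace.single k 1) with hx
        obtain ⟨g, hg, hg0, hgk, hgy⟩ := exists_forall_apply_eq_zero hn hD1 hmul hδ x k
          (Finset.univ.filter fun j : Fin n => j < k) (by simp)
        have hsub := hmul g⁻¹ (g * γ)
        rw [inv_mul_cancel_left, hinv] at hsub
        have hcard : ((Finset.univ.filter fun j : Fin n => j < k).card : ℝ) ≤ n := by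
          exact_mod_cast (Finset.card_le_univ _).trans_eq (Fintype.card_fin n)
        have hg' : D g ≤ n * δ := hg.trans (by gcongr)
        have := ih (by omega) (g * γ) fun j hj => ?_
        · push_cast
          linarith
        have hgj : ∀ j : Fin n, k < j → (g : EucSp n ≃ₗᵢ[ℝ] EucSp n) (EuclideanSpace.single j 1) =
            EuclideanSpace.single j 1 := by
          intro j hj
          have h1 := hgy (EuclideanSpace.single j 1) j (by simp [hj.le]) hj.ne'
          rw [PiLp.single_apply, if_pos rfl] at h1
          rw [← inner_eq_one_iff_of_norm_eq_one (𝕜 := ℝ) (by simp) (by simp),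
            EuclideanSpace.inner_single_right, h1]
          simp
        have hkj : ∀ j : Fin n, k < j → (γ : EucSp n ≃ₗᵢ[ℝ] EucSp n) (EuclideanSpace.single j 1) =
            EuclideanSpace.single j 1 := fun j hj => hγ j (Nat.succ_le_of_lt hj)
        rcases (show k ≤ j from hj).lt_or_eq with hj' | rfl
        · change (g : EucSp n ≃ₗᵢ[ℝ] EucSp n) ((γ : EucSp n ≃ₗᵢ[ℝ] EucSp n) _) = _
          rw [hkj j hj', hgj j hj']
        · change (g : EucSp n ≃ₗᵢ[ℝ] EucSp n) x = _
          set y := (g : EucSp n ≃ₗᵢ[ℝ] EucSp n) x with hy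
          have hyk : y = EuclideanSpace.single k (y k) := by
            ext j
            rcases lt_trichotomy j k with h | h | h
            · rw [hg0 j (by simpa using h)]
              simp [h.ne]
            · simp [h]
            · rw [hgy x j (by simp [h.le]) h.ne', hx,
                apply_single_apply_eq_zero h.ne' (hkj j h)]
              simp [h.ne']
          have hnorm : ‖y‖ = 1 := by rw [hy, LinearIsometryEquiv.norm_map, hx,
            LinearIsometryEquiv.norm_map]; simp
          have hyk0 := hgk ⟨⟨0, by omega⟩, by simpa [hk, Fin.lt_def] using h0⟩
          rw [hyk, PiLp.norm_single, Real.norm_eq_abs, abs_of_nonneg hyk0] at hnorm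
          rw [hyk, hnorm]
  exact hfix n le_rfl γ fun j hj => absurd j.2 (not_lt.2 hj)

end Length

end rotationGroup

section

open scoped RealInnerProductSpace

section SpectralGap

variable {E ι : Type*} [NormedAddCommGroup E] [InnerProductSpace ℝ E] [Fintype ι]

theorem sum_norm_sub_sq_eq {u : ι → E →ₗ[ℝ] E} (hu : ∀ i x, ‖u i x‖ = ‖x‖) (x : E) :
    ∑ i, ‖u i x - x‖ ^ 2 = 2 * Fintype.card ι * ‖x‖ ^ 2 - 2 * ⟪(∑ i, u i) x, x⟫ := by
  have h (i : ι) : ‖u i x - x‖ ^ 2 = 2 * ‖x‖ ^ 2 - 2 * ⟪u i x, x⟫ := by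
    rw [norm_sub_sq_real, hu]
    ring
  simp only [h]
  rw [Finset.sum_sub_distrib, LinearMap.sum_apply, sum_inner, Finset.mul_sum]
  simp
  ring

theorem exists_forall_apply_eq_self_of_eigenvalue_gap [FiniteDimensional ℝ E]
    {u : ι → E →ₗ[ℝ] E} (hu : ∀ i x, ‖u i x‖ = ‖x‖) (hT : (∑ i, u i).IsSymmetric) {r : ℝ}
    (hgap : ∀ x ≠ 0, ∀ Λ : ℝ, (∑ i, u i) x = Λ • x → Λ < Fintype.card ι → Λ ≤ r) (f : E) :
    ∃ f₀, (∀ i, u i f₀ = f₀) ∧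
      2 * (Fintype.card ι - r) * ‖f - f₀‖ ^ 2 ≤ ∑ i, ‖u i f - f‖ ^ 2 := by
  set T := ∑ i, u i with hTdef
  set K := Module.End.eigenspace T (Fintype.card ι : ℝ) with hK
  obtain ⟨f₀, hf₀, f₁, hf₁, rfl⟩ := K.exists_add_mem_mem_orthogonal f
  have hfix (i : ι) : u i f₀ = f₀ := by
    have h := sum_norm_sub_sq_eq hu f₀
    rw [← hTdef, Module.End.mem_eigenspace_iff.1 hf₀, real_inner_smul_left,
      real_inner_self_eq_norm_sq] at h
    have h0 : ∑ i, ‖u i f₀ - f₀‖ ^ 2 = 0 := by rw [h]; ring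
    have := (Finset.sum_eq_zero_iff_of_nonneg fun i _ => sq_nonneg _).1 h0 i (Finset.mem_univ i)
    exact sub_eq_zero.1 (norm_eq_zero.1 (pow_eq_zero_iff two_ne_zero |>.1 this))
  refine ⟨f₀, hfix, ?_⟩
  have hsub (i : ι) : u i (f₀ + f₁) - (f₀ + f₁) = u i f₁ - f₁ := by
    rw [map_add, hfix]
    abel
  simp only [hsub, add_sub_cancel_left]
  rw [sum_norm_sub_sq_eq hu, ← hTdef]
  suffices h : ⟪T f₁, f₁⟫ ≤ r * ‖f₁‖ ^ 2 by linarith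
  let b := hT.eigenvectorBasis rfl
  have hb (k) : T (b k) = hT.eigenvalues rfl k • b k := hT.apply_eigenvectorBasis rfl k
  rw [← b.sum_inner_mul_inner (T f₁) f₁, ← b.sum_sq_norm_inner_right f₁, Finset.mul_sum]
  refine Finset.sum_le_sum fun k _ => ?_
  rw [hT f₁ (b k), hb, real_inner_smul_right, real_inner_comm, Real.norm_eq_abs, sq_abs, mul_assoc,
    ← sq]
  have hbk : ‖b k‖ = 1 := b.orthonormal.1 k
  have hle : hT.eigenvalues rfl k ≤ Fintype.card ι := by
    have h := sum_norm_sub_sq_eq hu (b k)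
    rw [← hTdef, hb, real_inner_smul_left, real_inner_self_eq_norm_sq, hbk] at h
    have h0 : 0 ≤ ∑ i, ‖u i (b k) - b k‖ ^ 2 := Finset.sum_nonneg fun i _ => sq_nonneg _
    linarith
  rcases hle.lt_or_eq with hlt | heq
  · exact mul_le_mul_of_nonneg_right (hgap (b k) (norm_ne_zero_iff.1 (by rw [hbk]; simp)) _ (hb k)
      hlt) (sq_nonneg _)
  · have : ⟪b k, f₁⟫ = 0 :=
      K.inner_right_of_mem_orthogonal (Module.End.mem_eigenspace_iff.2 (by rw [hb, heq])) hf₁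
    rw [this]
    simp

end SpectralGap

end

section

open scoped RealInnerProductSpace

theorem exists_mem_forall_smul_eq_norm_sub_le {G H : Type*} [Group G] [NormedAddCommGroup H]
    [InnerProductSpace ℝ H] [CompleteSpace H] [DistribMulAction G H] [IsIsometricSMul G H]
    {K : Submodule ℝ H} (hKc : IsClosed (K : Set H)) (hK : ∀ (g : G), ∀ x ∈ K, g • x ∈ K)
    {f : H} (hf : f ∈ K) {δ : ℝ} (hδ : ∀ g : G, ‖g • f - f‖ ≤ δ) :
    ∃ x ∈ K, (∀ g : G, g • x = x) ∧ ‖f - x‖ ≤ δ := by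
  set C : Set H := (⋂ g : G, Metric.closedBall (g • f) δ) ∩ K with hC
  have hconv : Convex ℝ C := (convex_iInter fun g => convex_closedBall _ _).inter K.convex
  have hclosed : IsClosed C := (isClosed_iInter fun g => Metric.isClosed_closedBall).inter hKc
  have hmem {x : H} : x ∈ C ↔ (∀ g : G, ‖x - g • f‖ ≤ δ) ∧ x ∈ K := by
    simp only [hC, Set.mem_inter_iff, Set.mem_iInter, Metric.mem_closedBall, dist_eq_norm,
      SetLike.mem_coe]
  have hfC : f ∈ C := hmem.2 ⟨fun g => by rw [norm_sub_rev]; exact hδ g, hf⟩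
  obtain ⟨v, hv, hmin⟩ := exists_norm_eq_iInf_of_complete_convex ⟨f, hfC⟩ hclosed.isComplete hconv 0
  rw [norm_eq_iInf_iff_real_inner_le_zero hconv hv] at hmin
  refine ⟨v, (hmem.1 hv).2, fun g => ?_, ?_⟩
  · have hgv : g • v ∈ C := by
      refine hmem.2 ⟨fun h => ?_, hK g v (hmem.1 hv).2⟩
      rw [← dist_eq_norm, ← smul_inv_smul g (h • f), dist_smul, dist_eq_norm, smul_smul]
      exact (hmem.1 hv).1 _
    have h := hmin _ hgv
    have hn : ‖g • v‖ = ‖v‖ := by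
      rw [← dist_zero_right, ← dist_zero_right, ← smul_zero g, dist_smul, smul_zero]
    have h2 := norm_sub_sq_real (g • v) v
    rw [zero_sub, inner_neg_left, inner_sub_right, real_inner_self_eq_norm_sq] at h
    rw [hn, real_inner_comm] at h2
    have h3 : ‖g • v - v‖ ^ 2 ≤ 0 := by linarith
    exact sub_eq_zero.1 (norm_eq_zero.1 (pow_eq_zero_iff two_ne_zero |>.1
      (le_antisymm h3 (sq_nonneg _))))
  · have := (hmem.1 hv).1 1
    rwa [one_smul, norm_sub_rev] at this

end

namespace rotationGroup

open MvPolynomial DomMulAct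

variable {n : ℕ}

/-- The restriction of polynomials to the sphere. -/
def spherePoly (n : ℕ) : MvPolynomial (Fin n) ℝ →ₐ[ℝ] C(Sph n, ℝ) :=
  aeval fun i => ⟨fun x => (x : EucSp n) i, by fun_prop⟩

theorem spherePoly_apply (p : MvPolynomial (Fin n) ℝ) (x : Sph n) :
    spherePoly n p x = eval (x : EucSp n) p := by
  induction p using MvPolynomial.induction_on with
  | C a => simp [spherePoly]
  | add p q hp hq => simp [hp, hq]
  | mul_X p i hp => simp [hp]; simp [spherePoly]

theorem topologicalClosure_range_spherePoly (n : ℕ) :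
    (spherePoly n).range.topologicalClosure = ⊤ := by
  refine ContinuousMap.subalgebra_topologicalClosure_eq_top_of_separatesPoints _ ?_
  intro x y hxy
  obtain ⟨i, hi⟩ : ∃ i, (x : EucSp n) i ≠ (y : EucSp n) i := by
    by_contra! h
    exact hxy (Subtype.ext (PiLp.ext h))
  refine ⟨_, ⟨_, ⟨X i, rfl⟩, rfl⟩, ?_⟩
  simpa [spherePoly_apply] using hi

/-- The matrix of a rotation. -/
def toMatrix (γ : rotationGroup n) : Matrix (Fin n) (Fin n) ℝ :=
  Matrix.toEuclideanLin.symm (γ : EucSp n ≃ₗᵢ[ℝ] EucSp n).toLinearEquiv.toLinearMap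

theorem toMatrix_mulVec (γ : rotationGroup n) (x : EucSp n) :
    (toMatrix γ).mulVec x = (γ : EucSp n ≃ₗᵢ[ℝ] EucSp n) x := by
  have : Matrix.toEuclideanLin (toMatrix γ) x = (γ : EucSp n ≃ₗᵢ[ℝ] EucSp n) x := by
    rw [toMatrix, LinearEquiv.apply_symm_apply]
    rfl
  rw [← this]
  rfl

theorem toMatrix_ofMatrix (M : Matrix.specialOrthogonalGroup (Fin n) ℝ) :
    toMatrix (ofMatrix M) = M := by
  refine Matrix.toEuclideanLin.symm_apply_eq.2 ?_
  rfl

theorem spherePoly_linSubst_toMatrix (γ : rotationGroup n) (p : MvPolynomial (Fin n) ℝ)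
    (x : Sph n) : spherePoly n (linSubst (toMatrix γ) p) x = spherePoly n p (γ • x) := by
  rw [spherePoly_apply, spherePoly_apply, eval_linSubst, toMatrix_mulVec, coe_smul]

theorem _root_.linSubst_mem_restrictTotalDegree {ι : Type*} [Fintype ι] {d : ℕ}
    (M : Matrix ι ι ℝ) {p : MvPolynomial ι ℝ} (hp : p ∈ restrictTotalDegree ι ℝ d) :
    linSubst M p ∈ restrictTotalDegree ι ℝ d := by
  rw [← sum_homogeneousComponent p, map_sum]
  refine sum_mem fun k hk => ?_
  rw [mem_restrictTotalDegree] at hp ⊢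
  have := ((homogeneousComponent_isHomogeneous k p).linSubst M).totalDegree_le
  have := Finset.mem_range.1 hk
  omega

variable {μ : Measure (Sph n)} [IsProbabilityMeasure μ]

/-- Polynomials as square-integrable functions on the sphere. -/
def polyL2 (μ : Measure (Sph n)) [IsProbabilityMeasure μ] :
    MvPolynomial (Fin n) ℝ →ₗ[ℝ] Lp ℝ 2 μ :=
  (ContinuousMap.toLp 2 μ ℝ).toLinearMap ∘ₗ (spherePoly n).toLinearMap

theorem denseRange_polyL2 : DenseRange (polyL2 μ) := by
  refine (ContinuousMap.toLp_denseRange ℝ μ ℝ (by simp)).comp ?_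
    (ContinuousMap.toLp 2 μ ℝ).continuous
  intro f
  have h : f ∈ (spherePoly n).range.topologicalClosure := by
    rw [topologicalClosure_range_spherePoly]
    trivial
  exact h

theorem polyL2_one : polyL2 μ 1 = Lp.const 2 μ 1 := by
  rw [polyL2]
  simp only [LinearMap.comp_apply, AlgHom.toLinearMap_apply, map_one]
  rfl

theorem norm_polyL2_one : ‖polyL2 μ (1 : MvPolynomial (Fin n) ℝ)‖ = 1 := by
  rw [polyL2_one, ← indicatorConstLp_univ, norm_indicatorConstLp (by simp) (by simp)]
  simp

section
variable [SMulInvariantMeasure (rotationGroup n) (Sph n) μ]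

theorem mk_smul_polyL2 (γ : rotationGroup n) (p : MvPolynomial (Fin n) ℝ) :
    mk γ • polyL2 μ p = polyL2 μ (linSubst (toMatrix γ) p) := by
  refine Lp.ext ?_
  refine (smul_Lp_ae_eq _ _).trans ?_
  refine Filter.EventuallyEq.trans ?_ (ContinuousMap.coeFn_toLp μ (𝕜 := ℝ) _).symm
  have h := (measurePreserving_smul γ μ).quasiMeasurePreserving.ae_eq_comp
    (ContinuousMap.coeFn_toLp (p := 2) μ (𝕜 := ℝ) (spherePoly n p))
  refine h.trans (Filter.Eventually.of_forall fun x => ?_)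
  exact (spherePoly_linSubst_toMatrix γ p x).symm

end

end rotationGroup

namespace rotationGroup

open MvPolynomial DomMulAct Quaternion

variable {n : ℕ}

/-- The rotations of `ℝ³` given by the quaternions `heckeGen i`. -/
def heckeRot (i : Fin 6) : Matrix.specialOrthogonalGroup (Fin 3) ℝ :=
  ⟨quatRot ℝ (heckeGen i), by
    have h : ((normSq (heckeGen i) : ℤ) : ℝ) ≠ 0 := by rw [normSq_heckeGen]; norm_num
    rw [Matrix.mem_specialOrthogonalGroup_iff, Matrix.mem_orthogonalGroup_iff']
    exact ⟨quatRot_transpose_mul ℝ h, det_quatRot ℝ h⟩⟩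

theorem coe_heckeRot (i : Fin 6) :
    (heckeRot i : Matrix (Fin 3) (Fin 3) ℝ) = quatRot ℝ (heckeGen i) := rfl

theorem quatRot_star (𝕜 : Type*) [Field 𝕜] (q : ℍ[ℤ]) :
    quatRot 𝕜 (star q) = (quatRot 𝕜 q).transpose := by
  have h : quatConj (star q) = (quatConj q).transpose := by
    ext i j
    fin_cases i <;> fin_cases j <;> simp [quatConj] <;> ring
  rw [quatRot, quatRot, h, normSq_star]
  rfl

theorem exists_perm_heckeRot_mul_eq_one :
    ∃ σ : Equiv.Perm (Fin 6), ∀ i, heckeRot (σ i) * heckeRot i = 1 := by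
  choose σ hσ using exists_star_heckeGen_eq
  have hinj : Function.Injective heckeGen := by
    intro i j h
    have h1 := congrArg (fun q : ℍ[ℤ] => q.imI) h
    have h2 := congrArg (fun q : ℍ[ℤ] => q.imJ) h
    have h3 := congrArg (fun q : ℍ[ℤ] => q.imK) h
    change (![2, -2, 0, 0, 0, 0] : Fin 6 → ℤ) i = (![2, -2, 0, 0, 0, 0] : Fin 6 → ℤ) j at h1
    change (![0, 0, 2, -2, 0, 0] : Fin 6 → ℤ) i = (![0, 0, 2, -2, 0, 0] : Fin 6 → ℤ) j at h2
    change (![0, 0, 0, 0, 2, -2] : Fin 6 → ℤ) i = (![0, 0, 0, 0, 2, -2] : Fin 6 → ℤ) j at h3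
    clear h hσ
    revert i j
    decide
  have hσinj : Function.Injective σ := fun i j h =>
    hinj (star_injective (by rw [hσ, hσ, h]))
  refine ⟨Equiv.ofBijective σ (Finite.injective_iff_bijective.1 hσinj), fun i => ?_⟩
  have h : ((normSq (heckeGen i) : ℤ) : ℝ) ≠ 0 := by rw [normSq_heckeGen]; norm_num
  refine Subtype.ext ?_
  change quatRot ℝ (heckeGen (σ i)) * quatRot ℝ (heckeGen i) = 1
  rw [← hσ, quatRot_star, quatRot_transpose_mul ℝ h]

theorem _root_.Real.cos_two_mul_arctan_two : Real.cos (2 * Real.arctan 2) = -(3 / 5) := by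
  rw [Real.cos_two_mul, Real.cos_sq_arctan]
  norm_num

theorem planeRot_two_mul_arctan_two :
    planeRot (2 * Real.arctan 2) = heckeRot 4 := by
  have hs : Real.sin (2 * Real.arctan 2) = 4 / 5 := by
    rw [Real.sin_two_mul, Real.sin_arctan, Real.cos_arctan, mul_assoc, div_mul_div_comm,
      Real.mul_self_sqrt (by norm_num)]
    norm_num
  refine Subtype.ext ?_
  change !![Real.cos (2 * Real.arctan 2), -Real.sin (2 * Real.arctan 2), 0;
    Real.sin (2 * Real.arctan 2), Real.cos (2 * Real.arctan 2), 0; 0, 0, 1] =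
      quatRot ℝ (heckeGen 4)
  rw [Real.cos_two_mul_arctan_two, hs]
  have h1 : (heckeGen 4).re = 1 := rfl
  have h2 : (heckeGen 4).imI = 0 := rfl
  have h3 : (heckeGen 4).imJ = 0 := rfl
  have h4 : (heckeGen 4).imK = 2 := rfl
  rw [quatRot, normSq_heckeGen, quatConj, h1, h2, h3, h4]
  ext i j
  fin_cases i <;> fin_cases j <;> simp <;> norm_num

theorem _root_.irrational_two_mul_arctan_two_div_two_pi :
    Irrational (2 * Real.arctan 2 / (2 * Real.pi)) := by
  rintro ⟨q, hq⟩
  rw [eq_div_iff (by positivity)] at hq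
  have h := niven (θ := 2 * Real.arctan 2) ⟨q * 2, by push_cast; rw [← hq]; ring⟩
    ⟨-(3 / 5), by rw [Real.cos_two_mul_arctan_two]; norm_num⟩
  rw [Real.cos_two_mul_arctan_two] at h
  norm_num at h

/-- Specialization of all the variables but the three selected by `e`. -/
def blockSpec (e : Fin n ≃ Fin 3 ⊕ Fin (n - 3)) (y : Fin n → ℝ) :
    MvPolynomial (Fin n) ℝ →ₐ[ℝ] MvPolynomial (Fin 3) ℝ :=
  aeval fun j => (e j).elim X fun _ => C (y j)

theorem blockSpec_linSubst (e : Fin n ≃ Fin 3 ⊕ Fin (n - 3)) (y : Fin n → ℝ)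
    (M : Matrix (Fin 3) (Fin 3) ℝ) (F : MvPolynomial (Fin n) ℝ) :
    blockSpec e y (linSubst (blockMatrix e M) F) = linSubst M (blockSpec e y F) := by
  suffices h : (blockSpec e y).comp (linSubst (blockMatrix e M)) =
      (linSubst M).comp (blockSpec e y) from DFunLike.congr_fun h F
  refine MvPolynomial.algHom_ext fun i => ?_
  simp only [AlgHom.comp_apply, linSubst_X, map_sum, map_mul]
  simp only [blockSpec, aeval_X, aeval_C, algebraMap_eq]
  rw [← e.symm.sum_comp, Fintype.sum_sum_type]
  simp only [Equiv.apply_symm_apply, blockMatrix, Matrix.submatrix_apply]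
  rcases h : e i with a | b
  · simp [linSubst_X]
  · have : i = e.symm (Sum.inr b) := by rw [← h, Equiv.symm_apply_apply]
    simp [Matrix.one_apply, this]

theorem exists_blockSpec_ne_zero (e : Fin n ≃ Fin 3 ⊕ Fin (n - 3)) {F : MvPolynomial (Fin n) ℝ}
    (hF : F ≠ 0) : ∃ y, blockSpec e y F ≠ 0 := by
  obtain ⟨y, hy⟩ : ∃ y, eval y F ≠ 0 := by
    by_contra! h
    exact hF (MvPolynomial.funext fun y => by rw [h, map_zero])
  refine ⟨y, fun h0 => hy ?_⟩
  have h : (aeval fun a => y (e.symm (Sum.inl a))).comp (blockSpec e y) = aeval y := by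
    refine MvPolynomial.algHom_ext fun i => ?_
    simp only [AlgHom.comp_apply, blockSpec, aeval_X]
    rcases h : e i with a | b
    · have : i = e.symm (Sum.inl a) := by rw [← h, Equiv.symm_apply_apply]
      simp [this]
    · simp
  rw [← coe_aeval_eq_eval, RingHom.coe_coe, ← h, AlgHom.comp_apply, h0, map_zero]

theorem exists_sum_linSubst_blockMatrix_eigenvalue_le :
    ∃ r < (6 : ℝ), ∀ {n : ℕ} (e : Fin n ≃ Fin 3 ⊕ Fin (n - 3)) (F : MvPolynomial (Fin n) ℝ),
      F ≠ 0 → ∀ Λ : ℝ, ∑ i, linSubst (blockMatrix e (heckeRot i)) F = Λ • F → Λ < 6 → Λ ≤ r := by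
  obtain ⟨r, hr, h⟩ := exists_sum_linSubst_quatRot_eigenvalue_le
  refine ⟨r, hr, fun e F hF Λ hΛ => ?_⟩
  obtain ⟨y, hy⟩ := exists_blockSpec_ne_zero e hF
  refine h _ hy Λ ?_
  have := congrArg (blockSpec e y) hΛ
  simpa only [map_sum, blockSpec_linSubst, map_smul, coe_heckeRot] using this

theorem _root_.LinearMap.injective_of_comp_eq {K P E : Type*} [Field K] [AddCommGroup P]
    [Module K P] [AddCommGroup E] [Module K E] [FiniteDimensional K P] {S : P →ₗ[K] P}
    {T : E →ₗ[K] E} {φ : P →ₗ[K] E} (hφ : Function.Surjective φ) (h : T ∘ₗ φ = φ ∘ₗ S)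
    (hS : Function.Injective S) : Function.Injective T := by
  have : FiniteDimensional K E := Module.Finite.of_surjective φ hφ
  rw [LinearMap.injective_iff_surjective] at hS ⊢
  have hs : Function.Surjective (T ∘ₗ φ) := by
    rw [h]
    exact hφ.comp hS
  exact Function.Surjective.of_comp (g := φ) hs

end rotationGroup

namespace rotationGroup

open MvPolynomial DomMulAct
open scoped RealInnerProductSpace

variable {n : ℕ} {μ : Measure (Sph n)} [IsProbabilityMeasure μ]

/-- The polynomials of degree at most `d` as square-integrable functions on the sphere. -/
def polySubspace (μ : Measure (Sph n)) [IsProbabilityMeasure μ] (d : ℕ) :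
    Submodule ℝ (Lp ℝ 2 μ) :=
  (restrictTotalDegree (Fin n) ℝ d).map (polyL2 μ)

instance (d : ℕ) : FiniteDimensional ℝ (polySubspace μ d) :=
  inferInstanceAs (FiniteDimensional ℝ ((restrictTotalDegree (Fin n) ℝ d).map (polyL2 μ)))

variable [SMulInvariantMeasure (rotationGroup n) (Sph n) μ]

theorem mk_smul_mem_polySubspace {d : ℕ} (γ : rotationGroup n) {f : Lp ℝ 2 μ}
    (hf : f ∈ polySubspace μ d) : mk γ • f ∈ polySubspace μ d := by
  obtain ⟨p, hp, rfl⟩ := hf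
  rw [mk_smul_polyL2]
  exact ⟨_, linSubst_mem_restrictTotalDegree _ hp, rfl⟩

/-- The action of a rotation on the polynomials of degree at most `d`. -/
def polyAct (μ : Measure (Sph n)) [IsProbabilityMeasure μ]
    [SMulInvariantMeasure (rotationGroup n) (Sph n) μ] (d : ℕ) (γ : rotationGroup n) :
    polySubspace μ d →ₗ[ℝ] polySubspace μ d :=
  (DistribSMul.toLinearMap ℝ (Lp ℝ 2 μ) (mk γ)).restrict fun _ hf => mk_smul_mem_polySubspace γ hf

theorem coe_polyAct {d : ℕ} (γ : rotationGroup n) (f : polySubspace μ d) :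
    (polyAct μ d γ f : Lp ℝ 2 μ) = mk γ • (f : Lp ℝ 2 μ) := rfl

theorem norm_polyAct {d : ℕ} (γ : rotationGroup n) (f : polySubspace μ d) :
    ‖polyAct μ d γ f‖ = ‖f‖ := by
  rw [← Submodule.norm_coe, coe_polyAct, norm_smul_Lp, Submodule.norm_coe]

theorem polyAct_mul_apply {d : ℕ} (γ δ : rotationGroup n) (f : polySubspace μ d) :
    polyAct μ d (γ * δ) f = polyAct μ d δ (polyAct μ d γ f) := by
  refine Subtype.ext ?_
  rw [coe_polyAct, coe_polyAct, coe_polyAct, mk_mul, mul_smul]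

theorem polyAct_one_apply {d : ℕ} (f : polySubspace μ d) : polyAct μ d 1 f = f := by
  refine Subtype.ext ?_
  rw [coe_polyAct, mk_one, one_smul]

theorem inner_polyAct_left {d : ℕ} {γ δ : rotationGroup n} (h : γ * δ = 1)
    (f g : polySubspace μ d) : ⟪polyAct μ d γ f, g⟫ = ⟪f, polyAct μ d δ g⟫ := by
  let u : polySubspace μ d →ₗᵢ[ℝ] polySubspace μ d := ⟨polyAct μ d δ, norm_polyAct δ⟩
  have : polyAct μ d δ (polyAct μ d γ f) = f := by
    rw [← polyAct_mul_apply, h, polyAct_one_apply]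
  conv_rhs => rw [← this]
  exact (u.inner_map_map _ _).symm

theorem isSymmetric_sum_polyAct_heckeRot (d : ℕ) (e : Fin n ≃ Fin 3 ⊕ Fin (n - 3)) :
    (∑ i, polyAct μ d (block e (heckeRot i))).IsSymmetric := by
  obtain ⟨σ, hσ⟩ := exists_perm_heckeRot_mul_eq_one
  intro f g
  rw [LinearMap.sum_apply, LinearMap.sum_apply, sum_inner, inner_sum, ← σ.sum_comp _ _ (by simp)]
  refine Finset.sum_congr rfl fun i _ => inner_polyAct_left ?_ _ _
  rw [← block_mul, hσ, block_one]

theorem eigenvalue_sum_polyAct_heckeRot_le {r : ℝ} {e : Fin n ≃ Fin 3 ⊕ Fin (n - 3)}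
    (hr : ∀ F : MvPolynomial (Fin n) ℝ, F ≠ 0 → ∀ Λ : ℝ,
      ∑ i, linSubst (blockMatrix e (heckeRot i)) F = Λ • F → Λ < 6 → Λ ≤ r) {d : ℕ}
    {f : polySubspace μ d} (hf : f ≠ 0) {Λ : ℝ}
    (hΛ : (∑ i, polyAct μ d (block e (heckeRot i))) f = Λ • f) (hlt : Λ < 6) : Λ ≤ r := by
  by_contra! hrΛ
  let P := restrictTotalDegree (Fin n) ℝ d
  let S : P →ₗ[ℝ] P := (∑ i, (linSubst (blockMatrix e (heckeRot i))).toLinearMap).restrict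
    (fun p hp => by
      rw [LinearMap.sum_apply]
      exact sum_mem fun i _ => linSubst_mem_restrictTotalDegree _ hp) - Λ • LinearMap.id
  let T := (∑ i, polyAct μ d (block e (heckeRot i))) - Λ • LinearMap.id
  let φ : P →ₗ[ℝ] polySubspace μ d := (polyL2 μ).submoduleMap P
  have hS (p : P) : (S p : MvPolynomial (Fin n) ℝ) =
      ∑ i, linSubst (blockMatrix e (heckeRot i)) (p : MvPolynomial (Fin n) ℝ) - Λ • p := by
    simp [S, LinearMap.sum_apply]
  have hinj : Function.Injective T := by
    refine LinearMap.injective_of_comp_eq (φ := φ) (S := S)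
      ((polyL2 μ).submoduleMap_surjective P) ?_ ?_
    · refine LinearMap.ext fun p => Subtype.ext ?_
      have h1 : ((φ (S p) : polySubspace μ d) : Lp ℝ 2 μ) = polyL2 μ (S p) := rfl
      have h2 : ((φ p : polySubspace μ d) : Lp ℝ 2 μ) = polyL2 μ p := rfl
      rw [LinearMap.comp_apply, LinearMap.comp_apply, h1, hS]
      simp only [T, LinearMap.sub_apply, LinearMap.sum_apply, LinearMap.smul_apply,
        LinearMap.id_apply, Submodule.coe_sub, Submodule.coe_sum, Submodule.coe_smul,
        coe_polyAct, h2, mk_smul_polyL2, map_sub, map_sum, map_smul, block, toMatrix_ofMatrix]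
    · refine (injective_iff_map_eq_zero S).2 fun p hp => ?_
      by_contra hp0
      have h := congrArg (Subtype.val) hp
      rw [hS] at h
      refine hrΛ.not_ge (hr p (fun h0 => hp0 (Subtype.ext h0)) Λ (sub_eq_zero.1 h) hlt)
  refine hf (hinj ?_)
  rw [map_zero]
  simp only [T, LinearMap.sub_apply, hΛ, LinearMap.smul_apply, LinearMap.id_apply, sub_self]

end rotationGroup

namespace rotationGroup

open MvPolynomial DomMulAct
open scoped RealInnerProductSpace

variable {n : ℕ}

theorem continuous_block_planeRot_smul (e : Fin n ≃ Fin 3 ⊕ Fin (n - 3)) :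
    Continuous fun q : ℝ × Sph n => block e (planeRot q.1) • q.2 := by
  refine Continuous.subtype_mk ?_ _
  refine (PiLp.continuous_toLp 2 _).comp (continuous_pi fun i => ?_) |>.congr fun q => rfl
  change Continuous fun q : ℝ × Sph n =>
    (block e (planeRot q.1) : EucSp n ≃ₗᵢ[ℝ] EucSp n) (q.2 : EucSp n) i
  simp only [block_apply]
  rcases e i with a | b
  · refine continuous_finsetSum _ fun b _ => ?_
    refine Continuous.mul ?_ (by fun_prop)
    fin_cases a <;> fin_cases b <;> simp [planeRot] <;> fun_prop
  · simp only [Sum.elim_inr]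
    fun_prop

variable {μ : Measure (Sph n)} [IsProbabilityMeasure μ]
  [SMulInvariantMeasure (rotationGroup n) (Sph n) μ]

theorem continuous_mk_block_planeRot_smul (e : Fin n ≃ Fin 3 ⊕ Fin (n - 3)) (f : Lp ℝ 2 μ) :
    Continuous fun θ : ℝ => mk (block e (planeRot θ)) • f := by
  have hg : Continuous (ContinuousMap.mk _ (continuous_block_planeRot_smul e)).curry :=
    ContinuousMap.continuous _
  exact (continuous_const (y := f)).compMeasurePreservingLp hg
    (fun θ => measurePreserving_smul (block e (planeRot θ)) μ) (by simp)

theorem mk_block_planeRot_smul_eq {e : Fin n ≃ Fin 3 ⊕ Fin (n - 3)} {f : Lp ℝ 2 μ}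
    (hf : mk (block e (heckeRot 4)) • f = f) (θ : ℝ) : mk (block e (planeRot θ)) • f = f := by
  let S : AddSubgroup ℝ :=
    { carrier := {θ | mk (block e (planeRot θ)) • f = f}
      zero_mem' := by
        change mk (block e (planeRot 0)) • f = f
        rw [planeRot_zero, block_one, mk_one, one_smul]
      add_mem' := by
        intro a b ha hb
        change mk (block e (planeRot (a + b))) • f = f
        change mk (block e (planeRot a)) • f = f at ha
        change mk (block e (planeRot b)) • f = f at hb
        rw [planeRot_add, block_mul, mk_mul, mul_smul, ha, hb]
      neg_mem' := by
        intro a ha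
        change mk (block e (planeRot (-a))) • f = f
        change mk (block e (planeRot a)) • f = f at ha
        conv_lhs => rw [← ha]
        rw [← mul_smul, ← mk_mul, ← block_mul, ← planeRot_add, add_neg_cancel, planeRot_zero,
          block_one, mk_one, one_smul] }
  have hS : IsClosed (S : Set ℝ) :=
    isClosed_eq (continuous_mk_block_planeRot_smul e f) continuous_const
  have hle : AddSubgroup.closure {2 * Real.arctan 2, 2 * Real.pi} ≤ S := by
    rw [AddSubgroup.closure_le]
    rintro _ (rfl | rfl)
    · change mk (block e (planeRot _)) • f = f
      rw [planeRot_two_mul_arctan_two, hf]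
    · change mk (block e (planeRot _)) • f = f
      rw [planeRot_two_pi, block_one, mk_one, one_smul]
  have hd := dense_addSubgroupClosure_pair_iff.2 irrational_two_mul_arctan_two_div_two_pi
  have : (S : Set ℝ) = univ := by
    rw [← hS.closure_eq]
    exact (hd.mono hle).closure_eq
  have h : θ ∈ (S : Set ℝ) := by rw [this]; trivial
  exact h

theorem exists_eq_const_of_forall_mk_smul_eq (hn : 3 ≤ n) {p : MvPolynomial (Fin n) ℝ}
    (hp : ∀ γ : rotationGroup n, mk γ • polyL2 μ p = polyL2 μ p) :
    ∃ c : ℝ, polyL2 μ p = c • polyL2 μ 1 := by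
  have : μ.IsOpenPosMeasure := ⟨fun U hU hne h0 => by
    have h := measure_pos_of_interior_nonempty (μ := μ) hn (A := U) (by rwa [hU.interior_eq])
    rw [measureReal_def, h0] at h
    simp at h⟩
  obtain ⟨x⟩ := nonempty_of_isProbabilityMeasure μ
  refine ⟨spherePoly n p x, ?_⟩
  rw [← map_smul]
  refine congrArg (ContinuousMap.toLp 2 μ ℝ) (ContinuousMap.ext fun y => ?_)
  obtain ⟨γ, rfl⟩ := exists_smul_eq hn x y
  have h := hp γ
  rw [mk_smul_polyL2] at h
  have := ContinuousMap.toLp_injective (𝕜 := ℝ) μ h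
  change spherePoly n p (γ • x) = spherePoly n (spherePoly n p x • 1) (γ • x)
  rw [← spherePoly_linSubst_toMatrix]
  have h2 := DFunLike.congr_fun this x
  simpa using h2

end rotationGroup

namespace rotationGroup

open MvPolynomial DomMulAct
open scoped RealInnerProductSpace Pointwise

variable {n : ℕ} {μ : Measure (Sph n)} [IsProbabilityMeasure μ]
  [SMulInvariantMeasure (rotationGroup n) (Sph n) μ]

theorem norm_mk_block_planeRot_smul_sub_le {r : ℝ} (hr6 : r < 6)
    {e : Fin n ≃ Fin 3 ⊕ Fin (n - 3)}
    (hr : ∀ F : MvPolynomial (Fin n) ℝ, F ≠ 0 → ∀ Λ : ℝ,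
      ∑ i, linSubst (blockMatrix e (heckeRot i)) F = Λ • F → Λ < 6 → Λ ≤ r) {d : ℕ}
    {f : Lp ℝ 2 μ} (hf : f ∈ polySubspace μ d) (θ : ℝ) :
    ‖mk (block e (planeRot θ)) • f - f‖ ^ 2 ≤
      2 / (6 - r) * ∑ i, ‖mk (block e (heckeRot i)) • f - f‖ ^ 2 := by
  obtain ⟨f₀, hf₀, hle⟩ := exists_forall_apply_eq_self_of_eigenvalue_gap
    (u := fun i => polyAct μ d (block e (heckeRot i))) (fun i x => norm_polyAct _ x)
    (isSymmetric_sum_polyAct_heckeRot d e) (r := r)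
    (fun x hx Λ hΛ hlt => eigenvalue_sum_polyAct_heckeRot_le hr hx hΛ (by simpa using hlt)) ⟨f, hf⟩
  have hfix : mk (block e (planeRot θ)) • (f₀ : Lp ℝ 2 μ) = f₀ :=
    mk_block_planeRot_smul_eq (congrArg Subtype.val (hf₀ 4)) θ
  have h1 : ‖mk (block e (planeRot θ)) • f - f‖ ≤ 2 * ‖f - f₀‖ := by
    calc ‖mk (block e (planeRot θ)) • f - f‖
        = ‖mk (block e (planeRot θ)) • (f - f₀) - (f - f₀)‖ := by
          rw [smul_sub, hfix, sub_sub_sub_cancel_right]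
      _ ≤ ‖mk (block e (planeRot θ)) • (f - f₀)‖ + ‖f - f₀‖ := norm_sub_le _ _
      _ = 2 * ‖f - f₀‖ := by rw [norm_smul_Lp]; ring
  have h2 : 2 * (6 - r) * ‖f - f₀‖ ^ 2 ≤ ∑ i, ‖mk (block e (heckeRot i)) • f - f‖ ^ 2 := by
    rw [Fintype.card_fin] at hle
    exact_mod_cast hle
  have h3 : 0 < 6 - r := by linarith
  have h4 : ‖mk (block e (planeRot θ)) • f - f‖ ^ 2 ≤ (2 * ‖f - f₀‖) ^ 2 := by gcongr
  rw [div_mul_eq_mul_div, le_div_iff₀ h3]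
  nlinarith

theorem exists_norm_sub_const_sq_le (hn : 3 ≤ n) :
    ∃ C : ℝ, 0 ≤ C ∧ ∀ p : MvPolynomial (Fin n) ℝ, ∃ c : ℝ,
      ‖polyL2 μ p - c • polyL2 μ 1‖ ^ 2 ≤ C * ∑ e : Fin n ≃ Fin 3 ⊕ Fin (n - 3), ∑ i,
        ‖mk (block e (heckeRot i)) • polyL2 μ p - polyL2 μ p‖ ^ 2 := by
  obtain ⟨r, hr6, hr⟩ := exists_sum_linSubst_blockMatrix_eigenvalue_le
  have hr6' : 0 < 6 - r := by linarith
  refine ⟨n ^ 4 * (2 / (6 - r)), by positivity, fun p => ?_⟩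
  set f := polyL2 μ p with hfdef
  have hf : f ∈ polySubspace μ p.totalDegree :=
    ⟨p, (mem_restrictTotalDegree _ _ _).2 le_rfl, rfl⟩
  set S := ∑ e : Fin n ≃ Fin 3 ⊕ Fin (n - 3), ∑ i, ‖mk (block e (heckeRot i)) • f - f‖ ^ 2 with hS
  have hS0 : 0 ≤ S := Finset.sum_nonneg fun _ _ => Finset.sum_nonneg fun _ _ => sq_nonneg _
  have hblock (e : Fin n ≃ Fin 3 ⊕ Fin (n - 3)) (θ : ℝ) :
      ‖mk (block e (planeRot θ)) • f - f‖ ≤ √(2 / (6 - r) * S) := by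
    refine Real.le_sqrt_of_sq_le ((norm_mk_block_planeRot_smul_sub_le hr6 (hr e) hf θ).trans ?_)
    refine mul_le_mul_of_nonneg_left ?_ (by positivity)
    exact Finset.single_le_sum (f := fun e => ∑ i, ‖mk (block e (heckeRot i)) • f - f‖ ^ 2)
      (fun _ _ => Finset.sum_nonneg fun _ _ => sq_nonneg _) (Finset.mem_univ e)
  have hall := le_of_forall_block_planeRot_le hn (D := fun γ => ‖mk γ • f - f‖)
    (by rw [mk_one, one_smul, sub_self, norm_zero])
    (fun a b => by
      have : mk (a * b) • f - f = mk b • (mk a • f - f) + (mk b • f - f) := by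
        rw [smul_sub, mk_mul, mul_smul]
        abel
      rw [this]
      exact (norm_add_le _ _).trans (by rw [norm_smul_Lp]))
    (fun a => by
      have : mk a⁻¹ • f - f = -(mk a⁻¹ • (mk a • f - f)) := by
        rw [smul_sub, ← mul_smul, ← mk_mul, mul_inv_cancel, mk_one, one_smul, neg_sub]
      rw [this, norm_neg, norm_smul_Lp])
    (Real.sqrt_nonneg _) hblock
  obtain ⟨_, ⟨q, -, rfl⟩, hq, hle⟩ := exists_mem_forall_smul_eq_norm_sub_le
    (G := (rotationGroup n)ᵈᵐᵃ) (K := polySubspace μ p.totalDegree)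
    (polySubspace μ p.totalDegree).closed_of_finiteDimensional
    (fun g x hx => mk_smul_mem_polySubspace (mk.symm g) hx) hf (fun g => hall (mk.symm g))
  obtain ⟨c, hc⟩ := exists_eq_const_of_forall_mk_smul_eq hn (fun γ => hq (mk γ))
  refine ⟨c, ?_⟩
  rw [hc] at hle
  calc ‖f - c • polyL2 μ 1‖ ^ 2 ≤ (n * (n * √(2 / (6 - r) * S))) ^ 2 := by gcongr
    _ = n ^ 4 * (2 / (6 - r)) * S := by
      rw [mul_pow, mul_pow, Real.sq_sqrt (by positivity)]
      ring

theorem exists_norm_sq_sub_inner_sq_le (hn : 3 ≤ n) :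
    ∃ C : ℝ, 0 ≤ C ∧ ∀ f : Lp ℝ 2 μ, ‖f‖ ^ 2 - ⟪f, polyL2 μ 1⟫ ^ 2 ≤
      C * ∑ e : Fin n ≃ Fin 3 ⊕ Fin (n - 3), ∑ i, ‖mk (block e (heckeRot i)) • f - f‖ ^ 2 := by
  obtain ⟨C, hC, h⟩ := exists_norm_sub_const_sq_le (μ := μ) hn
  refine ⟨C, hC, fun f => ?_⟩
  refine denseRange_polyL2.induction_on (p := fun f => ‖f‖ ^ 2 - ⟪f, polyL2 μ 1⟫ ^ 2 ≤
    C * ∑ e : Fin n ≃ Fin 3 ⊕ Fin (n - 3), ∑ i, ‖mk (block e (heckeRot i)) • f - f‖ ^ 2) f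
    (isClosed_le (by fun_prop) ?_) fun p => ?_
  · have (γ : rotationGroup n) : Continuous fun f : Lp ℝ 2 μ => mk γ • f :=
      (isometry_smul _ (mk γ)).continuous
    fun_prop
  · obtain ⟨c, hc⟩ := h p
    refine le_trans ?_ hc
    rw [norm_sub_sq_real, real_inner_smul_right, norm_smul, norm_polyL2_one, mul_one,
      Real.norm_eq_abs, sq_abs]
    nlinarith [sq_nonneg (c - ⟪polyL2 μ p, polyL2 μ 1⟫)]

theorem norm_mk_smul_indicatorConstLp_sub_sq (γ : rotationGroup n) {Y : Set (Sph n)}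
    (hY : MeasurableSet Y) :
    ‖mk γ • indicatorConstLp 2 hY (measure_ne_top μ Y) (1 : ℝ) -
      indicatorConstLp 2 hY (measure_ne_top μ Y) (1 : ℝ)‖ ^ 2 = 2 * μ.real ((γ⁻¹ • Y) \ Y) := by
  have hY' : MeasurableSet ((γ • ·) ⁻¹' Y) := hY.preimage (measurable_const_smul γ)
  rw [norm_sub_sq_real, norm_smul_Lp, mk_smul_indicatorConstLp, ← real_inner_self_eq_norm_sq,
    L2.real_inner_indicatorConstLp_one_indicatorConstLp_one hY hY,
    L2.real_inner_indicatorConstLp_one_indicatorConstLp_one hY' hY, inter_self, ← preimage_smul_inv,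
    inv_inv]
  have h1 := measureReal_sdiff_add_inter (μ := μ) (s := (γ • ·) ⁻¹' Y) hY
  have h2 : μ.real ((γ • ·) ⁻¹' Y) = μ.real Y := by
    rw [measureReal_def, measure_preimage_smul, measureReal_def]
  linarith

theorem exists_finset_measureReal_smul_sdiff_ge (hn : 3 ≤ n) :
    ∃ Γ : Finset (rotationGroup n), ∃ c : ℝ, 0 < c ∧ ∀ Y : Set (Sph n), MeasurableSet Y →
      ∃ γ ∈ Γ, c * (μ.real Y * (1 - μ.real Y)) ≤ μ.real ((γ • Y) \ Y) := by
  classical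
  obtain ⟨C, hC, h⟩ := exists_norm_sq_sub_inner_sq_le (μ := μ) hn
  let ι := (Fin n ≃ Fin 3 ⊕ Fin (n - 3)) × Fin 6
  let g : ι → rotationGroup n := fun q => (block q.1 (heckeRot q.2))⁻¹
  set N : ℝ := (Fintype.card ι : ℝ) with hN
  refine ⟨insert 1 (Finset.univ.image g), 1 / (C * (2 * N) + 1), by positivity, fun Y hY => ?_⟩
  set v := μ.real Y with hv
  rcases le_or_gt (v * (1 - v)) 0 with hv0 | hv0
  · exact ⟨1, Finset.mem_insert_self _ _,
      (mul_nonpos_of_nonneg_of_nonpos (by positivity) hv0).trans measureReal_nonneg⟩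
  by_contra! hcon
  set b := 1 / (C * (2 * N) + 1) * (v * (1 - v)) with hb
  have h1 := h (indicatorConstLp 2 hY (measure_ne_top μ Y) (1 : ℝ))
  rw [polyL2_one, ← indicatorConstLp_univ, ← real_inner_self_eq_norm_sq,
    L2.real_inner_indicatorConstLp_one_indicatorConstLp_one hY hY,
    L2.real_inner_indicatorConstLp_one_indicatorConstLp_one hY MeasurableSet.univ, inter_self,
    inter_univ, ← hv, ← Fintype.sum_prod_type'
      (f := fun e i => ‖mk (block e (heckeRot i)) • indicatorConstLp 2 hY (measure_ne_top μ Y)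
        (1 : ℝ) - indicatorConstLp 2 hY (measure_ne_top μ Y) (1 : ℝ)‖ ^ 2)] at h1
  simp only [norm_mk_smul_indicatorConstLp_sub_sq] at h1
  have h2 : ∑ q : ι, 2 * μ.real (((block q.1 (heckeRot q.2))⁻¹ • Y) \ Y) ≤ ∑ _q : ι, 2 * b :=
    Finset.sum_le_sum fun q _ => by
      have := hcon (g q) (Finset.mem_insert_of_mem (Finset.mem_image_of_mem g (Finset.mem_univ q)))
      simp only [g] at this
      linarith
  rw [Finset.sum_const, nsmul_eq_mul, Finset.card_univ, ← hN] at h2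
  have h3 : v * (1 - v) ≤ C * (2 * N) * b := by nlinarith
  have h4 : b * (C * (2 * N) + 1) = v * (1 - v) := by
    have : 0 < C * (2 * N) + 1 := by positivity
    rw [hb, one_div, mul_right_comm, inv_mul_cancel₀ this.ne', one_mul]
  have h5 : 0 < b := by positivity
  nlinarith

end rotationGroup

theorem exists_measurableSet_subset_measure_diff_eq_zero {X : Type*} [TopologicalSpace X]
    [MeasurableSpace X] [BorelSpace X] {μ : Measure X} {A : Set X} (hA : NullMeasurableSet A μ) :
    ∃ A₀ ⊆ A, MeasurableSet A₀ ∧ μ (A \ A₀) = 0 ∧ interior A ⊆ A₀ := by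
  obtain ⟨A₁, h1, h2, h3⟩ := hA.exists_measurable_subset_ae_eq
  refine ⟨A₁ ∪ interior A, union_subset h1 interior_subset, h2.union isOpen_interior.measurableSet,
    ?_, subset_union_right⟩
  exact measure_mono_null (sdiff_subset_sdiff_right subset_union_left) (ae_le_set.1 h3.symm.le)

open scoped Pointwise in
theorem rotationGroup.exists_equidecomposition {n : ℕ} (hn : 3 ≤ n) (μ : Measure (Sph n))
    [IsProbabilityMeasure μ] [SMulInvariantMeasure (rotationGroup n) (Sph n) μ]
    {Γ : Finset (rotationGroup n)} {c : ℝ} (hc : 0 < c)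
    (hΓ : ∀ Y : Set (Sph n), MeasurableSet Y →
      ∃ γ ∈ Γ, c * (μ.real Y * (1 - μ.real Y)) ≤ μ.real ((γ • Y) \ Y))
    {A B : Set (Sph n)} (hAm : NullMeasurableSet A μ) (hBm : NullMeasurableSet B μ)
    (hAi : (interior A).Nonempty) (hBi : (interior B).Nonempty) (hAB : μ A = μ B) :
    ∃ A' B' : Set (Sph n), μ A' = 0 ∧ μ B' = 0 ∧
      ∃ (m : ℕ) (γ : Fin m → (EucSp n ≃ₗᵢ[ℝ] EucSp n)) (P : Fin m → Set (Sph n)),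
        (∀ i, IsRotation (γ i)) ∧
        (∀ i, MeasurableSet (P i)) ∧
        (∀ i j, i ≠ j → Disjoint (P i) (P j)) ∧
        (⋃ i, P i) = A \ A' ∧
        (∀ i j, i ≠ j → Disjoint (rotateSphere (γ i) '' P i) (rotateSphere (γ j) '' P j)) ∧
        (⋃ i, rotateSphere (γ i) '' P i) = B \ B' := by
  obtain ⟨A₀, hA₀, hA₀m, hA₀0, hA₀i⟩ := exists_measurableSet_subset_measure_diff_eq_zero hAm
  obtain ⟨B₀, hB₀, hB₀m, hB₀0, hB₀i⟩ := exists_measurableSet_subset_measure_diff_eq_zero hBm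
  have hA₀i' : (interior A₀).Nonempty := hAi.mono (interior_maximal hA₀i isOpen_interior)
  have hB₀i' : (interior B₀).Nonempty := hBi.mono (interior_maximal hB₀i isOpen_interior)
  have hA₀μ : μ A₀ = μ A := le_antisymm (measure_mono hA₀) (measure_mono_ae (ae_le_set.2 hA₀0))
  have hB₀μ : μ B₀ = μ B := le_antisymm (measure_mono hB₀) (measure_mono_ae (ae_le_set.2 hB₀0))
  obtain ⟨F, hF⟩ := exists_finset_iUnion_smul_eq_univ hn hA₀i'
  obtain ⟨F', hF'⟩ := exists_finset_iUnion_smul_eq_univ hn hB₀i'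
  obtain ⟨S, M, hM, hM'⟩ := exists_measMatching_of_expansion (μ := μ)
    (fun ε hε K => exists_finset_le_measureReal_biUnion_smul hc hΓ hε K) hA₀m hB₀m
    (by simp only [measureReal_def, hA₀μ, hB₀μ, hAB]) (measure_pos_of_interior_nonempty hn hA₀i')
    hF hF'
  have hsub : ∀ {C : Set (Sph n)} {C₀ D : Set (Sph n)}, μ (C \ C₀) = 0 → μ (C₀ \ D) = 0 →
      μ (C \ D) = 0 := fun {C C₀ D} h h' => measure_mono_null
    (fun x hx => (em (x ∈ C₀)).elim (fun h => Or.inr ⟨h, hx.2⟩) fun h => Or.inl ⟨hx.1, h⟩)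
    (measure_union_null h h')
  let e := S.equivFin.symm
  have hP : (⋃ i, M.piece (e i)) = ⋃ g, M.piece g := e.surjective.iUnion_comp M.piece
  have hQ : (⋃ i, rotateSphere (e i : EucSp n ≃ₗᵢ[ℝ] EucSp n) '' M.piece (e i)) =
      ⋃ g : S, (MeasurableEquiv.smul (g : rotationGroup n) : Sph n ≃ᵐ Sph n) '' M.piece g :=
    e.surjective.iUnion_comp
      fun g : S => (MeasurableEquiv.smul (g : rotationGroup n) : Sph n ≃ᵐ Sph n) '' M.piece g
  refine ⟨A \ ⋃ g, M.piece g, B \ ⋃ g : S, (MeasurableEquiv.smul (g : rotationGroup n) :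
    Sph n ≃ᵐ Sph n) '' M.piece g, hsub hA₀0 hM, hsub hB₀0 hM', S.card,
    fun i => ((e i : rotationGroup n) : EucSp n ≃ₗᵢ[ℝ] EucSp n),
    fun i => M.piece (e i), fun i => (e i : rotationGroup n).2,
    fun i => M.measurableSet_piece _, ?_, ?_, ?_, ?_⟩
  · exact fun i j hij => disjoint_left.2 fun x hx hx' =>
      hij (e.injective (M.eq_of_mem _ _ x hx hx'))
  · rw [hP, sdiff_sdiff_cancel_left]
    exact iUnion_subset fun g x hx => hA₀ (M.mem_left g x hx)
  · intro i j hij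
    refine disjoint_left.2 ?_
    rintro _ ⟨x, hx, rfl⟩ ⟨y, hy, hxy⟩
    exact hij (e.injective (M.eq_of_apply_eq _ _ x hx y hy hxy.symm))
  · rw [hQ, sdiff_sdiff_cancel_left]
    refine iUnion_subset fun g => ?_
    rintro _ ⟨x, hx, rfl⟩
    exact hB₀ (M.mem_right g x hx)

/-- Let `n ≥ 3` and let `A, B ⊆ S^{n-1}` be measurable (w.r.t. the rotation-invariant Borel
probability measure `μ`) sets with non-empty interiors relative to the sphere and of the same
measure.  Then there are null sets `A', B' ⊆ S^{n-1}` such that `A \ A'` and `B \ B'` are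
equidecomposable using rotations with Borel pieces. -/
theorem equidecomposition_sphere_mod_null (n : ℕ) (hn : 3 ≤ n)
    (μ : Measure (Sph n)) [IsProbabilityMeasure μ]
    (hinv : ∀ γ : EucSp n ≃ₗᵢ[ℝ] EucSp n, IsRotation γ →
      ∀ U : Set (Sph n), μ (rotateSphere γ '' U) = μ U)
    (A B : Set (Sph n))
    (hAm : NullMeasurableSet A μ) (hBm : NullMeasurableSet B μ)
    (hAi : (interior A).Nonempty) (hBi : (interior B).Nonempty)
    (hAB : μ A = μ B) :
    ∃ A' B' : Set (Sph n), μ A' = 0 ∧ μ B' = 0 ∧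
      ∃ (m : ℕ) (γ : Fin m → (EucSp n ≃ₗᵢ[ℝ] EucSp n)) (P : Fin m → Set (Sph n)),
        (∀ i, IsRotation (γ i)) ∧
        (∀ i, MeasurableSet (P i)) ∧
        (∀ i j, i ≠ j → Disjoint (P i) (P j)) ∧
        (⋃ i, P i) = A \ A' ∧
        (∀ i j, i ≠ j → Disjoint (rotateSphere (γ i) '' P i) (rotateSphere (γ j) '' P j)) ∧
        (⋃ i, rotateSphere (γ i) '' P i) = B \ B' := by
  have := rotationGroup.smulInvariantMeasure hinv
  obtain ⟨Γ, c, hc, hΓ⟩ := rotationGroup.exists_finset_measureReal_smul_sdiff_ge (μ := μ) hn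
  exact rotationGroup.exists_equidecomposition hn μ hc hΓ hAm hBm hAi hBi hAB
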